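/- arXiv:2511.03863 — 6 statements merged into one kernel-verified Lean document; each statement's English description precedes it below -/
import Mathlib

section
/- If a matching covered graph G has a nontrivial tight cut, then G has a nontrivial tight cut C such that either C = δ(K) for some barrier B of G and some odd component K of G − B, or C = δ(U ∪ {u}) for some 2-separation {u,v} of G and some even component U of G − u − v. -/
open BigOperators

variable {V : Type*}

/-- A graph is matching covered if it is connected, has an edge, and every edge
lies in some perfect matching. -/
def MatchingCovered (G : SimpleGraph V) : Prop :=
  G.Connected ∧ G.edgeSet.Nonempty ∧
    ∀ e ∈ G.edgeSet, ∃ M : G.Subgraph, M.IsPerfectMatching ∧ e ∈ M.edgeSet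

/-- The cut `δ(U)`: edges of `G` with exactly one endpoint in `U`. -/
def cutSet (G : SimpleGraph V) (U : Set V) : Set (Sym2 V) :=
  {e | e ∈ G.edgeSet ∧ ∃ a b, e = s(a, b) ∧ a ∈ U ∧ b ∉ U}

/-- `K` is (the vertex set of) a connected component of the subgraph of `G`
induced on `S`. -/
def IsComponentOf (G : SimpleGraph V) (S : Set V) (K : Set V) : Prop :=
  ∃ c : (G.induce S).ConnectedComponent, K = Subtype.val '' c.supp

/-- A barrier: a set `B` of at least two vertices such that `G - B` has exactly
`|B|` odd components. -/
def IsBarrier [Fintype V] (G : SimpleGraph V) (B : Finset V) : Prop :=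
  2 ≤ B.card ∧
    Nat.card {K : Set V // IsComponentOf G ((B : Set V))ᶜ K ∧ Odd K.ncard} = B.card

/-- A 2-separation: distinct vertices `u, v` such that `G - u - v` has at least
two components of even cardinality. -/
def Is2Separation (G : SimpleGraph V) (u v : V) : Prop :=
  u ≠ v ∧ ∃ K₁ K₂ : Set V, K₁ ≠ K₂ ∧
    IsComponentOf G ({u, v} : Set V)ᶜ K₁ ∧ IsComponentOf G ({u, v} : Set V)ᶜ K₂ ∧
    Even K₁.ncard ∧ Even K₂.ncard

/-- `U` is the shore of an odd cut: both `U` and its complement have odd size. -/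
def IsOddCutShore [Fintype V] (U : Set V) : Prop := Odd U.ncard ∧ Odd Uᶜ.ncard

/-- `δ(U)` is a tight cut: an odd cut met exactly once by every perfect matching. -/
def IsTightCut [Fintype V] (G : SimpleGraph V) (U : Set V) : Prop :=
  IsOddCutShore U ∧ ∀ M : G.Subgraph, M.IsPerfectMatching →
    (M.edgeSet ∩ cutSet G U).ncard = 1


open Finset in
theorem zz_even_of_inv {V : Type*} [DecidableEq V] (s : Finset V) (σ : V → V)
    (h1 : ∀ v ∈ s, σ v ∈ s) (h2 : ∀ v ∈ s, σ (σ v) = v) (h3 : ∀ v ∈ s, σ v ≠ v) : Even s.card := by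
  have : (∑ v ∈ s, (1 : ZMod 2)) = 0 := by
    refine Finset.sum_involution (fun v _ => σ v) ?_ ?_ ?_ ?_
    · intros; decide
    · intro v hv _; exact h3 v hv
    · intro v hv; exact h1 v hv
    · intro v hv; exact h2 v hv
  simp at this
  exact (ZMod.natCast_eq_zero_iff_even).1 this

section duality
set_option linter.unusedSectionVars false
variable {V : Type*} [Fintype V] [DecidableEq V]

def zzWt (w : V → V → ℕ) (σ : V → V) : ℕ := ∑ v, w v (σ v)

def zzMax (w : V → V → ℕ) (σ : V → V) : Prop :=
  Function.Involutive σ ∧ ∀ τ, Function.Involutive τ → zzWt w τ ≤ zzWt w σ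

theorem zz_exists_max (w : V → V → ℕ) : ∃ σ, zzMax w σ := by
  classical
  obtain ⟨σ, h1, h2⟩ := Finset.exists_max_image
    (Finset.univ.filter (fun σ : V → V => Function.Involutive σ)) (zzWt w) ⟨id, Finset.mem_filter.2 ⟨Finset.mem_univ _, fun _ => rfl⟩⟩
  exact ⟨σ, by simpa using h1, fun τ hτ => h2 τ (by simpa using hτ)⟩

theorem zz_wt_even (w : V → V → ℕ) (hs : ∀ u v, w u v = w v u) (h0 : ∀ v, w v v = 0)
    (σ : V → V) (h : Function.Involutive σ) : Even (zzWt w σ) := by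
  have : (∑ v, ((w v (σ v) : ℕ) : ZMod 2)) = 0 := by
    refine Finset.sum_involution (fun v _ => σ v) ?_ ?_ ?_ ?_
    · intro v _
      rw [h v, hs (σ v) v]
      exact CharTwo.add_self_eq_zero _
    · intro v _ hv h'
      apply hv
      rw [h', h0]; simp
    · simp
    · intro v _; exact h v
  rw [← Nat.cast_sum] at this
  exact (ZMod.natCast_eq_zero_iff_even).1 this

theorem zz_prune (w : V → V → ℕ) (hs : ∀ u v, w u v = w v u) (h0 : ∀ v, w v v = 0)
    (σ : V → V) (h : zzMax w σ) : ∃ τ, zzMax w τ ∧ (∀ v, τ v ≠ v → 0 < w v (τ v)) ∧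
      ∀ v, w v (σ v) = 0 → τ v = v := by
  have hw : zzWt w (fun v => if 0 < w v (σ v) then σ v else v) = zzWt w σ := by
    unfold zzWt
    apply Finset.sum_congr rfl
    intro v _
    by_cases hv : 0 < w v (σ v)
    · simp [hv]
    · simp only [hv, if_false, h0]; omega
  refine ⟨fun v => if 0 < w v (σ v) then σ v else v, ⟨?_, ?_⟩, ?_, ?_⟩
  · intro v
    by_cases hv : 0 < w v (σ v)
    · have : 0 < w (σ v) v := by rw [hs]; exact hv
      simp [hv, h.1 v, this]
    · simp [hv]
  · intro τ hτ; rw [hw]; exact h.2 τ hτ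
  · intro v hv
    by_cases hv' : 0 < w v (σ v)
    · simp [hv']
    · simp [hv'] at hv
  · intro v hv; simp [hv]

theorem zz_orbit (M N : V → V) (hM : Function.Involutive M) (hN : Function.Involutive N)
    (t : V) (ht : N t = t) : ∃ S : Finset V, t ∈ S ∧ (∀ x ∈ S, M x ∈ S) ∧ (∀ x ∈ S, N x ∈ S) ∧
      ∀ x ∈ S, ∀ y ∈ S, M x = x → M y = y → x = y := by
  classical
  set m := hM.toPerm with hm
  set n := hN.toPerm with hn
  have mm : m * m = 1 := by ext x; simp [hm, hM x]
  have nn : n * n = 1 := by ext x; simp [hn, hN x]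
  have mi : m⁻¹ = m := by rw [inv_eq_iff_mul_eq_one, mm]
  have ni : n⁻¹ = n := by rw [inv_eq_iff_mul_eq_one, nn]
  have nt : n t = t := by simp [hn, ht]
  set r := n * m with hr
  have nrn : n * r * n⁻¹ = r⁻¹ := by
    rw [hr, mul_inv_rev, mi, ni]
    calc n * (n * m) * n = (n * n) * m * n := by group
      _ = m * n := by rw [nn]; group
  have nrk : ∀ k : ℤ, n ((r ^ k) t) = (r ^ (-k)) t := by
    intro k
    have : n * r ^ k * n⁻¹ = r ^ (-k) := by
      rw [← conj_zpow, nrn]; simp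
    have h2 : (n * r ^ k * n⁻¹) t = (r ^ (-k)) t := by rw [this]
    rw [ni] at h2
    simpa [Equiv.Perm.mul_apply, nt] using h2
  have mr : m = n * r := by rw [hr, ← mul_assoc, nn, one_mul]
  have mrk : ∀ k : ℤ, m ((r ^ k) t) = (r ^ (-(k+1))) t := by
    intro k
    have h1 : (r ^ (k+1)) t = r ((r ^ k) t) := by
      rw [add_comm, zpow_add, zpow_one]; rfl
    rw [← nrk, h1]
    conv_lhs => rw [mr]
    rfl
  refine ⟨Finset.univ.filter (fun x => ∃ k : ℤ, (r ^ k) t = x), ?_, ?_, ?_, ?_⟩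
  · simp; exact ⟨0, by simp⟩
  · intro x hx
    simp only [Finset.mem_filter, Finset.mem_univ, true_and] at hx ⊢
    obtain ⟨k, rfl⟩ := hx
    exact ⟨_, (mrk k).symm⟩
  · intro x hx
    simp only [Finset.mem_filter, Finset.mem_univ, true_and] at hx ⊢
    obtain ⟨k, rfl⟩ := hx
    exact ⟨_, (nrk k).symm⟩
  · intro x hx y hy h1 h2
    simp only [Finset.mem_filter, Finset.mem_univ, true_and] at hx hy
    obtain ⟨k, rfl⟩ := hx
    obtain ⟨l, rfl⟩ := hy
    have e1 : (r ^ (2*k+1)) t = t := by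
      have := (mrk k).symm.trans h1
      have h3 : (r ^ (k+1)) ((r ^ (-(k+1))) t) = (r ^ (k+1)) ((r ^ k) t) := by rw [this]
      rw [← Equiv.Perm.mul_apply, ← zpow_add, ← Equiv.Perm.mul_apply, ← zpow_add] at h3
      rw [show 2*k+1 = k+1+k by ring, ← h3]; simp
    have e2 : (r ^ (2*l+1)) t = t := by
      have := (mrk l).symm.trans h2
      have h3 : (r ^ (l+1)) ((r ^ (-(l+1))) t) = (r ^ (l+1)) ((r ^ l) t) := by rw [this]
      rw [← Equiv.Perm.mul_apply, ← zpow_add, ← Equiv.Perm.mul_apply, ← zpow_add] at h3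
      rw [show 2*l+1 = l+1+l by ring, ← h3]; simp
    have hst : ∀ a : ℤ, (r ^ a) t = t ↔ r ^ a ∈ MulAction.stabilizer (Equiv.Perm V) t := by
      intro a; rw [MulAction.mem_stabilizer_iff]; rfl
    rw [hst] at e1 e2
    have e3 : r ^ (k - l) ∈ MulAction.stabilizer (Equiv.Perm V) t := by
      have b := Subgroup.mul_mem _ (Subgroup.zpow_mem _ e1 (k - l - k)) (Subgroup.zpow_mem _ e2 k)
      rw [← zpow_mul, ← zpow_mul, ← zpow_add] at b
      convert b using 2
      ring
    rw [← hst] at e3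
    have : (r ^ l) ((r ^ (k - l)) t) = (r ^ l) t := by rw [e3]
    rw [← Equiv.Perm.mul_apply, ← zpow_add] at this
    rw [← this]; congr 2; ring

end duality

section duality2
set_option linter.unusedSectionVars false
variable {V : Type*} [Fintype V] [DecidableEq V]

theorem zz_gallai (w w' : V → V → ℕ) (K : Finset V) (hs : ∀ u v, w u v = w v u) (h0 : ∀ v, w v v = 0)
    (a : V) (ha : a ∈ K) (hKc : ∀ u ∈ K, ∀ v, 0 < w u v → v ∈ K)
    (hK : ∀ v ∈ K, Relation.ReflTransGen (fun u v => 0 < w u v) a v)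
    (hw' : ∀ u v, w' u v = if u ∈ K ∧ v ∈ K then w u v - 1 else w u v)
    (hN : ∀ t ∈ K, ∃ N, zzMax w N ∧ (∀ v, N v ≠ v → 0 < w v (N v)) ∧ N t = t) :
    Odd K.card ∧ ∃ M, zzMax w' M ∧ zzWt w M = zzWt w' M + (K.card - 1) := by
  classical
  have hs' : ∀ u v, w' u v = w' v u := by
    intro u v; rw [hw', hw', hs u v]; simp only [and_comm]
  have h0' : ∀ v, w' v v = 0 := by intro v; rw [hw', h0]; simp
  have hle : ∀ u v, w' u v ≤ w u v := by
    intro u v; rw [hw']; split_ifs <;> omega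
  let fx : (V → V) → ℕ := fun M => (K.filter (fun v => M v = v)).card
  have hfx : ∀ M : V → V, (∀ v, M v ≠ v → 0 < w v (M v)) →
      zzWt w M + fx M = zzWt w' M + K.card := by
    intro M hv
    have e1 : fx M = ∑ v, (if v ∈ K ∧ M v = v then 1 else 0) := by
      simp only [fx, Finset.sum_boole, Nat.cast_id]
      congr 1; ext v; simp
    have e2 : K.card = ∑ v, (if v ∈ K then 1 else 0) := by simp
    rw [e1, e2]
    unfold zzWt
    rw [← Finset.sum_add_distrib, ← Finset.sum_add_distrib]
    apply Finset.sum_congr rfl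
    intro v _
    rw [hw']
    by_cases hvK : v ∈ K
    · by_cases hMv : M v = v
      · simp [hvK, hMv, h0]
      · have := hv v hMv
        have h2 := hKc v hvK _ this
        simp [hvK, hMv, h2]; omega
    · simp [hvK]
  let O : Finset (V → V) := Finset.univ.filter
    (fun M => zzMax w' M ∧ ∀ v, M v ≠ v → 0 < w v (M v))
  have hO : ∀ M, M ∈ O ↔ zzMax w' M ∧ ∀ v, M v ≠ v → 0 < w v (M v) := by
    intro M; simp [O]
  have hOne : O.Nonempty := by
    obtain ⟨σ, hσ⟩ := zz_exists_max w'
    obtain ⟨τ, h1, h2, -⟩ := zz_prune w' hs' h0' σ hσ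
    exact ⟨τ, (hO τ).2 ⟨h1, fun v hv => lt_of_lt_of_le (h2 v hv) (hle _ _)⟩⟩
  obtain ⟨M0, hM0, hmin⟩ := Finset.exists_min_image O fx hOne
  let Best : (V → V) → Prop := fun M => M ∈ O ∧ ∀ M' ∈ O, fx M ≤ fx M'
  let rel : V → V → Prop := fun u v => u = v ∨ ∀ M, Best M → ¬ (M u = u ∧ M v = v)
  have rel_symm : ∀ u v, rel u v → rel v u := by
    rintro u v (h | h)
    · exact Or.inl h.symm
    · exact Or.inr fun M hM h' => h M hM h'.symm
  have hadj : ∀ t ∈ K, ∀ x ∈ K, 0 < w t x → rel t x := by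
    intro t htK x hxK htx
    by_cases htx' : t = x
    · exact Or.inl htx'
    refine Or.inr ?_
    rintro M ⟨hMO, hMb⟩ ⟨h1, h2⟩
    obtain ⟨hMm, hMv⟩ := (hO M).1 hMO
    let M' : V → V := fun v => if v = t then x else if v = x then t else M v
    have hne : ∀ v, v ≠ t → v ≠ x → M v ≠ t ∧ M v ≠ x := by
      intro v hv1 hv2
      refine ⟨fun h => hv1 ?_, fun h => hv2 ?_⟩
      · rw [← hMm.1 v, h, h1]
      · rw [← hMm.1 v, h, h2]
    have hM'i : Function.Involutive M' := by
      intro v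
      by_cases hv1 : v = t
      · subst hv1; simp [M', Ne.symm htx']
      · by_cases hv2 : v = x
        · subst hv2; simp [M', hv1]
        · simp [M', hv1, hv2, hne v hv1 hv2, hMm.1 v]
    have hM'w : zzWt w' M ≤ zzWt w' M' := by
      apply Finset.sum_le_sum
      intro v _
      by_cases hv1 : v = t
      · subst hv1; simp [h1, h0']
      · by_cases hv2 : v = x
        · subst hv2; simp [h2, h0']
        · simp [M', hv1, hv2]
    have hM'O : M' ∈ O := by
      refine (hO _).2 ⟨⟨hM'i, fun τ hτ => (hMm.2 τ hτ).trans hM'w⟩, ?_⟩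
      intro v hv
      by_cases hv1 : v = t
      · subst hv1; simpa [M'] using htx
      · by_cases hv2 : v = x
        · subst hv2; simp only [M', hv1, if_true, if_false]; rw [hs]; exact htx
        · simp only [M', hv1, hv2, if_false] at hv ⊢; exact hMv v hv
    have : fx M' < fx M := by
      apply Finset.card_lt_card
      rw [Finset.ssubset_iff_of_subset]
      · refine ⟨t, by simp [htK, h1], ?_⟩
        simp [M', Ne.symm htx']
      · intro v hv
        simp only [Finset.mem_filter] at hv ⊢
        refine ⟨hv.1, ?_⟩
        by_cases hv1 : v = t
        · subst hv1; exact h1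
        · by_cases hv2 : v = x
          · subst hv2; exact h2
          · simpa [M', hv1, hv2] using hv.2
    have := hMb M' hM'O
    omega
  have htrans : ∀ u ∈ K, ∀ t ∈ K, ∀ v ∈ K, rel u t → rel t v → rel u v := by
    intro u huK t htK v hvK hut htv
    rcases hut with rfl | hut
    · exact htv
    rcases htv with rfl | htv
    · exact Or.inr hut
    by_cases huv : u = v
    · exact Or.inl huv
    refine Or.inr ?_
    rintro M ⟨hMO, hMb⟩ ⟨h1, h2⟩
    obtain ⟨hMm, hMv⟩ := (hO M).1 hMO
    obtain ⟨N, hNm, hNv, hNt⟩ := hN t htK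
    obtain ⟨S, htS, hSM, hSN, hSu⟩ := zz_orbit M N hMm.1 hNm.1 t hNt
    have hSM' : ∀ x, M x ∈ S ↔ x ∈ S := fun x =>
      ⟨fun h => by have := hSM _ h; rwa [hMm.1 x] at this, hSM x⟩
    have hSN' : ∀ x, N x ∈ S ↔ x ∈ S := fun x =>
      ⟨fun h => by have := hSN _ h; rwa [hNm.1 x] at this, hSN x⟩
    let M' : V → V := fun x => if x ∈ S then N x else M x
    let N' : V → V := fun x => if x ∈ S then M x else N x
    have hM'i : Function.Involutive M' := by
      intro x
      by_cases hx : x ∈ S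
      · simp [M', hx, hSN', hNm.1 x]
      · simp [M', hx, hSM', hMm.1 x]
    have hN'i : Function.Involutive N' := by
      intro x
      by_cases hx : x ∈ S
      · simp [N', hx, hSM', hMm.1 x]
      · simp [N', hx, hSN', hNm.1 x]
    have hsum : zzWt w M' + zzWt w N' = zzWt w M + zzWt w N := by
      unfold zzWt
      rw [← Finset.sum_add_distrib, ← Finset.sum_add_distrib]
      apply Finset.sum_congr rfl
      intro x _
      by_cases hx : x ∈ S
      · simp [M', N', hx]; omega
      · simp [M', N', hx]
    have hM'v : ∀ x, M' x ≠ x → 0 < w x (M' x) := by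
      intro x hx
      by_cases hxS : x ∈ S
      · simp only [M', hxS, if_true] at hx ⊢; exact hNv x hx
      · simp only [M', hxS, if_false] at hx ⊢; exact hMv x hx
    have hfx' : fx M ≤ fx M' := by
      refine Finset.card_le_card_of_injOn (fun x => if x ∈ S then t else x) ?_ ?_
      · intro x hx
        simp only [Finset.coe_filter, Set.mem_ofPred_eq] at hx ⊢
        by_cases hxS : x ∈ S
        · simp [hxS, M', htK, htS, hNt]
        · simp [hxS, M', hx]
      · intro x hx y hy hxy
        simp only [Finset.coe_filter, Set.mem_ofPred_eq] at hx hy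
        by_cases hxS : x ∈ S
        · by_cases hyS : y ∈ S
          · exact hSu x hxS y hyS hx.2 hy.2
          · simp only [hxS, hyS, if_true, if_false] at hxy
            exact absurd (hxy ▸ htS) hyS
        · by_cases hyS : y ∈ S
          · simp only [hxS, hyS, if_true, if_false] at hxy
            exact absurd (hxy ▸ htS) hxS
          · simpa [hxS, hyS] using hxy
    have e1 := hfx M hMv
    have e2 := hfx M' hM'v
    have e3 := hNm.2 N' hN'i
    have e4 := hMm.2 M' hM'i
    have hB : Best M' := by
      refine ⟨(hO _).2 ⟨⟨hM'i, fun τ hτ => (hMm.2 τ hτ).trans (by omega)⟩, hM'v⟩, fun M'' h'' => ?_⟩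
      have := hMb M'' h''
      omega
    have ht' : M' t = t := by simp [M', htS, hNt]
    by_cases huS : u ∈ S
    · have hvS : v ∉ S := fun hvS => huv (hSu u huS v hvS h1 h2)
      exact htv M' hB ⟨ht', by simp [M', hvS, h2]⟩
    · exact hut M' hB ⟨by simp [M', huS, h1], ht'⟩
  have hall : ∀ v ∈ K, rel a v := by
    intro v hv
    have : v ∈ K ∧ rel a v := by
      have hr := hK v hv
      clear hv
      induction hr with
      | refl => exact ⟨ha, Or.inl rfl⟩
      | tail _ hbc ih =>
        have hc := hKc _ ih.1 _ hbc
        exact ⟨hc, htrans a ha _ ih.1 _ hc ih.2 (hadj _ ih.1 _ hc hbc)⟩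
    exact this.2
  have hB0 : Best M0 := ⟨hM0, hmin⟩
  obtain ⟨hMm, hMv⟩ := (hO M0).1 hM0
  have f1 : fx M0 ≤ 1 := by
    rw [Finset.card_le_one]
    intro u hu v hv
    simp only [Finset.mem_filter] at hu hv
    rcases htrans u hu.1 a ha v hv.1 (rel_symm _ _ (hall u hu.1)) (hall v hv.1) with h | h
    · exact h
    · exact absurd ⟨hu.2, hv.2⟩ (h M0 hB0)
  have f0 : fx M0 ≠ 0 := by
    intro hf
    obtain ⟨N, hNm, hNv, hNt⟩ := hN a ha
    have e1 := hfx M0 hMv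
    have e2 := hfx N hNv
    have e3 := hMm.2 N hNm.1
    have e4 := hNm.2 M0 hMm.1
    have e5 : 0 < fx N := Finset.card_pos.2 ⟨a, by simp [ha, hNt]⟩
    omega
  have f : fx M0 = 1 := by omega
  have hodd : Odd K.card := by
    have := Finset.card_filter_add_card_filter_not (s := K) (fun v => M0 v = v)
    have hev : Even (K.filter (fun v => ¬ M0 v = v)).card := by
      apply zz_even_of_inv _ M0
      · intro v hv
        simp only [Finset.mem_filter] at hv ⊢
        refine ⟨hKc v hv.1 _ (hMv v hv.2), fun h => hv.2 ?_⟩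
        rw [hMm.1 v] at h; exact h.symm
      · intro v _; exact hMm.1 v
      · intro v hv; simp only [Finset.mem_filter] at hv; exact hv.2
    change fx M0 + _ = _ at this
    rw [← this, f, add_comm]
    exact hev.add_one
  refine ⟨hodd, M0, hMm, ?_⟩
  have := hfx M0 hMv
  have := hodd.pos
  omega

theorem zz_dual (n : ℕ) : ∀ (w : V → V → ℕ), (∀ u v, w u v = w v u) → (∀ v, w v v = 0) →
    (∑ u, ∑ v, w u v = n) →
    ∃ (y : V → ℕ) (z : Finset V → ℕ) (σ : V → V), Function.Involutive σ ∧
      (∀ U, z U ≠ 0 → Odd U.card) ∧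
      (∀ u v, u ≠ v → w u v ≤ y u + y v + ∑ U, if u ∈ U ∧ v ∈ U then z U else 0) ∧
      2 * ∑ v, y v + ∑ U, z U * (U.card - 1) ≤ zzWt w σ := by
  classical
  induction n using Nat.strong_induction_on with
  | _ n ih =>
  intro w hs h0 hn
  by_cases hw : ∀ u v, w u v = 0
  · exact ⟨0, 0, id, fun _ => rfl, by simp, by simp [hw], by simp⟩
  push Not at hw
  obtain ⟨a, b, hab⟩ := hw
  by_cases hc : ∃ u, ∀ σ, zzMax w σ → 0 < w u (σ u)
  · obtain ⟨u, hu⟩ := hc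
    let w' : V → V → ℕ := fun x y => if x = u ∨ y = u then w x y - 1 else w x y
    have hs' : ∀ u v, w' u v = w' v u := by
      intro x y; simp only [w', hs x y, or_comm]
    have h0' : ∀ v, w' v v = 0 := by intro v; simp [w', h0]
    have hle : ∀ x y, w' x y ≤ w x y := by
      intro x y; simp only [w']; split_ifs <;> omega
    obtain ⟨σ, hσ⟩ := zz_exists_max w
    have hlt : ∑ x, ∑ y, w' x y < n := by
      rw [← hn]
      apply Finset.sum_lt_sum
      · intro x _; exact Finset.sum_le_sum fun y _ => hle x y
      · refine ⟨u, Finset.mem_univ _, Finset.sum_lt_sum (fun y _ => hle u y) ⟨σ u, Finset.mem_univ _, ?_⟩⟩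
        have := hu σ hσ
        simp [w']; omega
    obtain ⟨y, z, τ, hτ, hz, hcov, hval⟩ := ih _ hlt w' hs' h0' rfl
    have key : zzWt w' τ + 2 ≤ zzWt w σ := by
      by_cases hτu : 0 < w u (τ u)
      · refine le_trans ?_ (hσ.2 τ hτ)
        have hne : τ u ≠ u := by intro h; rw [h, h0] at hτu; omega
        have e : ∑ x, (if x = u ∨ x = τ u then 1 else 0) = 2 := by
          rw [Finset.sum_boole]
          have : Finset.univ.filter (fun x => x = u ∨ x = τ u) = {u, τ u} := by ext; simp
          rw [this, Finset.card_pair hne.symm]; rfl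
        rw [← e]; unfold zzWt; rw [← Finset.sum_add_distrib]
        apply Finset.sum_le_sum
        intro x _
        by_cases h1 : x = u
        · subst h1; simp [w']; omega
        · by_cases h2 : x = τ u
          · subst h2
            have := hs (τ u) u
            simp [w', hτ u]; omega
          · have h3 : τ x ≠ u := fun h => h2 (by rw [← h, hτ x])
            simp [w', h1, h2, h3]
      · have e1 : zzWt w' τ ≤ zzWt w τ := Finset.sum_le_sum fun x _ => hle _ _
        have e2 : zzWt w τ ≤ zzWt w σ := hσ.2 τ hτ
        have e3 : zzWt w τ ≠ zzWt w σ := by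
          intro h
          exact hτu (hu τ ⟨hτ, fun ρ hρ => h ▸ hσ.2 ρ hρ⟩)
        obtain ⟨i, hi⟩ := zz_wt_even w hs h0 τ hτ
        obtain ⟨j, hj⟩ := zz_wt_even w hs h0 σ hσ.1
        omega
    refine ⟨fun v => y v + if v = u then 1 else 0, z, σ, hσ.1, hz, ?_, ?_⟩
    · intro p q hpq
      have h1 := hcov p q hpq
      have h2 : w p q ≤ w' p q + (if p = u then 1 else 0) + (if q = u then 1 else 0) := by
        simp only [w']; split_ifs <;> simp_all <;> omega
      beta_reduce
      omega
    · rw [Finset.sum_add_distrib]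
      simp only [Finset.sum_ite_eq', Finset.mem_univ, if_true]
      omega
  · push Not at hc
    let K : Finset V := Finset.univ.filter (fun v => Relation.ReflTransGen (fun u v => 0 < w u v) a v)
    have hKm : ∀ v, v ∈ K ↔ Relation.ReflTransGen (fun u v => 0 < w u v) a v := by intro v; simp [K]
    let w' : V → V → ℕ := fun u v => if u ∈ K ∧ v ∈ K then w u v - 1 else w u v
    have hle : ∀ x y, w' x y ≤ w x y := by
      intro x y; simp only [w']; split_ifs <;> omega
    have haK : a ∈ K := (hKm a).2 .refl
    have hKc : ∀ u ∈ K, ∀ v, 0 < w u v → v ∈ K := fun u hu v huv =>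
      (hKm v).2 (((hKm u).1 hu).tail huv)
    have hN : ∀ t ∈ K, ∃ N, zzMax w N ∧ (∀ v, N v ≠ v → 0 < w v (N v)) ∧ N t = t := by
      intro t _
      obtain ⟨σ, hσ, hσt⟩ := hc t
      obtain ⟨N, h1, h2, h3⟩ := zz_prune w hs h0 σ hσ
      exact ⟨N, h1, h2, h3 t (by omega)⟩
    obtain ⟨hodd, M, hM, hMw⟩ := zz_gallai w w' K hs h0 a haK hKc (fun v hv => (hKm v).1 hv)
      (fun _ _ => rfl) hN
    have hlt : ∑ x, ∑ y, w' x y < n := by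
      rw [← hn]
      apply Finset.sum_lt_sum
      · intro x _; exact Finset.sum_le_sum fun y _ => hle x y
      · refine ⟨a, Finset.mem_univ _, Finset.sum_lt_sum (fun y _ => hle a y) ⟨b, Finset.mem_univ _, ?_⟩⟩
        have hb : b ∈ K := hKc a haK b (by omega)
        simp [w', haK, hb]; omega
    have hs' : ∀ u v, w' u v = w' v u := by
      intro x y; simp only [w', hs x y, and_comm]
    obtain ⟨y, z, τ, hτ, hz, hcov, hval⟩ := ih _ hlt w' hs' (fun v => by simp [w', h0]) rfl
    refine ⟨y, fun U => z U + if U = K then 1 else 0, M, hM.1, ?_, ?_, ?_⟩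
    · intro U hU
      by_cases h : U = K
      · exact h ▸ hodd
      · simp [h] at hU; exact hz U hU
    · intro p q hpq
      have h1 := hcov p q hpq
      have h2 : w p q ≤ w' p q + (if p ∈ K ∧ q ∈ K then 1 else 0) := by
        simp only [w']; split_ifs <;> omega
      have h3 : (∑ U, if p ∈ U ∧ q ∈ U then (z U + if U = K then 1 else 0) else 0) =
          (∑ U, if p ∈ U ∧ q ∈ U then z U else 0) + (if p ∈ K ∧ q ∈ K then 1 else 0) := by
        have : (if p ∈ K ∧ q ∈ K then 1 else 0) =
          ∑ U : Finset V, if U = K then (if p ∈ U ∧ q ∈ U then 1 else 0) else 0 := by simp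
        rw [this, ← Finset.sum_add_distrib]
        apply Finset.sum_congr rfl
        intro U _
        split_ifs <;> simp
      rw [h3]; omega
    · have h3 : ∑ U : Finset V, (z U + if U = K then 1 else 0) * (U.card - 1) =
          (∑ U : Finset V, z U * (U.card - 1)) + (K.card - 1) := by
        simp only [add_mul, Finset.sum_add_distrib, ite_mul, one_mul, zero_mul, Finset.sum_ite_eq',
          Finset.mem_univ, if_true]
      rw [h3, hMw]
      have := hM.2 τ hτ
      omega
end duality2

section graph
set_option linter.unusedSectionVars false
variable {V : Type*} [Fintype V] [DecidableEq V]

def zzPM (G : SimpleGraph V) (σ : V → V) : Prop :=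
  Function.Involutive σ ∧ ∀ v, G.Adj v (σ v)

def zzEx (σ : V → V) (U : Finset V) : ℕ := (U.filter (fun v => σ v ∉ U)).card

def zzTight (G : SimpleGraph V) (U : Finset V) : Prop :=
  Odd U.card ∧ ∀ σ, zzPM G σ → zzEx σ U = 1

def zzChi (U : Finset V) (a b : V) : ℤ := if (a ∈ U ↔ b ∈ U) then 0 else 1

theorem zz_in_even (σ : V → V) (hσ : Function.Involutive σ) (hf : ∀ v, σ v ≠ v) (U : Finset V) :
    Even (U.filter (fun v => σ v ∈ U)).card := by
  apply zz_even_of_inv _ σ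
  · intro v hv
    simp only [Finset.mem_filter] at hv ⊢
    exact ⟨hv.2, by rw [hσ v]; exact hv.1⟩
  · intro v _; exact hσ v
  · intro v _; exact hf v

theorem zz_in_add_ex (σ : V → V) (U : Finset V) :
    (U.filter (fun v => σ v ∈ U)).card + zzEx σ U = U.card :=
  Finset.card_filter_add_card_filter_not (s := U) (fun v => σ v ∈ U)

theorem zz_ex_odd (σ : V → V) (hσ : Function.Involutive σ) (hf : ∀ v, σ v ≠ v) (U : Finset V) :
    Odd (zzEx σ U) ↔ Odd U.card := by
  have h1 := zz_in_even σ hσ hf U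
  rw [← zz_in_add_ex σ U, Nat.odd_add]
  constructor
  · intro h; constructor
    · intro h'; exact absurd h1 (by simpa using h')
    · intro h'; exact absurd h (by simpa using h')
  · intro h
    by_contra h'
    have := h.2 (by simpa using h')
    exact absurd h1 (by simpa using this)

theorem zz_ex_compl (σ : V → V) (hσ : Function.Involutive σ) (U : Finset V) :
    zzEx σ Uᶜ = zzEx σ U := by
  unfold zzEx
  apply Finset.card_bij' (fun v _ => σ v) (fun v _ => σ v)
  · intro v hv; simp at hv ⊢; exact ⟨hv.2, by rw [hσ v]; exact hv.1⟩
  · intro v hv; simp at hv ⊢; exact ⟨hv.2, by rw [hσ v]; exact hv.1⟩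
  · intro v _; exact hσ v
  · intro v _; exact hσ v

theorem zz_pm_ne {G : SimpleGraph V} {σ : V → V} (h : zzPM G σ) (v : V) : σ v ≠ v :=
  fun h' => (h.2 v).ne h'.symm

theorem zz_card_even {G : SimpleGraph V} {σ : V → V} (h : zzPM G σ) : Even (Fintype.card V) :=
  zz_even_of_inv Finset.univ σ (by simp) (fun v _ => h.1 v) (fun v _ => zz_pm_ne h v)

theorem zz_tight_compl {G : SimpleGraph V} {σ : V → V} (h : zzPM G σ) {U : Finset V}
    (hU : zzTight G U) : zzTight G Uᶜ := by
  refine ⟨?_, fun τ hτ => by rw [zz_ex_compl τ hτ.1, hU.2 τ hτ]⟩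
  have h1 := Finset.card_add_card_compl U
  have h2 := zz_card_even h
  rw [← h1, Nat.even_add'] at h2
  exact h2.1 hU.1

theorem zz_chi_sum (σ : V → V) (hσ : Function.Involutive σ) (U : Finset V) :
    ∑ v, (if (v ∈ U ↔ σ v ∈ U) then 0 else 1) = 2 * zzEx σ U := by
  have h1 : zzEx σ U = ∑ v, (if v ∈ U ∧ σ v ∉ U then 1 else 0) := by
    rw [Finset.sum_boole, zzEx]; simp only [Nat.cast_id]; congr 1; ext; simp
  have h2 : zzEx σ Uᶜ = ∑ v, (if v ∉ U ∧ σ v ∈ U then 1 else 0) := by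
    rw [Finset.sum_boole, zzEx]; simp only [Nat.cast_id]; congr 1; ext; simp
  rw [two_mul]
  nth_rw 2 [← zz_ex_compl σ hσ]
  rw [h1, h2, ← Finset.sum_add_distrib]
  apply Finset.sum_congr rfl
  intro v _
  by_cases a : v ∈ U <;> by_cases b : σ v ∈ U <;> simp [a, b]

theorem zz_chi_compl (U : Finset V) (a b : V) : zzChi Uᶜ a b = zzChi U a b := by
  unfold zzChi; simp [not_iff_not]

theorem zz_multi (z : Finset V → ℕ) (f : Finset V → ℤ) (s : Finset (Finset V)) :
    ((∑ U ∈ s, z U • ({U} : Multiset (Finset V))).map f).sum = ∑ U ∈ s, (z U : ℤ) * f U := by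
  classical
  induction s using Finset.induction_on with
  | empty => simp
  | insert U s hU ih => 
    rw [Finset.sum_insert hU, Finset.sum_insert hU, Multiset.map_add, Multiset.sum_add, ih]
    simp [Multiset.map_nsmul, Multiset.sum_nsmul]

theorem zz_relation (G : SimpleGraph V) (hmc : ∀ a b, G.Adj a b → ∃ σ, zzPM G σ ∧ σ a = b)
    (X : Finset V) (hX : zzTight G X) :
    ∃ (L : Multiset (Finset V)) (l : V → ℤ), X ∈ L ∧ (∀ U ∈ L, zzTight G U) ∧
      ∀ a b, G.Adj a b → (L.map (fun U => zzChi U a b)).sum = l a + l b := by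
  classical
  set n := Fintype.card V with hn
  let w : V → V → ℕ := fun a b => if G.Adj a b then n + (if (a ∈ X ↔ b ∈ X) then 0 else 1) else 0
  have hs : ∀ u v, w u v = w v u := by
    intro u v; simp only [w, G.adj_comm u v]
    congr 2; simp only [iff_comm]
  have h0 : ∀ v, w v v = 0 := by intro v; simp [w]
  obtain ⟨y, z, τ, hτ, hz, hcov, hval⟩ := zz_dual _ w hs h0 rfl
  have hpm : ∀ σ, zzPM G σ → zzWt w σ = n * n + 2 := by
    intro σ hσ
    have : zzWt w σ = ∑ v, (n + (if (v ∈ X ↔ σ v ∈ X) then 0 else 1)) := by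
      unfold zzWt; apply Finset.sum_congr rfl; intro v _; simp only [w, hσ.2 v, if_true]
    rw [this, Finset.sum_add_distrib, zz_chi_sum σ hσ.1, hX.2 σ hσ]
    simp [hn]
  have hup : zzWt w τ ≤ n * n + 2 := by
    by_cases h : ∀ v, G.Adj v (τ v)
    · exact (hpm τ ⟨hτ, h⟩).le
    · push Not at h
      obtain ⟨v0, hv0⟩ := h
      have : zzWt w τ ≤ ∑ v, (if v = v0 then 0 else (n + 1)) := by
        apply Finset.sum_le_sum
        intro v _
        by_cases hv : v = v0
        · subst hv; simp [w, hv0]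
        · simp only [w, hv, if_false]; split_ifs <;> omega
      have e : ∑ v, (if v = v0 then 0 else (n + 1)) + (n + 1) = n * (n + 1) := by
        have : (n + 1) = ∑ v, (if v = v0 then (n + 1) else 0) := by simp
        conv_lhs => rhs; rw [this]
        rw [← Finset.sum_add_distrib]
        have : ∀ v, ((if v = v0 then 0 else (n + 1)) + (if v = v0 then (n + 1) else 0)) = n + 1 := by
          intro v; split_ifs <;> simp
        simp only [this]; simp [hn]
      nlinarith
  let R : V → V → ℕ := fun a b => y a + y b + ∑ U, if a ∈ U ∧ b ∈ U then z U else 0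
  have hmain : ∀ σ, zzPM G σ → (∀ v, w v (σ v) = R v (σ v)) ∧
      ∀ U, z U * (U.filter (fun v => σ v ∈ U)).card = z U * (U.card - 1) := by
    intro σ hσ
    have i1 : ∀ v ∈ Finset.univ, w v (σ v) ≤ R v (σ v) := fun v _ => hcov _ _ (zz_pm_ne hσ v).symm
    have i2 : ∀ U ∈ Finset.univ, z U * (U.filter (fun v => σ v ∈ U)).card ≤ z U * (U.card - 1) := by
      intro U _
      by_cases hzU : z U = 0
      · simp [hzU]
      · apply Nat.mul_le_mul_left
        have h1 := (zz_ex_odd σ hσ.1 (zz_pm_ne hσ) U).2 (hz U hzU)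
        have h2 := zz_in_add_ex σ U
        have := h1.pos
        omega
    have e1 : ∑ v, R v (σ v) = 2 * ∑ v, y v + ∑ U : Finset V, z U * (U.filter (fun v => σ v ∈ U)).card := by
      simp only [R, Finset.sum_add_distrib]
      have : ∑ v, y (σ v) = ∑ v, y v := Equiv.sum_comp hσ.1.toPerm y
      rw [this, Finset.sum_comm, two_mul]
      congr 1
      apply Finset.sum_congr rfl
      intro U _
      rw [← Finset.sum_filter, Finset.sum_const, smul_eq_mul, mul_comm]
      congr 2; ext; simp
    have s1 := Finset.sum_le_sum i1
    have s2 := Finset.sum_le_sum i2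
    have e2 := hpm σ hσ
    unfold zzWt at e2
    refine ⟨?_, ?_⟩
    · have := (Finset.sum_eq_sum_iff_of_le i1).1 (by omega)
      intro v; exact this v (Finset.mem_univ _)
    · have := (Finset.sum_eq_sum_iff_of_le i2).1 (by omega)
      intro v; exact this v (Finset.mem_univ _)
  refine ⟨X ::ₘ X ::ₘ ∑ U, z U • ({U} : Multiset (Finset V)),
    fun v => 2 * y v + (∑ U : Finset V, (if v ∈ U then (z U : ℤ) else 0)) - n, by simp, ?_, ?_⟩
  · intro U hU
    rw [Multiset.mem_cons, Multiset.mem_cons, Multiset.mem_sum] at hU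
    rcases hU with rfl | rfl | ⟨U', -, hU'⟩
    · exact hX
    · exact hX
    · have hzz : z U' ≠ 0 := by intro h; simp [h] at hU'
      have := Multiset.mem_of_mem_nsmul hU'
      rw [Multiset.mem_singleton] at this
      subst this
      refine ⟨hz U hzz, fun σ hσ => ?_⟩
      have h1 := Nat.eq_of_mul_eq_mul_left (Nat.pos_of_ne_zero hzz) ((hmain σ hσ).2 U)
      have h2 := zz_in_add_ex σ U
      have := (hz U hzz).pos
      omega
  · intro a b hab
    obtain ⟨σ, hσ, rfl⟩ := hmc a b hab
    have h := (hmain σ hσ).1 a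
    simp only [Multiset.map_cons, Multiset.sum_cons]
    rw [zz_multi]
    simp only [w, hab, if_true, R] at h
    have h' : (n : ℤ) + zzChi X a (σ a) = y a + y (σ a) + ∑ U : Finset V, if a ∈ U ∧ σ a ∈ U then (z U : ℤ) else 0 := by
      have := congrArg (Nat.cast : ℕ → ℤ) h
      push_cast at this
      rw [← this, zzChi]
    have e : ∑ U : Finset V, (z U : ℤ) * zzChi U a (σ a) + 2 * (∑ U : Finset V, if a ∈ U ∧ σ a ∈ U then (z U : ℤ) else 0)
        = (∑ U : Finset V, (if a ∈ U then (z U : ℤ) else 0)) + ∑ U : Finset V, (if σ a ∈ U then (z U : ℤ) else 0) := by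
      rw [Finset.mul_sum, ← Finset.sum_add_distrib, ← Finset.sum_add_distrib]
      apply Finset.sum_congr rfl
      intro U _
      by_cases h1 : a ∈ U <;> by_cases h2 : σ a ∈ U <;> simp [zzChi, h1, h2] <;> ring
    linarith
end graph

section tree
set_option linter.unusedSectionVars false
variable {V : Type*} [Fintype V] [DecidableEq V]

theorem zz_uncross (G : SimpleGraph V) (hmc : ∀ a b, G.Adj a b → ∃ σ, zzPM G σ ∧ σ a = b)
    (X Y : Finset V) (hX : zzTight G X) (hY : zzTight G Y) (hodd : Odd (X ∩ Y).card) :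
    zzTight G (X ∩ Y) ∧ zzTight G (X ∪ Y) ∧ ∀ a ∈ X \ Y, ∀ b ∈ Y \ X, ¬ G.Adj a b := by
  have hodd2 : Odd (X ∪ Y).card := by
    have h1 := Finset.card_union_add_card_inter X Y
    obtain ⟨i, hi⟩ := hX.1
    obtain ⟨j, hj⟩ := hY.1
    obtain ⟨k, hk⟩ := hodd
    rw [Nat.odd_iff]; omega
  have hEx : ∀ (σ : V → V) (U : Finset V), zzEx σ U = ∑ v, (if v ∈ U ∧ σ v ∉ U then 1 else 0) := by
    intro σ U
    rw [Finset.sum_boole, zzEx]; simp only [Nat.cast_id]; congr 1; ext; simp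
  have key : ∀ σ, zzPM G σ → zzEx σ (X ∩ Y) = 1 ∧ zzEx σ (X ∪ Y) = 1 ∧
      ∀ a ∈ X \ Y, σ a ∉ Y \ X := by
    intro σ hσ
    have e : zzEx σ (X ∩ Y) + zzEx σ (X ∪ Y) + (Finset.univ.filter (fun a => a ∈ X \ Y ∧ σ a ∈ Y \ X)).card
        ≤ zzEx σ X + zzEx σ Y := by
      have : (Finset.univ.filter (fun a => a ∈ X \ Y ∧ σ a ∈ Y \ X)).card =
        ∑ a, (if a ∈ X \ Y ∧ σ a ∈ Y \ X then 1 else 0) := by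
          rw [Finset.sum_boole]; simp
      rw [this]
      simp only [hEx]
      simp only [← Finset.sum_add_distrib]
      apply Finset.sum_le_sum
      intro v _
      by_cases a : v ∈ X <;> by_cases b : v ∈ Y <;> by_cases c : σ v ∈ X <;> by_cases d : σ v ∈ Y <;>
        simp [a, b, c, d]
    have o1 := ((zz_ex_odd σ hσ.1 (zz_pm_ne hσ) (X ∩ Y)).2 hodd).pos
    have o2 := ((zz_ex_odd σ hσ.1 (zz_pm_ne hσ) (X ∪ Y)).2 hodd2).pos
    rw [hX.2 σ hσ, hY.2 σ hσ] at e
    refine ⟨by omega, by omega, ?_⟩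
    intro a ha hb
    have : 0 < (Finset.univ.filter (fun a => a ∈ X \ Y ∧ σ a ∈ Y \ X)).card :=
      Finset.card_pos.2 ⟨a, by simp only [Finset.mem_filter, Finset.mem_univ, true_and]; exact ⟨ha, hb⟩⟩
    omega
  refine ⟨⟨hodd, fun σ hσ => (key σ hσ).1⟩, ⟨hodd2, fun σ hσ => (key σ hσ).2.1⟩, ?_⟩
  intro a ha b hb hab
  obtain ⟨σ, hσ, rfl⟩ := hmc a b hab
  exact (key σ hσ).2.2 a ha hb

theorem zz_shore_const {α : Type*} (G : SimpleGraph V) (hmc : ∀ a b, G.Adj a b → ∃ σ, zzPM G σ ∧ σ a = b)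
    (hcon : ∀ S : Finset V, S.Nonempty → Sᶜ.Nonempty → ∃ a ∈ S, ∃ b ∉ S, G.Adj a b)
    (Z : Finset V) (hZ : zzTight G Z) (f : V → α)
    (hf : ∀ a ∈ Z, ∀ b ∈ Z, G.Adj a b → f a = f b) : ∀ a ∈ Z, ∀ b ∈ Z, f a = f b := by
  classical
  have main : ∀ B ⊆ Z, Even B.card → B.Nonempty → (∀ a ∈ B, ∀ b ∈ Z, b ∉ B → ¬ G.Adj a b) → False := by
    intro B hBZ hBe hBne hB
    have hBc : Bᶜ.Nonempty := by
      rw [Finset.nonempty_iff_ne_empty]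
      intro h
      rw [Finset.compl_eq_empty_iff] at h
      have : B = Z := Finset.Subset.antisymm hBZ (by rw [h]; exact Finset.subset_univ _)
      rw [this] at hBe
      exact (Nat.not_even_iff_odd.2 hZ.1) hBe
    obtain ⟨a, ha, b, hb, hab⟩ := hcon B hBne hBc
    obtain ⟨σ, hσ, rfl⟩ := hmc a b hab
    have h1 : ¬ Odd (zzEx σ B) := by
      rw [zz_ex_odd σ hσ.1 (zz_pm_ne hσ)]; exact Nat.not_odd_iff_even.2 hBe
    have h2 : 0 < zzEx σ B := Finset.card_pos.2 ⟨a, by simp [ha, hb]⟩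
    have h3 : zzEx σ B ≤ zzEx σ Z := by
      apply Finset.card_le_card
      intro v hv
      simp only [Finset.mem_filter] at hv ⊢
      exact ⟨hBZ hv.1, fun h => hB v hv.1 _ h hv.2 (hσ.2 v)⟩
    rw [hZ.2 σ hσ] at h3
    have : zzEx σ B = 1 := by omega
    rw [this] at h1; exact h1 odd_one
  intro a ha b hb
  by_contra hne
  let A := Z.filter (fun v => f v = f a)
  let B := Z.filter (fun v => ¬ f v = f a)
  have hAB : A.card + B.card = Z.card := Finset.card_filter_add_card_filter_not (s := Z) (fun v => f v = f a)
  by_cases hA : Even A.card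
  · refine main A (Finset.filter_subset _ _) hA ⟨a, by simp [A, ha]⟩ ?_
    intro x hx y hy hyA hxy
    simp only [A, Finset.mem_filter] at hx hyA
    exact hyA ⟨hy, (hf x hx.1 y hy hxy) ▸ hx.2⟩
  · have hB : Even B.card := by
      have := hZ.1
      rw [← hAB, Nat.odd_add] at this
      exact this.1 (Nat.not_even_iff_odd.1 hA)
    refine main B (Finset.filter_subset _ _) hB ⟨b, by simp [B, hb, Ne.symm hne]⟩ ?_
    intro x hx y hy hyB hxy
    simp only [B, Finset.mem_filter] at hx hyB
    exact hyB ⟨hy, (hf x hx.1 y hy hxy) ▸ hx.2⟩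

def zzBi (G : SimpleGraph V) : Prop := ∀ p q : V, p ≠ q → ∃ τ : V → V, Function.Involutive τ ∧
  τ p = q ∧ ∀ v, v ≠ p → v ≠ q → G.Adj v (τ v)

theorem zz_nb (G : SimpleGraph V) (hbi : zzBi G) (A : Finset V) (D : Finset (Finset V)) (hA : 2 ≤ A.card)
    (hD : ∀ S ∈ D, Odd S.card) (hDA : ∀ S ∈ D, ∀ v ∈ S, v ∉ A)
    (hDD : ∀ S ∈ D, ∀ T ∈ D, ∀ v, v ∈ S → v ∈ T → S = T)
    (hE : ∀ S ∈ D, ∀ v ∈ S, ∀ x, G.Adj v x → x ∉ S → x ∈ A) : D.card + 2 ≤ A.card := by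
  classical
  obtain ⟨p, hp, q, hq, hpq⟩ := Finset.one_lt_card.1 hA
  obtain ⟨τ, hτ, hτp, hτa⟩ := hbi p q hpq
  have hτq : τ q = p := by rw [← hτp, hτ p]
  have hf : ∀ v, τ v ≠ v := by
    intro v h
    by_cases h1 : v = p
    · subst h1; exact hpq (h.symm.trans hτp)
    by_cases h2 : v = q
    · subst h2; exact hpq (hτq.symm.trans h)
    exact (hτa v h1 h2).ne h.symm
  have hex : ∀ S ∈ D, ∃ v ∈ S, τ v ∉ S := by
    intro S hS
    have := ((zz_ex_odd τ hτ hf S).2 (hD S hS)).pos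
    obtain ⟨v, hv⟩ := Finset.card_pos.1 this
    simp only [Finset.mem_filter] at hv
    exact ⟨v, hv⟩
  haveI : Nonempty V := ⟨p⟩
  choose! g hg1 hg2 using hex
  have : D.card ≤ ((A.erase p).erase q).card := by
    apply Finset.card_le_card_of_injOn (fun S => τ (g S))
    · intro S hS
      have hS' : S ∈ D := hS
      have hgA := hDA S hS' _ (hg1 S hS')
      have hgp : g S ≠ p := fun h => hgA (h ▸ hp)
      have hgq : g S ≠ q := fun h => hgA (h ▸ hq)
      simp only [Finset.coe_erase, Set.mem_sdiff, Set.mem_singleton_iff, Finset.mem_coe]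
      refine ⟨⟨hE S hS' _ (hg1 S hS') _ (hτa _ hgp hgq) (hg2 S hS'), ?_⟩, ?_⟩
      · intro h; apply hgq; rw [← hτ (g S), h, hτp]
      · intro h; apply hgp; rw [← hτ (g S), h, hτq]
    · intro S hS T hT hST
      have : g S = g T := hτ.injective hST
      exact hDD S hS T hT _ (hg1 S hS) (this ▸ hg1 T hT)
  rw [Finset.card_erase_of_mem (by simp [hq, hpq.symm]), Finset.card_erase_of_mem hp] at this
  omega

theorem zz_count (G : SimpleGraph V) (Z : Finset V) (P : V → Finset V) (μ : V → ℤ)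
    (hP : ∀ v, v ∈ P v) (hP' : ∀ u v, u ∈ P v → P u = P v) (hPt : ∀ v, zzTight G (P v))
    (hμ : ∀ u v, u ∈ P v → μ u = μ v) (hneg : ∀ v, P v ≠ {v} → μ v < 0)
    (hPZ : ∀ v ∈ Z, P v ⊆ Z)
    (hrel : ∀ a ∈ Z, ∀ b ∈ Z, G.Adj a b → b ∉ P a → μ a + μ b = 0)
    (σ : V → V) (hσ : zzPM G σ) :
    (Z.filter (fun v => 0 < μ v)).card + ((Z.filter (fun v => μ v < 0)).filter (fun v => σ v ∉ Z)).card
    = ((Z.filter (fun v => μ v < 0)).image P).card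
      + ((Z.filter (fun v => 0 < μ v)).filter (fun v => σ v ∉ Z)).card := by
  classical
  set A := Z.filter (fun v => 0 < μ v) with hA
  set N := Z.filter (fun v => μ v < 0) with hN
  have h1 : (A.filter (fun v => σ v ∈ Z)).card + (A.filter (fun v => σ v ∉ Z)).card = A.card :=
    Finset.card_filter_add_card_filter_not (s := A) (fun v => σ v ∈ Z)
  have h2 : (N.image P).card = (N.filter (fun v => σ v ∉ P v)).card := by
    symm
    apply Finset.card_bij (fun v _ => P v)
    · intro v hv; exact Finset.mem_image_of_mem _ (Finset.mem_filter.1 hv).1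
    · intro u hu v hv huv
      simp only [Finset.mem_filter] at hu hv
      have ht := (hPt u).2 σ hσ
      rw [zzEx, Finset.card_eq_one] at ht
      obtain ⟨x, hx⟩ := ht
      have hu' : u ∈ ({x} : Finset V) := by rw [← hx]; simp [hP u, hu.2]
      have hv' : v ∈ ({x} : Finset V) := by
        rw [← hx]; simp only [Finset.mem_filter]; rw [huv]; exact ⟨hP v, hv.2⟩
      rw [Finset.mem_singleton] at hu' hv'
      rw [hu', hv']
    · intro S hS
      obtain ⟨v, hv, rfl⟩ := Finset.mem_image.1 hS
      have ht := (hPt v).2 σ hσ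
      have ht' : 0 < ((P v).filter (fun u => σ u ∉ P v)).card := by
        rw [zzEx] at ht; omega
      obtain ⟨x, hx⟩ := Finset.card_pos.1 ht'
      simp only [Finset.mem_filter] at hx
      refine ⟨x, ?_, hP' x v hx.1⟩
      simp only [hN, Finset.mem_filter] at hv ⊢
      refine ⟨⟨hPZ v hv.1 hx.1, ?_⟩, ?_⟩
      · rw [hμ x v hx.1]; exact hv.2
      · rw [hP' x v hx.1]; exact hx.2
  have h3 : (N.filter (fun v => σ v ∉ P v)).card =
      ((N.filter (fun v => σ v ∉ P v)).filter (fun v => σ v ∈ Z)).card + (N.filter (fun v => σ v ∉ Z)).card := by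
    rw [← Finset.card_filter_add_card_filter_not (s := N.filter (fun v => σ v ∉ P v)) (fun v => σ v ∈ Z)]
    congr 2
    ext v
    simp only [Finset.mem_filter, hN]
    constructor
    · tauto
    · rintro ⟨⟨a, b⟩, c⟩; exact ⟨⟨⟨a, b⟩, fun h => c (hPZ v a h)⟩, c⟩
  have h4 : (A.filter (fun v => σ v ∈ Z)).card =
      ((N.filter (fun v => σ v ∉ P v)).filter (fun v => σ v ∈ Z)).card := by
    apply Finset.card_bij' (fun v _ => σ v) (fun v _ => σ v)
    · intro v hv
      simp only [hA, hN, Finset.mem_filter] at hv ⊢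
      obtain ⟨⟨a, b⟩, c⟩ := hv
      have hPv : P v = {v} := by by_contra h; have := hneg v h; omega
      have hn : σ v ∉ P v := by rw [hPv, Finset.mem_singleton]; exact zz_pm_ne hσ v
      have := hrel v a _ c (hσ.2 v) hn
      refine ⟨⟨⟨c, by omega⟩, ?_⟩, by rw [hσ.1 v]; exact a⟩
      rw [hσ.1 v]
      intro h
      have := hμ _ _ h
      omega
    · intro v hv
      simp only [hA, hN, Finset.mem_filter] at hv ⊢
      obtain ⟨⟨⟨a, b⟩, d⟩, c⟩ := hv
      have := hrel v a _ c (hσ.2 v) d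
      exact ⟨⟨c, by omega⟩, by rw [hσ.1 v]; exact a⟩
    · intro v _; exact hσ.1 v
    · intro v _; exact hσ.1 v
  omega

theorem zz_nb2 (G : SimpleGraph V) (hbi : zzBi G) (Z : Finset V) (P : V → Finset V) (μ : V → ℤ)
    (hP : ∀ v, v ∈ P v) (hP' : ∀ u v, u ∈ P v → P u = P v) (hPt : ∀ v, zzTight G (P v))
    (hμ : ∀ u v, u ∈ P v → μ u = μ v)
    (hPZ : ∀ v ∈ Z, P v ⊆ Z)
    (hrel : ∀ a ∈ Z, ∀ b ∈ Z, G.Adj a b → b ∉ P a → μ a + μ b = 0)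
    (hout : ∀ a ∈ Z, μ a < 0 → ∀ b, G.Adj a b → b ∈ Z)
    (hA : 2 ≤ (Z.filter (fun v => 0 < μ v)).card) :
    ((Z.filter (fun v => μ v < 0)).image P).card + 2 ≤ (Z.filter (fun v => 0 < μ v)).card := by
  have hmem : ∀ S ∈ (Z.filter (fun v => μ v < 0)).image P, ∀ v ∈ S, v ∈ Z ∧ μ v < 0 ∧ P v = S := by
    intro S hS v hv
    obtain ⟨u, hu, rfl⟩ := Finset.mem_image.1 hS
    simp only [Finset.mem_filter] at hu
    exact ⟨hPZ u hu.1 hv, by rw [hμ v u hv]; exact hu.2, hP' v u hv⟩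
  apply zz_nb G hbi _ _ hA
  · intro S hS
    obtain ⟨v, hv, rfl⟩ := Finset.mem_image.1 hS
    exact (hPt v).1
  · intro S hS v hv h
    have := (hmem S hS v hv).2.1
    simp only [Finset.mem_filter] at h
    omega
  · intro S hS T hT v hvS hvT
    rw [← (hmem S hS v hvS).2.2, (hmem T hT v hvT).2.2]
  · intro S hS v hv x hvx hx
    obtain ⟨h1, h2, h3⟩ := hmem S hS v hv
    have hxZ := hout v h1 h2 x hvx
    have := hrel v h1 x hxZ hvx (by rw [h3]; exact hx)
    simp only [Finset.mem_filter]
    exact ⟨hxZ, by omega⟩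

theorem zz_tree (G : SimpleGraph V) (hmc : ∀ a b, G.Adj a b → ∃ σ, zzPM G σ ∧ σ a = b)
    (hcon : ∀ S : Finset V, S.Nonempty → Sᶜ.Nonempty → ∃ a ∈ S, ∃ b ∉ S, G.Adj a b)
    (hne : ∃ σ, zzPM G σ) (hbi : zzBi G) (k : ℕ) : ∀ (L : Multiset (Finset V)), L.card = k →
    ∀ (P : V → Finset V) (μ : V → ℤ),
    (∀ U ∈ L, zzTight G U ∧ 2 ≤ U.card ∧ 2 ≤ Uᶜ.card) →
    (∀ U ∈ L, ∀ U' ∈ L, U ⊆ U' ∨ U' ⊆ U ∨ Disjoint U U') →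
    (∀ v, v ∈ P v) → (∀ u v, u ∈ P v → P u = P v) → (∀ v, zzTight G (P v)) →
    (∀ u v, u ∈ P v → μ u = μ v) → (∀ v, P v ≠ {v} → μ v < 0) →
    (∀ U ∈ L, ∀ v ∈ U, P v ⊆ U) →
    (∀ a b, G.Adj a b → b ∉ P a → (L.map (fun U => zzChi U a b)).sum = μ a + μ b) →
    (L ≠ 0 ∨ ∃ v, 2 ≤ (P v).card ∧ 2 ≤ (P v)ᶜ.card) → False := by
  classical
  induction k with
  | zero =>
    intro L hL P μ hLt hlam hP hP' hPt hμ hneg hPU hrel hnon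
    rw [Multiset.card_eq_zero] at hL
    subst hL
    simp only [Multiset.map_zero, Multiset.sum_zero, ne_eq, not_true, false_or] at hrel hnon
    obtain ⟨v0, hv1, hv2⟩ := hnon
    have hv0 : μ v0 < 0 := by
      apply hneg; intro h; rw [h] at hv1; simp at hv1
    have hrel' : ∀ a ∈ (Finset.univ : Finset V), ∀ b ∈ (Finset.univ : Finset V), G.Adj a b → b ∉ P a → μ a + μ b = 0 :=
      fun a _ b _ h1 h2 => (hrel a b h1 h2).symm
    have habs : ∀ v, |μ v| = |μ v0| := by
      by_contra hcon'
      push Not at hcon'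
      obtain ⟨v1, hv1'⟩ := hcon'
      obtain ⟨a, ha, b, hb, hab⟩ := hcon (Finset.univ.filter (fun v => |μ v| = |μ v0|)) ⟨v0, by simp⟩
        ⟨v1, by simpa using hv1'⟩
      simp only [Finset.mem_filter, Finset.mem_univ, true_and] at ha hb
      apply hb
      by_cases h : b ∈ P a
      · rw [hμ b a h, ha]
      · have := hrel a b hab h
        rw [← ha, show μ b = - μ a by omega, abs_neg]
    have hnz : ∀ v, μ v ≠ 0 := by
      intro v h
      have := habs v
      rw [h, abs_zero] at this
      have := abs_eq_zero.1 this.symm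
      omega
    obtain ⟨σ, hσ⟩ := hne
    have hc := zz_count G Finset.univ P μ hP hP' hPt hμ hneg (by simp) hrel' σ hσ
    simp only [Finset.mem_univ, not_true, Finset.filter_false, Finset.card_empty, add_zero] at hc
    by_cases hA : 2 ≤ (Finset.univ.filter (fun v => 0 < μ v)).card
    · have := zz_nb2 G hbi Finset.univ P μ hP hP' hPt hμ (by simp) hrel' (by simp) hA
      omega
    · have hle : ((Finset.univ.filter (fun v => μ v < 0)).image P).card ≤ 1 := by omega
      rw [Finset.card_le_one] at hle
      have hsub : (P v0)ᶜ ⊆ Finset.univ.filter (fun v => 0 < μ v) := by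
        intro v hv
        simp only [Finset.mem_compl, Finset.mem_filter, Finset.mem_univ, true_and] at hv ⊢
        by_contra hn
        have hv' : μ v < 0 := by have := hnz v; omega
        have := hle (P v) (Finset.mem_image_of_mem _ (by simpa using hv')) (P v0)
          (Finset.mem_image_of_mem _ (by simpa using hv0))
        exact hv (this ▸ hP v)
      have := Finset.card_le_card hsub
      omega
  | succ k ih =>
    intro L hL P μ hLt hlam hP hP' hPt hμ hneg hPU hrel hnon
    have hLne : L.toFinset.Nonempty := by
      rw [Multiset.toFinset_nonempty]
      intro h; rw [h] at hL; simp at hL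
    obtain ⟨Z, hZL, hZmin⟩ := Finset.exists_min_image L.toFinset Finset.card hLne
    rw [Multiset.mem_toFinset] at hZL
    obtain ⟨L', rfl⟩ := Multiset.exists_cons_of_mem hZL
    obtain ⟨hZt, hZ1, hZ2⟩ := hLt Z hZL
    have hdich : ∀ U ∈ Z ::ₘ L', Z ⊆ U ∨ Disjoint U Z := by
      intro U hU
      rcases hlam U hU Z hZL with h | h | h
      · left
        have := hZmin U (Multiset.mem_toFinset.2 hU)
        rw [Finset.eq_of_subset_of_card_le h this]
      · exact Or.inl h
      · exact Or.inr h
    have hchi : ∀ U ∈ Z ::ₘ L', ∀ a ∈ Z, ∀ b ∈ Z, zzChi U a b = 0 := by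
      intro U hU a ha b hb
      rcases hdich U hU with h | h
      · simp [zzChi, h ha, h hb]
      · have h1 : a ∉ U := fun h' => (Finset.disjoint_left.1 h h') ha
        have h2 : b ∉ U := fun h' => (Finset.disjoint_left.1 h h') hb
        simp [zzChi, h1, h2]
    have hrel' : ∀ a ∈ Z, ∀ b ∈ Z, G.Adj a b → b ∉ P a → μ a + μ b = 0 := by
      intro a ha b hb hab hbP
      rw [← hrel a b hab hbP]
      apply Multiset.sum_eq_zero
      intro x hx
      obtain ⟨U, hU, rfl⟩ := Multiset.mem_map.1 hx
      exact hchi U hU a ha b hb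
    have hPZ : ∀ v ∈ Z, P v ⊆ Z := hPU Z hZL
    obtain ⟨z0, hz0⟩ : Z.Nonempty := Finset.card_pos.1 (by omega)
    have habs : ∀ a ∈ Z, ∀ b ∈ Z, |μ a| = |μ b| := by
      apply zz_shore_const G hmc hcon Z hZt (fun v => |μ v|)
      intro a ha b hb hab
      by_cases h : b ∈ P a
      · simp only [hμ b a h]
      · have := hrel' a ha b hb hab h
        simp only [show μ b = - μ a by omega, abs_neg]
    have hbd : ∀ a ∈ Z, ∀ b ∉ Z, G.Adj a b → μ a ≤ 0 := by
      intro a ha b hb hab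
      by_contra hpos
      push Not at hpos
      have hnz : ∀ v ∈ Z, μ v ≠ 0 := by
        intro v hv h
        have := habs v hv a ha
        rw [h, abs_zero] at this
        have := abs_eq_zero.1 this.symm
        omega
      have hexs : ∀ σ : V → V, zzEx σ Z = ((Z.filter (fun v => 0 < μ v)).filter (fun v => σ v ∉ Z)).card +
          ((Z.filter (fun v => μ v < 0)).filter (fun v => σ v ∉ Z)).card := by
        intro σ
        rw [← Finset.card_union_of_disjoint]
        · unfold zzEx
          congr 1
          ext v
          simp only [Finset.mem_filter, Finset.mem_union]
          constructor
          · rintro ⟨h1, h2⟩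
            have := hnz v h1
            rcases lt_or_gt_of_ne this with h | h
            · exact Or.inr ⟨⟨h1, h⟩, h2⟩
            · exact Or.inl ⟨⟨h1, h⟩, h2⟩
          · tauto
        · rw [Finset.disjoint_left]
          intro v h1 h2
          simp only [Finset.mem_filter] at h1 h2
          omega
      obtain ⟨σ, hσ, rfl⟩ := hmc a b hab
      have hc := zz_count G Z P μ hP hP' hPt hμ hneg hPZ hrel' σ hσ
      have he := hexs σ
      rw [hZt.2 σ hσ] at he
      have hpos' : 0 < ((Z.filter (fun v => 0 < μ v)).filter (fun v => σ v ∉ Z)).card :=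
        Finset.card_pos.2 ⟨a, by simp only [Finset.mem_filter]; exact ⟨⟨ha, hpos⟩, hb⟩⟩
      have hout : ∀ a ∈ Z, μ a < 0 → ∀ b, G.Adj a b → b ∈ Z := by
        intro a1 ha1 hn b1 hab1
        by_contra hb1
        obtain ⟨σ1, hσ1, rfl⟩ := hmc a1 b1 hab1
        have hc1 := zz_count G Z P μ hP hP' hPt hμ hneg hPZ hrel' σ1 hσ1
        have he1 := hexs σ1
        rw [hZt.2 σ1 hσ1] at he1
        have hpos1 : 0 < ((Z.filter (fun v => μ v < 0)).filter (fun v => σ1 v ∉ Z)).card :=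
          Finset.card_pos.2 ⟨a1, by simp only [Finset.mem_filter]; exact ⟨⟨ha1, hn⟩, hb1⟩⟩
        omega
      by_cases hA : 2 ≤ (Z.filter (fun v => 0 < μ v)).card
      · have := zz_nb2 G hbi Z P μ hP hP' hPt hμ hPZ hrel' hout hA
        omega
      · have h0 : ((Z.filter (fun v => μ v < 0)).image P).card = 0 := by omega
        rw [Finset.card_eq_zero, Finset.image_eq_empty] at h0
        have : Z ⊆ Z.filter (fun v => 0 < μ v) := by
          intro v hv
          simp only [Finset.mem_filter]
          refine ⟨hv, ?_⟩
          by_contra hn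
          have h1 := hnz v hv
          have : v ∈ Z.filter (fun v => μ v < 0) := by
            simp only [Finset.mem_filter]; exact ⟨hv, by omega⟩
          rw [h0] at this
          simp at this
        have := Finset.card_le_card this
        omega
    set c := |μ z0| with hc
    have hcnn : 0 ≤ c := abs_nonneg _
    have hbd' : ∀ a ∈ Z, ∀ b ∉ Z, G.Adj a b → μ a = - c := by
      intro a ha b hb hab
      have h1 := hbd a ha b hb hab
      have h2 := habs a ha z0 hz0
      rw [abs_of_nonpos h1] at h2
      omega
    have hPout : ∀ v ∉ Z, ∀ u ∈ P v, u ∉ Z := by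
      intro v hv u hu huZ
      apply hv
      apply hPZ u huZ
      rw [hP' u v hu]; exact hP v
    refine ih L' (by simpa using hL) (fun v => if v ∈ Z then Z else P v) (fun v => if v ∈ Z then - c - 1 else μ v)
      (fun U hU => hLt U (Multiset.mem_cons_of_mem hU))
      (fun U hU U' hU' => hlam U (Multiset.mem_cons_of_mem hU) U' (Multiset.mem_cons_of_mem hU'))
      ?_ ?_ ?_ ?_ ?_ ?_ ?_ ?_
    · intro v; by_cases hv : v ∈ Z
      · simp [hv]
      · simp [hv, hP v]
    · intro u v huv
      by_cases hv : v ∈ Z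
      · simp only [hv, if_true] at huv ⊢; simp [huv]
      · simp only [hv, if_false] at huv ⊢
        simp [hPout v hv u huv, hP' u v huv]
    · intro v; by_cases hv : v ∈ Z
      · simp [hv, hZt]
      · simp [hv, hPt v]
    · intro u v huv
      by_cases hv : v ∈ Z
      · simp only [hv, if_true] at huv ⊢; simp [huv]
      · simp only [hv, if_false] at huv ⊢
        simp [hPout v hv u huv, hμ u v huv]
    · intro v h
      by_cases hv : v ∈ Z
      · simp only [hv, if_true]; omega
      · simp only [hv, if_false] at h ⊢; exact hneg v h
    · intro U hU v hv
      by_cases hvZ : v ∈ Z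
      · simp only [hvZ, if_true]
        rcases hdich U (Multiset.mem_cons_of_mem hU) with h | h
        · exact h
        · exact absurd hvZ (Finset.disjoint_left.1 h hv)
      · simp only [hvZ, if_false]
        exact hPU U (Multiset.mem_cons_of_mem hU) v hv
    · intro a b hab hb
      by_cases ha : a ∈ Z
      · simp only [ha, if_true] at hb ⊢
        simp only [hb, if_false]
        have h1 := hrel a b hab (fun h => hb (hPZ a ha h))
        have h2 := hbd' a ha b hb hab
        rw [Multiset.map_cons, Multiset.sum_cons] at h1
        have h3 : zzChi Z a b = 1 := by simp [zzChi, ha, hb]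
        omega
      · simp only [ha, if_false] at hb ⊢
        have h1 := hrel a b hab hb
        rw [Multiset.map_cons, Multiset.sum_cons] at h1
        by_cases hbZ : b ∈ Z
        · simp only [hbZ, if_true]
          have h2 := hbd' b hbZ a ha hab.symm
          have h3 : zzChi Z a b = 1 := by simp [zzChi, ha, hbZ]
          omega
        · simp only [hbZ, if_false]
          have h3 : zzChi Z a b = 0 := by simp [zzChi, ha, hbZ]
          omega
    · right
      exact ⟨z0, by simp only [hz0, if_true]; exact ⟨hZ1, hZ2⟩⟩
end tree

section mainpart
set_option linter.unusedSectionVars false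
variable {V : Type*} [Fintype V] [DecidableEq V]

theorem zz_filter (G : SimpleGraph V) (L : Multiset (Finset V)) :
    (∀ U ∈ L, zzTight G U ∧ Odd Uᶜ.card) → ∃ l : V → ℤ, ∀ a b, G.Adj a b →
      (L.map (fun U => zzChi U a b)).sum =
      ((L.filter (fun U => 2 ≤ U.card ∧ 2 ≤ Uᶜ.card)).map (fun U => zzChi U a b)).sum + l a + l b := by
  induction L using Multiset.induction_on with
  | empty => intro _; exact ⟨fun _ => 0, by simp⟩
  | cons U L ih =>
    intro h
    obtain ⟨l, hl⟩ := ih (fun W hW => h W (Multiset.mem_cons_of_mem hW))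
    by_cases hU : 2 ≤ U.card ∧ 2 ≤ Uᶜ.card
    · refine ⟨l, fun a b hab => ?_⟩
      rw [Multiset.filter_cons_of_pos (p := fun U : Finset V => 2 ≤ U.card ∧ 2 ≤ Uᶜ.card) _ hU]
      simp only [Multiset.map_cons, Multiset.sum_cons]
      rw [hl a b hab]; ring
    · have hs : ∃ u, ∀ a b, a ≠ b → zzChi U a b = (if a = u then 1 else 0) + (if b = u then 1 else 0) := by
        have hu := h U (Multiset.mem_cons_self _ _)
        have key : ∀ u, ∀ a b, a ≠ b → zzChi ({u} : Finset V) a b = (if a = u then 1 else 0) + (if b = u then 1 else 0) := by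
          intro u a b hab
          unfold zzChi
          by_cases h1 : a = u <;> by_cases h2 : b = u
          · exact absurd (h1.trans h2.symm) hab
          all_goals simp [h1, h2]
        by_cases h2 : 2 ≤ U.card
        · have h3 : Uᶜ.card = 1 := by
            have := hu.2.pos
            have : ¬ 2 ≤ Uᶜ.card := fun h' => hU ⟨h2, h'⟩
            omega
          obtain ⟨u, hu'⟩ := Finset.card_eq_one.1 h3
          refine ⟨u, fun a b hab => ?_⟩
          rw [← zz_chi_compl, hu', key u a b hab]
        · have h3 : U.card = 1 := by
            have := hu.1.1.pos
            omega
          obtain ⟨u, hu'⟩ := Finset.card_eq_one.1 h3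
          refine ⟨u, fun a b hab => ?_⟩
          rw [hu', key u a b hab]
      obtain ⟨u, hu⟩ := hs
      refine ⟨fun v => l v + if v = u then 1 else 0, fun a b hab => ?_⟩
      rw [Multiset.filter_cons_of_neg (p := fun U : Finset V => 2 ≤ U.card ∧ 2 ≤ Uᶜ.card) _ hU]
      simp only [Multiset.map_cons, Multiset.sum_cons]
      rw [hl a b hab, hu a b hab.ne]; ring

def zzW (U : Finset V) : ℕ := U.card * Uᶜ.card

theorem zz_w_compl (U : Finset V) : zzW Uᶜ = zzW U := by
  unfold zzW; rw [compl_compl, mul_comm]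

theorem zz_w_uncross (X Y : Finset V) (h1 : (X \ Y).Nonempty) (h2 : (Y \ X).Nonempty) :
    zzW (X ∩ Y) + zzW (X ∪ Y) < zzW X + zzW Y := by
  have e1 : X.card = (X ∩ Y).card + (X \ Y).card := (Finset.card_inter_add_card_sdiff X Y).symm
  have e2 : Y.card = (X ∩ Y).card + (Y \ X).card := by
    rw [Finset.inter_comm]; exact (Finset.card_inter_add_card_sdiff Y X).symm
  have e3 := Finset.card_union_add_card_inter X Y
  have c1 := Finset.card_add_card_compl X
  have c2 := Finset.card_add_card_compl Y
  have c3 := Finset.card_add_card_compl (X ∩ Y)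
  have c4 := Finset.card_add_card_compl (X ∪ Y)
  have p1 := h1.card_pos
  have p2 := h2.card_pos
  unfold zzW
  generalize Fintype.card V = n at *
  set a := (X ∩ Y).card
  set b := (X \ Y).card
  set c := (Y \ X).card
  set d := (X ∪ Y)ᶜ.card
  have f1 : Xᶜ.card = c + d := by omega
  have f2 : Yᶜ.card = b + d := by omega
  have f3 : (X ∩ Y)ᶜ.card = b + c + d := by omega
  have f4 : (X ∪ Y).card = a + b + c := by omega
  rw [f1, f2, f3, f4, e1, e2]
  nlinarith [Nat.mul_pos p1 p2]

theorem zz_main (G : SimpleGraph V) (hmc : ∀ a b, G.Adj a b → ∃ σ, zzPM G σ ∧ σ a = b)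
    (hcon : ∀ S : Finset V, S.Nonempty → Sᶜ.Nonempty → ∃ a ∈ S, ∃ b ∉ S, G.Adj a b)
    (hne : ∃ σ, zzPM G σ) (hbi : zzBi G)
    (h2 : ∀ (X Y : Finset V) (u v : V), X ∩ Y = {u} → (X ∪ Y)ᶜ = {v} →
      (X \ Y).Nonempty → (Y \ X).Nonempty → (∀ a ∈ X \ Y, ∀ b ∈ Y \ X, ¬ G.Adj a b) → False)
    (k : ℕ) : ∀ (L : Multiset (Finset V)) (l : V → ℤ), (L.map zzW).sum = k → L ≠ 0 →
    (∀ U ∈ L, zzTight G U ∧ 2 ≤ U.card ∧ 2 ≤ Uᶜ.card) →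
    (∀ a b, G.Adj a b → (L.map (fun U => zzChi U a b)).sum = l a + l b) → False := by
  classical
  obtain ⟨σ0, hσ0⟩ := hne
  induction k using Nat.strong_induction_on with
  | _ k ih =>
  intro L l hk hL0 hLt hrel
  by_cases hcr : ∃ X ∈ L, ∃ Y ∈ L, (X ∩ Y).Nonempty ∧ (X \ Y).Nonempty ∧ (Y \ X).Nonempty ∧ (X ∪ Y)ᶜ.Nonempty
  · obtain ⟨X, hX, Y, hY, n1, n2, n3, n4⟩ := hcr
    have hXY : X ≠ Y := by rintro rfl; simp at n2
    obtain ⟨L1, rfl⟩ := Multiset.exists_cons_of_mem hX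
    have hY1 : Y ∈ L1 := by
      rcases Multiset.mem_cons.1 hY with h | h
      · exact absurd h.symm hXY
      · exact h
    obtain ⟨L0, rfl⟩ := Multiset.exists_cons_of_mem hY1
    obtain ⟨Y', hY't, hchi, hw, hodd, m2, m3⟩ : ∃ Y' : Finset V, zzTight G Y' ∧ (∀ a b, zzChi Y' a b = zzChi Y a b) ∧
        zzW Y' = zzW Y ∧ Odd (X ∩ Y').card ∧ (X \ Y').Nonempty ∧ (Y' \ X).Nonempty := by
      by_cases ho : Odd (X ∩ Y).card
      · exact ⟨Y, (hLt Y hY).1, fun _ _ => rfl, rfl, ho, n2, n3⟩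
      · refine ⟨Yᶜ, zz_tight_compl hσ0 (hLt Y hY).1, fun a b => zz_chi_compl Y a b, zz_w_compl Y, ?_, ?_, ?_⟩
        · have e1 := Finset.card_inter_add_card_sdiff X Y
          have e2 : X ∩ Yᶜ = X \ Y := by ext; simp
          rw [e2]
          have e3 := (hLt X hX).1.1
          rw [Nat.odd_iff] at *
          omega
        · have e2 : X \ Yᶜ = X ∩ Y := by ext; simp
          rw [e2]; exact n1
        · have e2 : Yᶜ \ X = (X ∪ Y)ᶜ := by ext; simp; tauto
          rw [e2]; exact n4
    obtain ⟨t1, t2, t3⟩ := zz_uncross G hmc X Y' (hLt X hX).1 hY't hodd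
    have hall : ∀ U ∈ (X ∩ Y') ::ₘ (X ∪ Y') ::ₘ L0, zzTight G U ∧ Odd Uᶜ.card := by
      intro U hU
      have : zzTight G U := by
        rcases Multiset.mem_cons.1 hU with h | h
        · rw [h]; exact t1
        rcases Multiset.mem_cons.1 h with h | h
        · rw [h]; exact t2
        exact (hLt U (Multiset.mem_cons_of_mem (Multiset.mem_cons_of_mem h))).1
      exact ⟨this, (zz_tight_compl hσ0 this).1⟩
    obtain ⟨l', hl'⟩ := zz_filter G _ hall
    have hwlt := zz_w_uncross X Y' m2 m3
    refine ih ((((X ∩ Y') ::ₘ (X ∪ Y') ::ₘ L0).filter (fun U => 2 ≤ U.card ∧ 2 ≤ Uᶜ.card)).map zzW).sum ?_ _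
      (fun v => l v - l' v) rfl ?_ ?_ ?_
    · have hle : ((((X ∩ Y') ::ₘ (X ∪ Y') ::ₘ L0).filter (fun U => 2 ≤ U.card ∧ 2 ≤ Uᶜ.card)).map zzW).sum
          ≤ (((X ∩ Y') ::ₘ (X ∪ Y') ::ₘ L0).map zzW).sum := by
        have hle1 := Multiset.filter_le (fun U : Finset V => 2 ≤ U.card ∧ 2 ≤ Uᶜ.card) ((X ∩ Y') ::ₘ (X ∪ Y') ::ₘ L0)
        obtain ⟨R, hR⟩ := Multiset.le_iff_exists_add.1 hle1
        conv_rhs => rw [hR]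
        rw [Multiset.map_add, Multiset.sum_add]
        omega
      simp only [Multiset.map_cons, Multiset.sum_cons] at hle hk
      omega
    · intro h0
      have hn1 : ¬ (2 ≤ (X ∩ Y').card ∧ 2 ≤ (X ∩ Y')ᶜ.card) := by
        intro hh
        have : X ∩ Y' ∈ ((X ∩ Y') ::ₘ (X ∪ Y') ::ₘ L0).filter (fun U => 2 ≤ U.card ∧ 2 ≤ Uᶜ.card) :=
          Multiset.mem_filter.2 ⟨by simp, hh⟩
        rw [h0] at this; simp at this
      have hn2 : ¬ (2 ≤ (X ∪ Y').card ∧ 2 ≤ (X ∪ Y')ᶜ.card) := by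
        intro hh
        have : X ∪ Y' ∈ ((X ∩ Y') ::ₘ (X ∪ Y') ::ₘ L0).filter (fun U => 2 ≤ U.card ∧ 2 ≤ Uᶜ.card) :=
          Multiset.mem_filter.2 ⟨by simp, hh⟩
        rw [h0] at this; simp at this
      have hX2 := (hLt X hX).2
      have a1 : Xᶜ.card ≤ (X ∩ Y')ᶜ.card := by
        apply Finset.card_le_card; intro x; simp; tauto
      have a2 : X.card ≤ (X ∪ Y').card := Finset.card_le_card Finset.subset_union_left
      have o1 := t1.1.pos
      have o2 := (zz_tight_compl hσ0 t2).1.pos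
      obtain ⟨u, hu⟩ := Finset.card_eq_one.1 (show (X ∩ Y').card = 1 by omega)
      obtain ⟨v, hv⟩ := Finset.card_eq_one.1 (show (X ∪ Y')ᶜ.card = 1 by omega)
      exact h2 X Y' u v hu hv m2 m3 t3
    · intro U hU
      rw [Multiset.mem_filter] at hU
      exact ⟨(hall U hU.1).1, hU.2⟩
    · intro a b hab
      have e1 := hl' a b hab
      have e2 := hrel a b hab
      simp only [Multiset.map_cons, Multiset.sum_cons] at e1 e2
      have e3 : zzChi (X ∩ Y') a b + zzChi (X ∪ Y') a b = zzChi X a b + zzChi Y' a b := by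
        have s1 := t3 a
        have s2 := t3 b
        unfold zzChi
        have s3 := fun h1 h2 => t3 a h1 b h2 hab
        have s4 := fun h1 h2 => t3 b h1 a h2 hab.symm
        simp only [Finset.mem_sdiff] at s3 s4
        by_cases x1 : a ∈ X <;> by_cases x2 : b ∈ X <;> by_cases y1 : a ∈ Y' <;> by_cases y2 : b ∈ Y' <;>
          simp [x1, x2, y1, y2] at s3 s4 ⊢
      rw [hchi] at e3
      linarith
  · -- laminar
    push Not at hcr
    obtain ⟨U0, hU0⟩ := Multiset.exists_mem_of_ne_zero hL0
    obtain ⟨r, -⟩ := Finset.card_pos.1 (hLt U0 hU0).1.1.pos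
    let f : Finset V → Finset V := fun U => if r ∈ U then Uᶜ else U
    have hf : ∀ U, f U = U ∨ f U = Uᶜ := by intro U; simp only [f]; split_ifs <;> simp
    have hfr : ∀ U, r ∉ f U := by intro U; simp only [f]; split_ifs with h <;> simp [h]
    refine zz_tree G hmc hcon ⟨σ0, hσ0⟩ hbi _ (L.map f) rfl (fun v => {v}) l ?_ ?_ ?_ ?_ ?_ ?_ ?_ ?_ ?_ ?_
    · intro U hU
      obtain ⟨W, hW, rfl⟩ := Multiset.mem_map.1 hU
      have := hLt W hW
      rcases hf W with h | h <;> rw [h]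
      · exact this
      · refine ⟨zz_tight_compl hσ0 this.1, this.2.2, by rw [compl_compl]; exact this.2.1⟩
    · intro U hU U' hU'
      obtain ⟨W, hW, rfl⟩ := Multiset.mem_map.1 hU
      obtain ⟨W', hW', rfl⟩ := Multiset.mem_map.1 hU'
      by_contra hcon'
      simp only [not_or, Finset.disjoint_left, Finset.subset_iff] at hcon'
      push Not at hcon'
      obtain ⟨⟨a, a1, a2⟩, ⟨b, b1, b2⟩, ⟨c, c1, c2⟩⟩ := hcon'
      have r1 := hfr W
      have r2 := hfr W'
      have cr : ∀ p q s t : V, p ∈ W → p ∈ W' → q ∈ W → q ∉ W' → s ∉ W → s ∈ W' → t ∉ W → t ∉ W' → False := by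
        intro p q s t p1 p2 q1 q2 s1 s2 t1 t2
        have := hcr W hW W' hW' ⟨p, by simp [p1, p2]⟩ ⟨q, by simp [q1, q2]⟩ ⟨s, by simp [s1, s2]⟩
        have ht : t ∈ (W ∪ W')ᶜ := by simp [t1, t2]
        rw [this] at ht; simp at ht
      rcases hf W with h | h <;> rcases hf W' with h' | h' <;>
        rw [h] at a1 b2 c1 r1 <;> rw [h'] at a2 b1 c2 r2 <;>
        (try simp only [Finset.mem_compl, not_not] at a1 a2 b1 b2 c1 c2 r1 r2)
      · exact cr c a b r c1 c2 a1 a2 b2 b1 r1 r2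
      · exact cr a c r b a1 a2 c1 c2 r1 r2 b2 b1
      · exact cr b r c a b2 b1 r1 r2 c1 c2 a1 a2
      · exact cr r b a c r1 r2 b2 b1 a1 a2 c1 c2
    · intro v; simp
    · intro u v; simp
    · intro v
      refine ⟨by simp, fun σ hσ => ?_⟩
      unfold zzEx
      rw [Finset.filter_true_of_mem]; · simp
      intro x hx
      simp only [Finset.mem_singleton] at hx ⊢
      subst hx
      exact zz_pm_ne hσ x
    · intro u v h; rw [Finset.mem_singleton] at h; rw [h]
    · intro v h; exact absurd rfl h
    · intro U _ v hv; simpa using hv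
    · intro a b hab _
      rw [← hrel a b hab, Multiset.map_map]
      congr 1
      apply Multiset.map_congr rfl
      intro U _
      simp only [Function.comp]
      rcases hf U with h | h <;> rw [h]
      exact zz_chi_compl U a b
    · left
      intro h
      exact hL0 (Multiset.map_eq_zero.1 h)

theorem zz_main2 (G : SimpleGraph V) (hmc : ∀ a b, G.Adj a b → ∃ σ, zzPM G σ ∧ σ a = b)
    (hcon : ∀ S : Finset V, S.Nonempty → Sᶜ.Nonempty → ∃ a ∈ S, ∃ b ∉ S, G.Adj a b)
    (hne : ∃ σ, zzPM G σ) (hbi : zzBi G)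
    (h2 : ∀ (X Y : Finset V) (u v : V), X ∩ Y = {u} → (X ∪ Y)ᶜ = {v} →
      (X \ Y).Nonempty → (Y \ X).Nonempty → (∀ a ∈ X \ Y, ∀ b ∈ Y \ X, ¬ G.Adj a b) → False)
    (X : Finset V) (hX : zzTight G X) (hX1 : 2 ≤ X.card) (hX2 : 2 ≤ Xᶜ.card) : False := by
  obtain ⟨L, l, hXL, hLt, hrel⟩ := zz_relation G hmc X hX
  obtain ⟨σ0, hσ0⟩ := id hne
  obtain ⟨l', hl'⟩ := zz_filter G L (fun U hU => ⟨hLt U hU, (zz_tight_compl hσ0 (hLt U hU)).1⟩)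
  refine zz_main G hmc hcon hne hbi h2 _ (L.filter (fun U => 2 ≤ U.card ∧ 2 ≤ Uᶜ.card)) (fun v => l v - l' v) rfl ?_ ?_ ?_
  · intro h0
    have : X ∈ L.filter (fun U => 2 ≤ U.card ∧ 2 ≤ Uᶜ.card) := Multiset.mem_filter.2 ⟨hXL, hX1, hX2⟩
    rw [h0] at this; simp at this
  · intro U hU
    rw [Multiset.mem_filter] at hU
    exact ⟨hLt U hU.1, hU.2⟩
  · intro a b hab
    have := hl' a b hab
    have := hrel a b hab
    linarith

end mainpart

section bridge
set_option linter.unusedSectionVars false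
variable {V : Type*} [Fintype V] [DecidableEq V]

theorem zz_pm_of_sub {W : Type*} (G : SimpleGraph W) (M : G.Subgraph) (hM : M.IsPerfectMatching) :
    ∃ σ, zzPM G σ ∧ ∀ a b, M.Adj a b ↔ σ a = b := by
  rw [SimpleGraph.Subgraph.isPerfectMatching_iff] at hM
  choose σ h1 h2 using hM
  have key : ∀ a b, M.Adj a b ↔ σ a = b := fun a b =>
    ⟨fun h => (h2 a b h).symm, fun h => h ▸ h1 a⟩
  exact ⟨σ, ⟨fun v => (key _ _).1 (h1 v).symm, fun v => (h1 v).adj_sub⟩, key⟩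

theorem zz_sub_of_pm {W : Type*} (G : SimpleGraph W) (σ : W → W) (hσ : zzPM G σ) :
    ∃ M : G.Subgraph, M.IsPerfectMatching ∧ ∀ a b, M.Adj a b ↔ σ a = b := by
  refine ⟨{ verts := Set.univ, Adj := fun a b => σ a = b, adj_sub := ?_, edge_vert := ?_, symm := ?_ }, ?_, ?_⟩
  · intro a b h; rw [← h]; exact hσ.2 a
  · intro a b _; trivial
  · refine ⟨fun a b h => ?_⟩
    rw [← h]; exact hσ.1 a
  · rw [SimpleGraph.Subgraph.isPerfectMatching_iff]
    intro v; exact ⟨σ v, rfl, fun b h => Eq.symm h⟩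
  · intro a b; rfl

theorem zz_cut_card (G : SimpleGraph V) (M : G.Subgraph) (σ : V → V) (hσ : zzPM G σ)
    (h : ∀ a b, M.Adj a b ↔ σ a = b) (U : Finset V) :
    (M.edgeSet ∩ cutSet G (U : Set V)).ncard = zzEx σ U := by
  have e : M.edgeSet ∩ cutSet G (U : Set V) =
      (fun v => s(v, σ v)) '' ((U.filter (fun v => σ v ∉ U) : Finset V) : Set V) := by
    ext e
    constructor
    · rintro ⟨h1, h2, a, b, rfl, ha, hb⟩
      rw [SimpleGraph.Subgraph.mem_edgeSet, h] at h1
      subst h1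
      exact ⟨a, by simpa using ⟨ha, hb⟩, rfl⟩
    · rintro ⟨a, ha, rfl⟩
      simp only [Finset.coe_filter, Set.mem_ofPred_eq] at ha
      refine ⟨?_, ?_, a, σ a, rfl, by simpa using ha.1, by simpa using ha.2⟩
      · simp only [SimpleGraph.Subgraph.mem_edgeSet]; rw [h]
      · simp only [SimpleGraph.mem_edgeSet]; exact hσ.2 a
  rw [e, Set.InjOn.ncard_image, Set.ncard_coe_finset]; · rfl
  intro a ha b hb hab
  simp only [Finset.coe_filter, Set.mem_ofPred_eq] at ha hb
  simp only [Sym2.eq_iff] at hab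
  rcases hab with h | h
  · exact h.1
  · exact absurd (h.1 ▸ ha.1) hb.2

theorem zz_tight_iff (G : SimpleGraph V) (hne : ∃ σ, zzPM G σ) (U : Finset V) :
    IsTightCut G (U : Set V) ↔ zzTight G U := by
  obtain ⟨σ0, hσ0⟩ := hne
  have ec : ((U : Set V))ᶜ.ncard = Uᶜ.card := by rw [← Finset.coe_compl, Set.ncard_coe_finset]
  constructor
  · rintro ⟨⟨h1, h2⟩, h3⟩
    refine ⟨by simpa [Set.ncard_coe_finset] using h1, fun σ hσ => ?_⟩
    obtain ⟨M, hM, hMa⟩ := zz_sub_of_pm G σ hσ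
    rw [← zz_cut_card G M σ hσ hMa]; exact h3 M hM
  · intro h
    refine ⟨⟨by rw [Set.ncard_coe_finset]; exact h.1, by rw [ec]; exact (zz_tight_compl hσ0 h).1⟩, fun M hM => ?_⟩
    obtain ⟨σ, hσ, hMa⟩ := zz_pm_of_sub G M hM
    rw [zz_cut_card G M σ hσ hMa]; exact h.2 σ hσ

theorem zz_comp_exists (G : SimpleGraph V) (S : Set V) (x : V) (hx : x ∈ S) :
    ∃ K, IsComponentOf G S K ∧ x ∈ K :=
  ⟨_, ⟨(G.induce S).connectedComponentMk ⟨x, hx⟩, rfl⟩, ⟨⟨x, hx⟩, rfl, rfl⟩⟩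

theorem zz_comp_sub (G : SimpleGraph V) (S K : Set V) (h : IsComponentOf G S K) : K ⊆ S := by
  obtain ⟨c, rfl⟩ := h
  rintro _ ⟨y, _, rfl⟩; exact y.2

theorem zz_comp_closed (G : SimpleGraph V) (S K : Set V) (h : IsComponentOf G S K) (a b : V)
    (ha : a ∈ K) (hb : b ∈ S) (hab : G.Adj a b) : b ∈ K := by
  obtain ⟨c, rfl⟩ := h
  obtain ⟨y, hy, rfl⟩ := ha
  refine ⟨⟨b, hb⟩, ?_, rfl⟩
  have : (G.induce S).Adj y ⟨b, hb⟩ := hab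
  exact (SimpleGraph.ConnectedComponent.mem_supp_congr_adj c this).1 hy

theorem zz_comp_min (G : SimpleGraph V) (S K : Set V) (h : IsComponentOf G S K) (T : Set V)
    (hT : ∀ a ∈ T, ∀ b ∈ S, G.Adj a b → b ∈ T) (x : V) (hx : x ∈ K) (hxT : x ∈ T) : K ⊆ T := by
  obtain ⟨c, rfl⟩ := h
  obtain ⟨x', hx', rfl⟩ := hx
  rintro _ ⟨y, hy, rfl⟩
  have hr : (G.induce S).Reachable x' y := by
    rw [SimpleGraph.ConnectedComponent.mem_supp_iff] at hx' hy
    rw [← SimpleGraph.ConnectedComponent.eq, hx', hy]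
  obtain ⟨p⟩ := hr
  induction p with
  | nil => exact hxT
  | cons hadj p ih => 
    exact ih ((SimpleGraph.ConnectedComponent.mem_supp_congr_adj c hadj).1 hx')
      (hT _ hxT _ (Subtype.property _) hadj) hy

theorem zz_comp_eq (G : SimpleGraph V) (S K K' : Set V) (h : IsComponentOf G S K)
    (h' : IsComponentOf G S K') (x : V) (hx : x ∈ K) (hx' : x ∈ K') : K = K' :=
  Set.Subset.antisymm
    (zz_comp_min G S K h K' (fun a ha b hb hab => zz_comp_closed G S K' h' a b ha hb hab) x hx hx')
    (zz_comp_min G S K' h' K (fun a ha b hb hab => zz_comp_closed G S K h a b ha hb hab) x hx' hx)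

theorem zz_comp_of_tight (G : SimpleGraph V) (hmc : ∀ a b, G.Adj a b → ∃ σ, zzPM G σ ∧ σ a = b)
    (hcon : ∀ S : Finset V, S.Nonempty → Sᶜ.Nonempty → ∃ a ∈ S, ∃ b ∉ S, G.Adj a b)
    (hne : ∃ σ, zzPM G σ) (B S : Finset V) (hS : zzTight G S) (hSB : ∀ v ∈ S, v ∉ B)
    (hE : ∀ v ∈ S, ∀ x, G.Adj v x → x ∉ S → x ∈ B) : IsComponentOf G ((B : Set V))ᶜ (S : Set V) := by
  obtain ⟨x, hx⟩ := Finset.card_pos.1 hS.1.pos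
  obtain ⟨K, hK, hxK⟩ := zz_comp_exists G ((B : Set V))ᶜ x (by simpa using hSB x hx)
  have : K = (S : Set V) := by
    apply Set.Subset.antisymm
    · apply zz_comp_min G _ K hK _ _ x hxK hx
      intro a ha b hb hab
      by_contra hbS
      exact hb (hE a ha b hab hbS)
    · intro y hy
      have := zz_shore_const G hmc hcon S hS (fun v => v ∈ K) (by
        intro a ha b hb hab
        refine propext ⟨fun h => ?_, fun h => ?_⟩
        · exact zz_comp_closed G _ K hK a b h (by simpa using hSB b hb) hab
        · exact zz_comp_closed G _ K hK b a h (by simpa using hSB a ha) hab.symm) x hx y hy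
      exact (iff_of_eq this).1 hxK
  rw [← this]; exact hK

theorem zz_barrier (G : SimpleGraph V) (hmc : ∀ a b, G.Adj a b → ∃ σ, zzPM G σ ∧ σ a = b)
    (hcon : ∀ S : Finset V, S.Nonempty → Sᶜ.Nonempty → ∃ a ∈ S, ∃ b ∉ S, G.Adj a b)
    (hne : ∃ σ, zzPM G σ) (B : Finset V) (D : Finset (Finset V)) (hB : 2 ≤ B.card) (hBD : B.card ≤ D.card)
    (hD : ∀ S ∈ D, Odd S.card) (hDB : ∀ S ∈ D, ∀ v ∈ S, v ∉ B)
    (hDD : ∀ S ∈ D, ∀ T ∈ D, ∀ v, v ∈ S → v ∈ T → S = T)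
    (hE : ∀ S ∈ D, ∀ v ∈ S, ∀ x, G.Adj v x → x ∉ S → x ∈ B) :
    D.card = B.card ∧ (∀ S ∈ D, zzTight G S) ∧ (∀ v, v ∉ B → ∃ S ∈ D, v ∈ S) ∧
    (∀ a ∈ B, ∀ b ∈ B, ¬ G.Adj a b) ∧ IsBarrier G B ∧
    (∀ S ∈ D, IsComponentOf G ((B : Set V))ᶜ (S : Set V)) := by
  have main : ∀ σ, zzPM G σ → D.card = B.card ∧ (∀ S ∈ D, zzEx σ S = 1) ∧ (∀ b ∈ B, ∃ S ∈ D, σ b ∈ S) := by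
    intro σ hσ
    set E := D.biUnion (fun S => S.filter (fun v => σ v ∉ S)) with hEdef
    have hEc : E.card = ∑ S ∈ D, zzEx σ S := by
      rw [hEdef, Finset.card_biUnion]; · rfl
      intro S hS T hT hST
      rw [Function.onFun, Finset.disjoint_left]
      intro v hv hv'
      exact hST (hDD S hS T hT v (Finset.mem_filter.1 hv).1 (Finset.mem_filter.1 hv').1)
    have hEB : E.image σ ⊆ B := by
      intro x hx
      obtain ⟨v, hv, rfl⟩ := Finset.mem_image.1 hx
      obtain ⟨S, hS, hv⟩ := Finset.mem_biUnion.1 hv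
      rw [Finset.mem_filter] at hv
      exact hE S hS v hv.1 _ (hσ.2 v) hv.2
    have hEi : (E.image σ).card = E.card := Finset.card_image_of_injective _ hσ.1.injective
    have hle := Finset.card_le_card hEB
    have hone : ∀ S ∈ D, 1 ≤ zzEx σ S := fun S hS => ((zz_ex_odd σ hσ.1 (zz_pm_ne hσ) S).2 (hD S hS)).pos
    have hsum : D.card ≤ ∑ S ∈ D, zzEx σ S := by
      rw [Finset.card_eq_sum_ones]; exact Finset.sum_le_sum hone
    have hsum' : ∑ S ∈ D, 1 = ∑ S ∈ D, zzEx σ S := by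
      rw [← Finset.card_eq_sum_ones]; omega
    refine ⟨by omega, fun S hS => ((Finset.sum_eq_sum_iff_of_le hone).1 hsum' S hS).symm, ?_⟩
    intro b hb
    rw [← Finset.eq_of_subset_of_card_le hEB (by omega)] at hb
    obtain ⟨v, hv, rfl⟩ := Finset.mem_image.1 hb
    obtain ⟨S, hS, hv⟩ := Finset.mem_biUnion.1 hv
    exact ⟨S, hS, by rw [hσ.1 v]; exact (Finset.mem_filter.1 hv).1⟩
  obtain ⟨σ0, hσ0⟩ := id hne
  have hcard := (main σ0 hσ0).1
  have htight : ∀ S ∈ D, zzTight G S := fun S hS => ⟨hD S hS, fun σ hσ => (main σ hσ).2.1 S hS⟩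
  have hBout : ∀ b ∈ B, ∀ x, G.Adj b x → ∃ S ∈ D, x ∈ S := by
    intro b hb x hbx
    obtain ⟨σ, hσ, rfl⟩ := hmc b x hbx
    exact (main σ hσ).2.2 b hb
  have hcov : ∀ v, v ∉ B → ∃ S ∈ D, v ∈ S := by
    by_contra hc
    push Not at hc
    obtain ⟨v, hv, hvD⟩ := hc
    obtain ⟨b0, hb0⟩ := Finset.card_pos.1 (show 0 < B.card by omega)
    obtain ⟨a, ha, b, hb, hab⟩ := hcon (B ∪ D.biUnion id) ⟨b0, by simp [hb0]⟩
      ⟨v, by simp only [Finset.mem_compl, Finset.mem_union, Finset.mem_biUnion, id]; push Not; exact ⟨hv, hvD⟩⟩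
    simp only [Finset.mem_union, Finset.mem_biUnion, id] at ha hb
    push Not at hb
    rcases ha with ha | ⟨S, hS, ha⟩
    · obtain ⟨S, hS, h⟩ := hBout a ha b hab
      exact hb.2 S hS h
    · exact hb.1 (hE S hS a ha b hab (hb.2 S hS))
  have hcomp : ∀ S ∈ D, IsComponentOf G ((B : Set V))ᶜ (S : Set V) := fun S hS =>
    zz_comp_of_tight G hmc hcon hne B S (htight S hS) (hDB S hS) (hE S hS)
  refine ⟨hcard, htight, hcov, ?_, ⟨hB, ?_⟩, hcomp⟩
  · intro a ha b hb hab
    obtain ⟨S, hS, h⟩ := hBout a ha b hab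
    exact hDB S hS b h hb
  · rw [← hcard]
    have e : {K : Set V | IsComponentOf G ((B : Set V))ᶜ K ∧ Odd K.ncard} =
        (fun S : Finset V => (S : Set V)) '' (D : Set (Finset V)) := by
      ext K
      constructor
      · rintro ⟨h1, h2⟩
        obtain ⟨x, hx⟩ := (Set.ncard_pos (Set.toFinite K)).1 h2.pos
        have hxB := zz_comp_sub G _ K h1 hx
        obtain ⟨S, hS, hxS⟩ := hcov x (by simpa using hxB)
        exact ⟨S, hS, zz_comp_eq G _ _ _ (hcomp S hS) h1 x hxS hx⟩
      · rintro ⟨S, hS, rfl⟩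
        exact ⟨hcomp S hS, by rw [Set.ncard_coe_finset]; exact hD S hS⟩
    have : Nat.card {K : Set V // IsComponentOf G ((B : Set V))ᶜ K ∧ Odd K.ncard} =
      {K : Set V | IsComponentOf G ((B : Set V))ᶜ K ∧ Odd K.ncard}.ncard := rfl
    rw [this, e, Set.InjOn.ncard_image (fun a _ b _ h => Finset.coe_injective h), Set.ncard_coe_finset]

theorem zz_tutte {W : Type*} [Fintype W] [DecidableEq W] (G : SimpleGraph W) (hW : Even (Fintype.card W))
    (h : ¬ ∃ σ, zzPM G σ) : ∃ (T : Finset W) (D : Finset (Finset W)), T.card + 2 ≤ D.card ∧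
    (∀ S ∈ D, Odd S.card) ∧ (∀ S ∈ D, ∀ v ∈ S, v ∉ T) ∧
    (∀ S ∈ D, ∀ T ∈ D, ∀ v, v ∈ S → v ∈ T → S = T) ∧
    (∀ S ∈ D, ∀ v ∈ S, ∀ x, G.Adj v x → x ∉ S → x ∈ T) := by
  classical
  have h1 : ¬ ∃ M : G.Subgraph, M.IsPerfectMatching := by
    rintro ⟨M, hM⟩
    obtain ⟨σ, hσ, _⟩ := zz_pm_of_sub G M hM
    exact h ⟨σ, hσ⟩
  rw [SimpleGraph.tutte] at h1
  push Not at h1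
  obtain ⟨T, hT⟩ := h1
  unfold SimpleGraph.IsTutteViolator at hT
  set H := ((⊤ : G.Subgraph).deleteVerts T) with hH
  have hv : ∀ x, x ∈ H.verts ↔ x ∉ T := by intro x; simp [hH]
  have hpar : Odd (Nat.card H.verts) ↔ Odd (H.coe.oddComponents.ncard) := H.coe.odd_ncard_oddComponents.symm
  have hcv : Nat.card H.verts + T.ncard = Fintype.card W := by
    have : H.verts = Tᶜ := by ext x; rw [hv]; rfl
    rw [this, ← Nat.card_eq_fintype_card, ← Set.ncard_add_ncard_compl T, add_comm]; rfl
  let φ : H.coe.ConnectedComponent → Finset W := fun c => (Subtype.val '' c.supp).toFinset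
  have hφ : ∀ c x, x ∈ φ c ↔ ∃ hx : x ∈ H.verts, H.coe.connectedComponentMk ⟨x, hx⟩ = c := by
    intro c x
    simp only [φ, Set.mem_toFinset]
    constructor
    · rintro ⟨y, hy, rfl⟩; exact ⟨y.2, hy⟩
    · rintro ⟨hx, h⟩; exact ⟨⟨x, hx⟩, h, rfl⟩
  have hφinj : ∀ c d x, x ∈ φ c → x ∈ φ d → c = d := by
    intro c d x hc hd
    obtain ⟨_, h1⟩ := (hφ c x).1 hc
    obtain ⟨_, h2⟩ := (hφ d x).1 hd
    exact h1.symm.trans h2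
  have hφne : ∀ c, ∃ x, x ∈ φ c := by
    intro c
    induction c using SimpleGraph.ConnectedComponent.ind with
    | h v => exact ⟨v, (hφ _ _).2 ⟨v.2, rfl⟩⟩
  have hφi : Function.Injective φ := by
    intro c d hcd
    obtain ⟨x, hx⟩ := hφne c
    exact hφinj c d x hx (hcd ▸ hx)
  refine ⟨T.toFinset, H.coe.oddComponents.toFinset.image φ, ?_, ?_, ?_, ?_, ?_⟩
  · rw [Finset.card_image_of_injective _ hφi, ← Set.ncard_eq_toFinset_card', ← Set.ncard_eq_toFinset_card']
    rw [Nat.odd_iff, Nat.odd_iff] at hpar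
    rw [← hcv, Nat.even_iff] at hW
    omega
  · intro S hS
    obtain ⟨c, hc, rfl⟩ := Finset.mem_image.1 hS
    rw [Set.mem_toFinset] at hc
    have : Odd c.supp.ncard := hc
    rw [← Set.ncard_image_of_injective c.supp Subtype.val_injective, Set.ncard_eq_toFinset_card'] at this
    exact this
  · intro S hS v hv'
    obtain ⟨c, hc, rfl⟩ := Finset.mem_image.1 hS
    obtain ⟨h1, _⟩ := (hφ c v).1 hv'
    rw [Set.mem_toFinset]; exact (hv v).1 h1
  · intro S hS S' hS' v h1 h2
    obtain ⟨c, hc, rfl⟩ := Finset.mem_image.1 hS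
    obtain ⟨c', hc', rfl⟩ := Finset.mem_image.1 hS'
    rw [hφinj c c' v h1 h2]
  · intro S hS v hvS x hvx hxS
    obtain ⟨c, hc, rfl⟩ := Finset.mem_image.1 hS
    by_contra hxT
    rw [Set.mem_toFinset] at hxT
    apply hxS
    obtain ⟨h1, h2⟩ := (hφ c v).1 hvS
    refine (hφ c x).2 ⟨(hv x).2 hxT, ?_⟩
    rw [← h2, SimpleGraph.ConnectedComponent.eq]
    apply SimpleGraph.Adj.reachable
    have h3 := (hv v).1 h1
    simp only [SimpleGraph.Subgraph.coe_adj, hH, SimpleGraph.Subgraph.deleteVerts_adj]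
    simp [hxT, h3, hvx.symm]

end bridge

section final
set_option linter.unusedSectionVars false
variable {V : Type*} [Fintype V] [DecidableEq V]

theorem zz_bip_case (G : SimpleGraph V) (hmc : ∀ a b, G.Adj a b → ∃ σ, zzPM G σ ∧ σ a = b)
    (hcon : ∀ S : Finset V, S.Nonempty → Sᶜ.Nonempty → ∃ a ∈ S, ∃ b ∉ S, G.Adj a b)
    (hne : ∃ σ, zzPM G σ) (B X : Finset V) (hbip : ∀ a b, G.Adj a b → (a ∈ B ↔ b ∉ B))
    (hX : zzTight G X) (hX2 : 2 ≤ Xᶜ.card)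
    (hc : (X.filter (· ∈ B)).card = (X.filter (· ∉ B)).card + 1)
    (hexit : ∀ a ∈ X, ∀ b ∉ X, G.Adj a b → a ∈ B) :
    ∃ B', IsBarrier G B' ∧ IsComponentOf G ((B' : Set V))ᶜ (X : Set V) := by
  obtain ⟨σ0, hσ0⟩ := id hne
  have hBI : B.card = Bᶜ.card := by
    apply Finset.card_bij' (fun v _ => σ0 v) (fun v _ => σ0 v)
    · intro v hv; simpa using (hbip _ _ (hσ0.2 v)).1 hv
    · intro v hv; 
      have := (hbip _ _ (hσ0.2 v).symm).2 (by simpa using hv)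
      exact this
    · intro v _; exact hσ0.1 v
    · intro v _; exact hσ0.1 v
  have c1 : B.card = (X.filter (· ∈ B)).card + (Xᶜ.filter (· ∈ B)).card := by
    rw [← Finset.card_filter_add_card_filter_not (s := B) (· ∈ X)]
    congr 2 <;> ext x <;> simp <;> tauto
  have c2 : Bᶜ.card = (X.filter (· ∉ B)).card + (Xᶜ.filter (· ∉ B)).card := by
    rw [← Finset.card_filter_add_card_filter_not (s := Bᶜ) (· ∈ X)]
    congr 2 <;> ext x <;> simp <;> tauto
  have c3 : (Xᶜ.filter (· ∈ B)).card + (Xᶜ.filter (· ∉ B)).card = Xᶜ.card :=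
    Finset.card_filter_add_card_filter_not (s := Xᶜ) (· ∈ B)
  have hD : X ∉ (Xᶜ.filter (· ∈ B)).image (fun v => ({v} : Finset V)) := by
    intro h
    obtain ⟨v, hv, he⟩ := Finset.mem_image.1 h
    simp only [Finset.mem_filter, Finset.mem_compl] at hv
    exact hv.1 (he ▸ Finset.mem_singleton_self v)
  have := zz_barrier G hmc hcon hne (Xᶜ.filter (· ∉ B)) (insert X ((Xᶜ.filter (· ∈ B)).image (fun v => ({v} : Finset V))))
    (by omega) (by
      rw [Finset.card_insert_of_notMem hD, Finset.card_image_of_injective _ Finset.singleton_injective]; omega)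
    (by
      intro S hS
      rcases Finset.mem_insert.1 hS with rfl | hS
      · exact hX.1
      obtain ⟨v, hv, rfl⟩ := Finset.mem_image.1 hS
      simp)
    (by
      intro S hS v hv
      rcases Finset.mem_insert.1 hS with rfl | hS
      · simp [hv]
      obtain ⟨w, hw, rfl⟩ := Finset.mem_image.1 hS
      rw [Finset.mem_singleton] at hv; subst hv
      simp only [Finset.mem_filter] at hw ⊢
      tauto)
    (by
      intro S hS T hT v hv1 hv2
      rcases Finset.mem_insert.1 hS with rfl | hS <;> rcases Finset.mem_insert.1 hT with rfl | hT
      · rfl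
      · obtain ⟨w, hw, rfl⟩ := Finset.mem_image.1 hT
        rw [Finset.mem_singleton] at hv2; subst hv2
        simp only [Finset.mem_filter, Finset.mem_compl] at hw
        exact absurd hv1 hw.1
      · obtain ⟨w, hw, rfl⟩ := Finset.mem_image.1 hS
        rw [Finset.mem_singleton] at hv1; subst hv1
        simp only [Finset.mem_filter, Finset.mem_compl] at hw
        exact absurd hv2 hw.1
      · obtain ⟨w, hw, rfl⟩ := Finset.mem_image.1 hS
        obtain ⟨w', hw', rfl⟩ := Finset.mem_image.1 hT
        rw [Finset.mem_singleton] at hv1 hv2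
        rw [← hv1, ← hv2])
    (by
      intro S hS v hv x hvx hxS
      rcases Finset.mem_insert.1 hS with rfl | hS
      · have h1 := hexit v hv x hxS hvx
        simp only [Finset.mem_filter, Finset.mem_compl]
        exact ⟨hxS, (hbip v x hvx).1 h1⟩
      · obtain ⟨w, hw, rfl⟩ := Finset.mem_image.1 hS
        rw [Finset.mem_singleton] at hv; subst hv
        simp only [Finset.mem_filter, Finset.mem_compl] at hw ⊢
        have h1 := (hbip v x hvx).1 hw.2
        exact ⟨fun h2 => h1 (hexit x h2 v hw.1 hvx.symm), h1⟩)
  exact ⟨_, this.2.2.2.2.1, this.2.2.2.2.2 X (Finset.mem_insert_self _ _)⟩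

theorem zz_bip_count (G : SimpleGraph V) (B X : Finset V) (hbip : ∀ a b, G.Adj a b → (a ∈ B ↔ b ∉ B))
    (hX : zzTight G X) (σ : V → V) (hσ : zzPM G σ) (a : V) (ha : a ∈ X) (hb : σ a ∉ X) (haB : a ∈ B) :
    (X.filter (· ∈ B)).card = (X.filter (· ∉ B)).card + 1 := by
  have h1 := hX.2 σ hσ
  rw [zzEx, Finset.card_eq_one] at h1
  obtain ⟨y, hy⟩ := h1
  have hex : ∀ v ∈ X, v ≠ a → σ v ∈ X := by
    intro v hv hva
    by_contra h
    have e1 : v ∈ ({y} : Finset V) := by rw [← hy]; simp [hv, h]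
    have e2 : a ∈ ({y} : Finset V) := by rw [← hy]; simp [ha, hb]
    rw [Finset.mem_singleton] at e1 e2
    exact hva (e1.trans e2.symm)
  have haF : a ∈ X.filter (· ∈ B) := by simp [ha, haB]
  rw [← Finset.card_erase_add_one haF]
  congr 1
  apply Finset.card_bij' (fun v _ => σ v) (fun v _ => σ v)
  · intro v hv
    simp only [Finset.mem_erase, Finset.mem_filter] at hv ⊢
    exact ⟨hex v hv.2.1 hv.1, (hbip _ _ (hσ.2 v)).1 hv.2.2⟩
  · intro v hv
    simp only [Finset.mem_erase, Finset.mem_filter] at hv ⊢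
    refine ⟨?_, hex v hv.1 ?_, (hbip _ _ (hσ.2 v).symm).2 hv.2⟩
    · intro h; apply hb; rw [← h, hσ.1 v]; exact hv.1
    · rintro rfl; exact hv.2 haB
  · intro v _; exact hσ.1 v
  · intro v _; exact hσ.1 v

theorem zz_bip (G : SimpleGraph V) (hmc : ∀ a b, G.Adj a b → ∃ σ, zzPM G σ ∧ σ a = b)
    (hcon : ∀ S : Finset V, S.Nonempty → Sᶜ.Nonempty → ∃ a ∈ S, ∃ b ∉ S, G.Adj a b)
    (hne : ∃ σ, zzPM G σ) (B X : Finset V) (hbip : ∀ a b, G.Adj a b → (a ∈ B ↔ b ∉ B))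
    (hX : zzTight G X) (hX2 : 2 ≤ Xᶜ.card) :
    ∃ B', IsBarrier G B' ∧ IsComponentOf G ((B' : Set V))ᶜ (X : Set V) := by
  have hbip' : ∀ a b, G.Adj a b → (a ∈ Bᶜ ↔ b ∉ Bᶜ) := by
    intro a b hab; have := hbip a b hab; simp only [Finset.mem_compl]; tauto
  obtain ⟨σ0, hσ0⟩ := id hne
  have h1 := hX.2 σ0 hσ0
  have h1' : 0 < (X.filter (fun v => σ0 v ∉ X)).card := by rw [zzEx] at h1; omega
  obtain ⟨x, hx⟩ := Finset.card_pos.1 h1'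
  rw [Finset.mem_filter] at hx
  by_cases hxB : x ∈ B
  · have hc := zz_bip_count G B X hbip hX σ0 hσ0 x hx.1 hx.2 hxB
    apply zz_bip_case G hmc hcon hne B X hbip hX hX2 hc
    intro a ha b hb hab
    by_contra haB
    obtain ⟨σ, hσ, rfl⟩ := hmc a b hab
    have hc' := zz_bip_count G Bᶜ X hbip' hX σ hσ a ha hb (by simpa using haB)
    simp only [Finset.mem_compl, not_not] at hc'
    omega
  · have hc := zz_bip_count G Bᶜ X hbip' hX σ0 hσ0 x hx.1 hx.2 (by simpa using hxB)
    apply zz_bip_case G hmc hcon hne Bᶜ X hbip' hX hX2 hc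
    intro a ha b hb hab
    by_contra haB
    obtain ⟨σ, hσ, rfl⟩ := hmc a b hab
    have hc' := zz_bip_count G B X hbip hX σ hσ a ha hb (by simpa using haB)
    simp only [Finset.mem_compl, not_not] at hc
    omega

theorem zz_bicrit (G : SimpleGraph V) (hmc : ∀ a b, G.Adj a b → ∃ σ, zzPM G σ ∧ σ a = b)
    (hcon : ∀ S : Finset V, S.Nonempty → Sᶜ.Nonempty → ∃ a ∈ S, ∃ b ∉ S, G.Adj a b)
    (hne : ∃ σ, zzPM G σ)
    (hbar : ∀ B S : Finset V, IsBarrier G B → IsComponentOf G ((B : Set V))ᶜ (S : Set V) →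
      zzTight G S → 2 ≤ S.card → 2 ≤ Sᶜ.card → False)
    (X : Finset V) (hX : zzTight G X) (hX1 : 2 ≤ X.card) (hX2 : 2 ≤ Xᶜ.card) : zzBi G := by
  classical
  obtain ⟨σ0, hσ0⟩ := id hne
  intro p q hpq
  let W := {x : V // x ≠ p ∧ x ≠ q}
  have hWc : Fintype.card W + 2 = Fintype.card V := by
    have e : Fintype.card W = (({p, q} : Finset V)ᶜ).card := by
      rw [Fintype.card_subtype]; congr 1; ext x; simp
    have := Finset.card_add_card_compl ({p, q} : Finset V)
    rw [Finset.card_pair hpq] at this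
    omega
  have hWe : Even (Fintype.card W) := by
    have := zz_card_even hσ0
    rw [Nat.even_iff] at *; omega
  let H : SimpleGraph W := G.comap Subtype.val
  by_cases hpm : ∃ σ, zzPM H σ
  · obtain ⟨σ, hσ⟩ := hpm
    let τ : V → V := fun v => if h : v ≠ p ∧ v ≠ q then (σ ⟨v, h⟩).1 else if v = p then q else p
    have τp : τ p = q := by simp [τ]
    have τq : τ q = p := by simp [τ, hpq.symm]
    have τw : ∀ w : W, τ w.1 = (σ w).1 := by intro w; simp only [τ]; rw [dif_pos w.2]
    refine ⟨τ, ?_, τp, ?_⟩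
    · intro v
      by_cases h1 : v = p
      · rw [h1, τp, τq]
      by_cases h2 : v = q
      · rw [h2, τq, τp]
      rw [τw ⟨v, h1, h2⟩, τw, hσ.1]
    · intro v h1 h2
      rw [τw ⟨v, h1, h2⟩]
      exact hσ.2 ⟨v, h1, h2⟩
  · exfalso
    obtain ⟨T, D, d1, d2, d3, d4, d5⟩ := zz_tutte H hWe hpm
    let ι : W ↪ V := Function.Embedding.subtype _
    let B : Finset V := insert p (insert q (T.map ι))
    let D' : Finset (Finset V) := D.image (fun S => S.map ι)
    have hpT : ∀ S : Finset W, p ∉ S.map ι := by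
      intro S h; obtain ⟨w, _, e⟩ := Finset.mem_map.1 h; exact w.2.1 e
    have hqT : ∀ S : Finset W, q ∉ S.map ι := by
      intro S h; obtain ⟨w, _, e⟩ := Finset.mem_map.1 h; exact w.2.2 e
    have hmem : ∀ (S : Finset W) (w : W), w.1 ∈ S.map ι ↔ w ∈ S := by
      intro S w; exact Finset.mem_map' ι
    have hBc : B.card = T.card + 2 := by
      simp only [B]
      rw [Finset.card_insert_of_notMem, Finset.card_insert_of_notMem (hqT T), Finset.card_map]
      rw [Finset.mem_insert]; push Not; exact ⟨hpq, hpT T⟩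
    have hDc : D'.card = D.card := Finset.card_image_of_injective _ (Finset.map_injective ι)
    have hB2 : 2 ≤ B.card := by omega
    have hb := zz_barrier G hmc hcon hne B D' hB2 (by omega)
      (by
        intro S hS
        obtain ⟨S, hSD, rfl⟩ := Finset.mem_image.1 hS
        rw [Finset.card_map]; exact d2 S hSD)
      (by
        intro S hS v hv
        obtain ⟨S, hSD, rfl⟩ := Finset.mem_image.1 hS
        obtain ⟨w, hw, rfl⟩ := Finset.mem_map.1 hv
        simp only [B, Finset.mem_insert]
        push Not
        exact ⟨w.2.1, w.2.2, fun h => d3 S hSD w hw ((hmem T w).1 h)⟩)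
      (by
        intro S hS S' hS' v h1 h2
        obtain ⟨S, hSD, rfl⟩ := Finset.mem_image.1 hS
        obtain ⟨S', hSD', rfl⟩ := Finset.mem_image.1 hS'
        obtain ⟨w, hw, rfl⟩ := Finset.mem_map.1 h1
        rw [d4 S hSD S' hSD' w hw ((hmem S' w).1 h2)])
      (by
        intro S hS v hv x hvx hxS
        obtain ⟨S, hSD, rfl⟩ := Finset.mem_image.1 hS
        obtain ⟨w, hw, rfl⟩ := Finset.mem_map.1 hv
        simp only [B, Finset.mem_insert]
        by_cases h1 : x = p
        · exact Or.inl h1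
        by_cases h2 : x = q
        · exact Or.inr (Or.inl h2)
        right; right
        have := d5 S hSD w hw ⟨x, h1, h2⟩ hvx (fun h => hxS ((hmem S ⟨x, h1, h2⟩).2 h))
        exact (hmem T ⟨x, h1, h2⟩).2 this)
    obtain ⟨b1, b2, b3, b4, b5, b6⟩ := hb
    have hsing : ∀ S ∈ D', S.card = 1 := by
      intro S hS
      by_contra h
      have h1 := (b2 S hS).1.pos
      apply hbar B S b5 (b6 S hS) (b2 S hS) (by omega)
      refine hB2.trans (Finset.card_le_card ?_)
      intro x hx
      rw [Finset.mem_compl]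
      intro hxS
      have := zz_comp_sub G _ _ (b6 S hS) hxS
      exact this hx
    have hbip : ∀ a b, G.Adj a b → (a ∈ B ↔ b ∉ B) := by
      intro a b hab
      constructor
      · intro ha hb; exact b4 a ha b hb hab
      · intro hb
        by_contra ha
        obtain ⟨S, hS, haS⟩ := b3 a ha
        obtain ⟨y, hy⟩ := Finset.card_eq_one.1 (hsing S hS)
        have hbS := zz_comp_closed G _ _ (b6 S hS) a b haS (by simpa using hb) hab
        have h1 : a = y := by rw [hy] at haS; simpa using haS
        have h2 : b = y := by rw [hy] at hbS; simpa using hbS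
        exact hab.ne (h1.trans h2.symm)
    obtain ⟨B', h1, h2⟩ := zz_bip G hmc hcon hne B X hbip hX hX2
    exact hbar B' X h1 h2 hX hX1 hX2

theorem zz_twosep (G : SimpleGraph V) (hbi : zzBi G)
    (X Y : Finset V) (u v : V) (hu : X ∩ Y = {u}) (hv : (X ∪ Y)ᶜ = {v})
    (n1 : (X \ Y).Nonempty) (n2 : (Y \ X).Nonempty)
    (hno : ∀ a ∈ X \ Y, ∀ b ∈ Y \ X, ¬ G.Adj a b) :
    Is2Separation G u v ∧ ∃ K : Finset V, IsComponentOf G ({u, v} : Set V)ᶜ (K : Set V) ∧ Even K.card ∧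
      zzTight G (K ∪ {u}) ∧ 2 ≤ (K ∪ {u}).card ∧ 2 ≤ (K ∪ {u})ᶜ.card := by
  classical
  have mu : ∀ x, (x ∈ X ∧ x ∈ Y) ↔ x = u := by
    intro x; rw [← Finset.mem_inter, hu, Finset.mem_singleton]
  have mv : ∀ x, (x ∉ X ∧ x ∉ Y) ↔ x = v := by
    intro x; rw [← Finset.mem_singleton, ← hv]; simp
  have huX := (mu u).2 rfl
  have hvX := (mv v).2 rfl
  have huv : u ≠ v := by rintro rfl; exact hvX.1 huX.1
  obtain ⟨τ, hτ, hτu, hτa⟩ := hbi u v huv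
  have hτv : τ v = u := by rw [← hτu, hτ u]
  have hmem : ∀ x, x ∈ ({u, v} : Set V)ᶜ ↔ x ≠ u ∧ x ≠ v := by intro x; simp
  have heven : ∀ K : Finset V, IsComponentOf G ({u, v} : Set V)ᶜ (K : Set V) → Even K.card := by
    intro K hK
    have hKs : ∀ x ∈ K, x ≠ u ∧ x ≠ v := fun x hx => (hmem x).1 (zz_comp_sub G _ _ hK hx)
    apply zz_even_of_inv K τ
    · intro x hx
      have h := hKs x hx
      refine zz_comp_closed G _ _ hK x (τ x) hx ((hmem _).2 ⟨?_, ?_⟩) (hτa x h.1 h.2)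
      · intro e; apply h.2; rw [← hτ x, e, hτu]
      · intro e; apply h.1; rw [← hτ x, e, hτv]
    · intro x _; exact hτ x
    · intro x hx; have h := hKs x hx; exact (hτa x h.1 h.2).ne'
  have hfin : ∀ K : Set V, ∃ K' : Finset V, (K' : Set V) = K := fun K => ⟨K.toFinset, by simp⟩
  obtain ⟨x, hx⟩ := n1
  obtain ⟨y, hy⟩ := n2
  rw [Finset.mem_sdiff] at hx hy
  have hxuv : x ≠ u ∧ x ≠ v := ⟨by rintro rfl; exact hx.2 huX.2, by rintro rfl; exact hvX.1 hx.1⟩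
  have hyuv : y ≠ u ∧ y ≠ v := ⟨by rintro rfl; exact hy.2 huX.1, by rintro rfl; exact hvX.2 hy.1⟩
  obtain ⟨K1, hK1, hxK⟩ := zz_comp_exists G ({u, v} : Set V)ᶜ x ((hmem x).2 hxuv)
  obtain ⟨K2, hK2, hyK⟩ := zz_comp_exists G ({u, v} : Set V)ᶜ y ((hmem y).2 hyuv)
  obtain ⟨K1, rfl⟩ := hfin K1
  obtain ⟨K2, rfl⟩ := hfin K2
  have hsub : (K1 : Set V) ⊆ ((X \ Y : Finset V) : Set V) := by
    apply zz_comp_min G _ _ hK1 _ _ x hxK (by simp [hx])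
    intro a ha b hb hab
    rw [hmem] at hb
    have e1 := fun h => hno a ha b h hab
    have e2 := mu b
    have e3 := mv b
    simp only [Finset.mem_sdiff, Finset.mem_coe] at e1 ⊢
    tauto
  have hyK1 : y ∉ K1 := by
    intro h
    have := hsub h
    simp only [Finset.mem_coe, Finset.mem_sdiff] at this
    exact hy.2 this.1
  have huK1 : u ∉ K1 := fun h => ((hmem u).1 (zz_comp_sub G _ _ hK1 h)).1 rfl
  have hvK1 : v ∉ K1 := fun h => ((hmem v).1 (zz_comp_sub G _ _ hK1 h)).2 rfl
  have hcK : (K1 ∪ {u}).card = K1.card + 1 := by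
    rw [Finset.card_union_of_disjoint (by simpa using huK1)]; simp
  have hK1e := heven K1 hK1
  refine ⟨⟨huv, K1, K2, ?_, hK1, hK2, by simpa [Set.ncard_coe_finset] using hK1e,
    by simpa [Set.ncard_coe_finset] using heven K2 hK2⟩, K1, hK1, hK1e, ⟨?_, ?_⟩, ?_, ?_⟩
  · intro h; apply hyK1; rw [← h] at hyK; exact hyK
  · rw [hcK]; exact hK1e.add_one
  · intro σ hσ
    have h1 := (zz_ex_odd σ hσ.1 (zz_pm_ne hσ) (K1 ∪ {u})).2 (by rw [hcK]; exact hK1e.add_one)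
    have h2 : zzEx σ (K1 ∪ {u}) ≤ ({u, σ v} : Finset V).card := by
      apply Finset.card_le_card
      intro w hw
      simp only [Finset.mem_filter, Finset.mem_union, Finset.mem_singleton] at hw
      obtain ⟨hw | hw, hw'⟩ := hw
      · have : σ w = v := by
          by_contra hne
          apply hw'
          by_cases h : σ w = u
          · exact Or.inr h
          · exact Or.inl (zz_comp_closed G _ _ hK1 w (σ w) hw ((hmem _).2 ⟨h, hne⟩) (hσ.2 w))
        rw [← this, hσ.1 w]; simp
      · simp [hw]
    have h3 : ({u, σ v} : Finset V).card ≤ 2 := Finset.card_le_two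
    rw [Nat.odd_iff] at h1
    omega
  · rw [hcK]
    have : 0 < K1.card := Finset.card_pos.2 ⟨x, hxK⟩
    omega
  · have : ({y, v} : Finset V) ⊆ (K1 ∪ {u})ᶜ := by
      intro z hz
      simp only [Finset.mem_insert, Finset.mem_singleton] at hz
      simp only [Finset.mem_compl, Finset.mem_union, Finset.mem_singleton]
      rcases hz with rfl | rfl
      · push Not; exact ⟨hyK1, hyuv.1⟩
      · push Not; exact ⟨hvK1, huv.symm⟩
    calc 2 = ({y, v} : Finset V).card := (Finset.card_pair hyuv.2).symm
      _ ≤ _ := Finset.card_le_card this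

end final

/-- if a matching covered graph has a nontrivial tight cut, then it
has a nontrivial tight cut that is a barrier cut or a 2-separation cut. -/
theorem nontrivial_tight_cut_barrier_or_two_separation [Fintype V]
    (G : SimpleGraph V) (hG : MatchingCovered G)
    (h : ∃ U : Set V, IsTightCut G U ∧ 2 ≤ U.ncard ∧ 2 ≤ Uᶜ.ncard) :
    ∃ S : Set V, IsTightCut G S ∧ 2 ≤ S.ncard ∧ 2 ≤ Sᶜ.ncard ∧
      ((∃ B : Finset V, IsBarrier G B ∧
          IsComponentOf G ((B : Set V))ᶜ S ∧ Odd S.ncard) ∨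
       (∃ u v : V, Is2Separation G u v ∧ ∃ K : Set V,
          IsComponentOf G ({u, v} : Set V)ᶜ K ∧ Even K.ncard ∧ S = K ∪ {u})) := by
  classical
  obtain ⟨hconn, ⟨e0, he0⟩, hcov⟩ := hG
  have hmc : ∀ a b, G.Adj a b → ∃ σ, zzPM G σ ∧ σ a = b := by
    intro a b hab
    obtain ⟨M, hM, hMe⟩ := hcov s(a, b) hab
    obtain ⟨σ, hσ, hσM⟩ := zz_pm_of_sub G M hM
    exact ⟨σ, hσ, (hσM a b).1 hMe⟩
  have hne : ∃ σ, zzPM G σ := by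
    obtain ⟨M, hM, hMe⟩ := hcov e0 he0
    obtain ⟨σ, hσ, -⟩ := zz_pm_of_sub G M hM
    exact ⟨σ, hσ⟩
  have hcon : ∀ S : Finset V, S.Nonempty → Sᶜ.Nonempty → ∃ a ∈ S, ∃ b ∉ S, G.Adj a b := by
    intro S ⟨x, hx⟩ ⟨y, hy⟩
    obtain ⟨p⟩ := hconn.preconnected x y
    obtain ⟨d, -, h1, h2⟩ := p.exists_boundary_dart (S : Set V) hx (by simpa using hy)
    exact ⟨d.fst, h1, d.snd, h2, d.adj⟩
  have ec : ∀ U : Finset V, ((U : Set V))ᶜ.ncard = Uᶜ.card := by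
    intro U; rw [← Finset.coe_compl, Set.ncard_coe_finset]
  obtain ⟨U, hU, hU1, hU2⟩ := h
  obtain ⟨X, rfl⟩ : ∃ X : Finset V, (X : Set V) = U := ⟨U.toFinset, by simp⟩
  rw [zz_tight_iff G hne] at hU
  rw [Set.ncard_coe_finset] at hU1
  rw [ec] at hU2
  by_contra hcontra
  have hbar : ∀ B S : Finset V, IsBarrier G B → IsComponentOf G ((B : Set V))ᶜ (S : Set V) →
      zzTight G S → 2 ≤ S.card → 2 ≤ Sᶜ.card → False := by
    intro B S h1 h2 h3 h4 h5
    exact hcontra ⟨S, (zz_tight_iff G hne S).2 h3, by rw [Set.ncard_coe_finset]; exact h4,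
      by rw [ec]; exact h5, Or.inl ⟨B, h1, h2, by rw [Set.ncard_coe_finset]; exact h3.1⟩⟩
  have hbi := zz_bicrit G hmc hcon hne hbar X hU hU1 hU2
  refine zz_main2 G hmc hcon hne hbi ?_ X hU hU1 hU2
  intro X Y u v hu hv n1 n2 hno
  obtain ⟨h1, K, h2, h3, h4, h5, h6⟩ := zz_twosep G hbi X Y u v hu hv n1 n2 hno
  exact hcontra ⟨((K ∪ {u} : Finset V) : Set V), (zz_tight_iff G hne _).2 h4,
    by rw [Set.ncard_coe_finset]; exact h5, by rw [ec]; exact h6,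
    Or.inr ⟨u, v, h1, K, h2, by rw [Set.ncard_coe_finset]; exact h3, by simp⟩⟩
end

section
/- Let G be a matching covered graph. A set B ⊆ V(G) with |B| ≥ 2 is a maximal barrier of G (a barrier contained in no strictly larger barrier) if and only if: for all distinct x, y ∈ B the graph G − x − y has no perfect matching, and for every x ∈ B and every z ∈ V(G) \ B the graph G − x − z has a perfect matching. -/
open BigOperators

variable {V : Type*}

open Finset

/-- A family of pairwise disjoint odd sets avoiding `W`, whose outside neighbours lie in `W`. -/
def OddFam (G : SimpleGraph V) (W : Finset V) (F : Finset (Finset V)) : Prop :=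
  (∀ Y ∈ F, Odd Y.card) ∧ (∀ Y ∈ F, ∀ v ∈ Y, v ∉ W) ∧
  (∀ Y ∈ F, ∀ Z ∈ F, ∀ v, v ∈ Y → v ∈ Z → Y = Z) ∧
  (∀ Y ∈ F, ∀ v ∈ Y, ∀ w, G.Adj v w → w ∈ Y ∨ w ∈ W)

/-- Existence of a large family. -/
def PB (G : SimpleGraph V) (W : Finset V) : Prop :=
  ∃ F, OddFam G W F ∧ W.card ≤ F.card

open Classical in
lemma odd_exit [Fintype V] (m : V → V) (hm : ∀ v, m (m v) = v) (Y : Finset V)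
    (hY : Odd Y.card) (hne : ∀ v ∈ Y, m v ≠ v) : ∃ v ∈ Y, m v ∉ Y := by
  by_contra! h
  have h2 : ∑ v ∈ Y, (1 : ZMod 2) = 0 := by
    apply Finset.sum_involution (fun v _ => m v)
    · intros; decide
    · intro v hv _; exact hne v hv
    · intro v hv; exact h v hv
    · intro v hv; exact hm v
  simp only [Finset.sum_const, nsmul_eq_mul, mul_one] at h2
  rw [ZMod.natCast_eq_zero_iff_even] at h2
  exact (Nat.not_even_iff_odd.2 hY) h2

open Classical in
lemma fam_bound [Fintype V] (G : SimpleGraph V) (W : Finset V) (F : Finset (Finset V))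
    (hF : OddFam G W F) (m : V → V) (hm : ∀ v, m (m v) = v)
    (hadj : ∀ Y ∈ F, ∀ v ∈ Y, G.Adj v (m v)) :
    F.card ≤ (W.filter (fun w => ∃ Y ∈ F, m w ∈ Y)).card := by
  obtain ⟨h1, h2, h3, h4⟩ := hF
  have key : ∀ Y ∈ F, ∃ v ∈ Y, m v ∉ Y := fun Y hY =>
    odd_exit m hm Y (h1 Y hY) (fun v hv => (hadj Y hY v hv).ne')
  rcases F.eq_empty_or_nonempty with hE | ⟨Y₀, hY₀⟩
  · simp [hE]
  have : Nonempty V := ⟨(key Y₀ hY₀).choose⟩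
  choose! g hg hg' using key
  apply Finset.card_le_card_of_injOn (fun Y => m (g Y))
  · intro Y hY
    have hY : Y ∈ F := hY
    simp only [Finset.coe_filter, Set.mem_ofPred_eq]
    refine ⟨(h4 Y hY _ (hg Y hY) _ (hadj Y hY _ (hg Y hY))).resolve_left (hg' Y hY), Y, hY, ?_⟩
    rw [hm]; exact hg Y hY
  · intro Y hY Z hZ h
    have hY : Y ∈ F := hY
    have hZ : Z ∈ F := hZ
    have : g Y = g Z := by rw [← hm (g Y), ← hm (g Z)]; exact congrArg m h
    exact h3 Y hY Z hZ _ (hg Y hY) (this ▸ hg Z hZ)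

lemma pm_fun (G : SimpleGraph V) (M : G.Subgraph) (hM : M.IsPerfectMatching) :
    ∃ m : V → V, (∀ v, m (m v) = v) ∧ (∀ v, G.Adj v (m v)) ∧ ∀ v w, M.Adj v w → m v = w := by
  rw [SimpleGraph.Subgraph.isPerfectMatching_iff] at hM
  choose m hm hm' using hM
  refine ⟨m, fun v => ?_, fun v => (hm v).adj_sub, fun v w h => (hm' v w h).symm⟩
  exact (hm' (m v) v (hm v).symm).symm

lemma mc_fun (G : SimpleGraph V) (hG : MatchingCovered G) (u w : V) (h : G.Adj u w) :
    ∃ m : V → V, (∀ v, m (m v) = v) ∧ (∀ v, G.Adj v (m v)) ∧ m u = w := by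
  obtain ⟨M, hM, he⟩ := hG.2.2 s(u, w) h
  obtain ⟨m, a, b, c⟩ := pm_fun G M hM
  exact ⟨m, a, b, c u w he⟩

lemma mc_fun' (G : SimpleGraph V) (hG : MatchingCovered G) :
    ∃ m : V → V, (∀ v, m (m v) = v) ∧ (∀ v, G.Adj v (m v)) := by
  obtain ⟨e, he⟩ := hG.2.1
  obtain ⟨M, hM, he⟩ := hG.2.2 e he
  obtain ⟨m, a, b, c⟩ := pm_fun G M hM
  exact ⟨m, a, b⟩

lemma mc_even [Fintype V] (G : SimpleGraph V) (hG : MatchingCovered G) :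
    Even (Nat.card V) := by
  obtain ⟨m, a, b⟩ := mc_fun' G hG
  by_contra h
  rw [Nat.not_even_iff_odd, Nat.card_eq_fintype_card] at h
  obtain ⟨v, _, hv⟩ := odd_exit m a univ h (fun v _ => (b v).ne')
  simp at hv

lemma fam_le [Fintype V] (G : SimpleGraph V) (hG : MatchingCovered G) (W : Finset V)
    (F : Finset (Finset V)) (hF : OddFam G W F) : F.card ≤ W.card := by
  classical
  obtain ⟨m, a, b⟩ := mc_fun' G hG
  exact (fam_bound G W F hF m a (fun _ _ v _ => b v)).trans (Finset.card_filter_le _ _)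

lemma fam_cover [Fintype V] (G : SimpleGraph V) (hG : MatchingCovered G) (W : Finset V)
    (F : Finset (Finset V)) (hF : OddFam G W F) (hc : W.card ≤ F.card) (hW : W.Nonempty)
    (v : V) : v ∈ W ∨ ∃ Y ∈ F, v ∈ Y := by
  classical
  obtain ⟨x, hx⟩ := hW
  have step : ∀ u w, G.Adj u w → (u ∈ W ∨ ∃ Y ∈ F, u ∈ Y) → (w ∈ W ∨ ∃ Y ∈ F, w ∈ Y) := by
    intro u w huw hu
    rcases hu with hu | ⟨Y, hY, hu⟩
    · by_contra hcon
      push Not at hcon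
      obtain ⟨m, a, b, c⟩ := mc_fun G hG u w huw
      have h1 := fam_bound G W F hF m a (fun _ _ v _ => b v)
      have h2 : (W.filter (fun w => ∃ Y ∈ F, m w ∈ Y)).card < W.card := by
        apply Finset.card_lt_card
        rw [Finset.filter_ssubset]
        refine ⟨u, hu, ?_⟩
        rintro ⟨Y, hY, h⟩
        exact hcon.2 Y hY (c ▸ h)
      omega
    · rcases hF.2.2.2 Y hY u hu w huw with h | h
      · exact Or.inr ⟨Y, hY, h⟩
      · exact Or.inl h
  obtain ⟨p⟩ := hG.1.preconnected x v
  have : ∀ a b, G.Walk a b → (a ∈ W ∨ ∃ Y ∈ F, a ∈ Y) → (b ∈ W ∨ ∃ Y ∈ F, b ∈ Y) := by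
    intro a b p
    induction p with
    | nil => exact id
    | cons h _ ih => exact fun ha => ih (step _ _ h ha)
  exact this _ _ p (Or.inl hx)

/-- A family witness forbids a perfect matching of `G - x - y`. -/
lemma no_pm_of_PB [Fintype V] (G : SimpleGraph V) (W : Finset V)
    (hW : PB G W) (x y : V) (hx : x ∈ W) (hy : y ∈ W) :
    ¬ ∃ M : (G.induce ({x, y} : Set V)ᶜ).Subgraph, M.IsPerfectMatching := by
  classical
  rintro ⟨M, hM⟩
  obtain ⟨F, hF, hc⟩ := hW
  obtain ⟨m, a, b, -⟩ := pm_fun _ M hM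
  let m' : V → V := fun v => if h : v ∈ ({x, y} : Set V)ᶜ then (m ⟨v, h⟩ : V) else v
  have h1 : ∀ v (h : v ∈ ({x, y} : Set V)ᶜ), m' v = m ⟨v, h⟩ := fun v h => dif_pos h
  have h2 : ∀ v, v ∉ ({x, y} : Set V)ᶜ → m' v = v := fun v h => dif_neg h
  have hinv : ∀ v, m' (m' v) = v := by
    intro v
    by_cases h : v ∈ ({x, y} : Set V)ᶜ
    · rw [h1 v h, h1 _ (m ⟨v, h⟩).2]; simp [a]
    · rw [h2 v h, h2 v h]
  have hb := fam_bound G W F hF m' hinv (by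
    intro Y hY v hv
    have hvW := hF.2.1 Y hY v hv
    have h : v ∈ ({x, y} : Set V)ᶜ := by
      simp only [Set.mem_compl_iff, Set.mem_insert_iff, Set.mem_singleton_iff]
      rintro (rfl | rfl) <;> contradiction
    rw [h1 v h]
    exact b ⟨v, h⟩)
  have h3 : (W.filter (fun w => ∃ Y ∈ F, m' w ∈ Y)).card < W.card := by
    apply Finset.card_lt_card
    rw [Finset.filter_ssubset]
    refine ⟨x, hx, ?_⟩
    rintro ⟨Y, hY, h⟩
    rw [h2 x (by simp)] at h
    exact hF.2.1 Y hY x h hx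
  omega

/-- Tutte direction. -/
lemma PB_of_no_pm [Fintype V] (G : SimpleGraph V) (hG : MatchingCovered G) (x y : V)
    (hxy : x ≠ y)
    (h : ¬ ∃ M : (G.induce ({x, y} : Set V)ᶜ).Subgraph, M.IsPerfectMatching) :
    ∃ W, x ∈ W ∧ y ∈ W ∧ PB G W := by
  classical
  rw [SimpleGraph.tutte] at h
  push Not at h
  obtain ⟨u, hu⟩ := h
  unfold SimpleGraph.IsTutteViolator at hu
  set H := ((⊤ : (G.induce ({x, y} : Set V)ᶜ).Subgraph).deleteVerts u) with hH
  have hverts : ∀ v, v ∈ H.verts ↔ v ∉ u := by intro v; simp [hH]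
  have hHadj : ∀ a b : H.verts, H.coe.Adj a b ↔ G.Adj (a : ↥({x, y} : Set V)ᶜ) (b : ↥({x, y} : Set V)ᶜ) := by
    intro a b
    have ha := (hverts _).1 a.2
    have hb := (hverts _).1 b.2
    simp [hH, SimpleGraph.Subgraph.deleteVerts_adj, ha, hb]
  have hpar := SimpleGraph.odd_ncard_oddComponents H.coe
  have hcard1 : Nat.card H.verts + u.ncard = Nat.card ↥({x, y} : Set V)ᶜ := by
    have : H.verts = uᶜ := by ext v; simp [hverts]
    rw [this, Nat.card_coe_set_eq, add_comm, Set.ncard_add_ncard_compl]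
  have hcard2 : Nat.card ↥({x, y} : Set V)ᶜ + 2 = Nat.card V := by
    rw [Nat.card_coe_set_eq, add_comm, ← Set.ncard_pair hxy, Set.ncard_add_ncard_compl]
  have heven := mc_even G hG
  have hge : u.ncard + 2 ≤ H.coe.oddComponents.ncard := by
    by_contra hlt
    have : H.coe.oddComponents.ncard = u.ncard + 1 := by omega
    rw [this] at hpar
    rw [← hcard2, ← hcard1] at heven
    simp only [Nat.odd_iff, Nat.even_iff] at hpar heven
    omega
  let toV : H.verts → V := fun a => ((a : ↥({x, y} : Set V)ᶜ) : V)
  have htoV : Function.Injective toV := Subtype.val_injective.comp Subtype.val_injective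
  let fs : H.coe.ConnectedComponent → Finset V := fun c => (toV '' c.supp).toFinset
  have hfs : ∀ c v, v ∈ fs c ↔ ∃ a : H.verts, H.coe.connectedComponentMk a = c ∧ toV a = v := by
    intro c v; simp [fs]
  let U : Finset ↥({x, y} : Set V)ᶜ := u.toFinset
  let W : Finset V := insert x (insert y (U.map ⟨Subtype.val, Subtype.val_injective⟩))
  have hWmem : ∀ v, v ∈ W ↔ v = x ∨ v = y ∨ ∃ h : v ∈ ({x, y} : Set V)ᶜ, (⟨v, h⟩ : ↥({x, y} : Set V)ᶜ) ∈ u := by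
    intro v; simp only [W, U, Finset.mem_insert, Finset.mem_map, Set.mem_toFinset, Function.Embedding.coeFn_mk, Subtype.exists, exists_and_right, exists_eq_right]
  have hnotW : ∀ a : H.verts, toV a ∉ W := by
    intro a ha
    have h1 := a.1.2
    have h2 := (hverts _).1 a.2
    simp only [Set.mem_compl_iff, Set.mem_insert_iff, Set.mem_singleton_iff, not_or] at h1
    rcases (hWmem _).1 ha with h | h | ⟨h, h'⟩
    · exact h1.1 h
    · exact h1.2 h
    · exact h2 h'
  have hinW : ∀ v, v ∉ W → ∃ a : H.verts, toV a = v := by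
    intro v hv
    rw [hWmem] at hv
    push Not at hv
    have h1 : v ∈ ({x, y} : Set V)ᶜ := by simp [hv.1, hv.2.1]
    exact ⟨⟨⟨v, h1⟩, (hverts _).2 (hv.2.2 h1)⟩, rfl⟩
  refine ⟨W, by simp [W], by simp [W], H.coe.oddComponents.toFinset.image fs, ⟨?_, ?_, ?_, ?_⟩, ?_⟩
  · simp only [Finset.mem_image, Set.mem_toFinset]
    rintro _ ⟨c, hc, rfl⟩
    have : (fs c).card = c.supp.ncard := by
      rw [← Set.ncard_image_of_injective c.supp htoV, Set.ncard_eq_toFinset_card']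
    rw [this]; exact hc
  · simp only [Finset.mem_image, Set.mem_toFinset]
    rintro _ ⟨c, hc, rfl⟩ v hv
    obtain ⟨a, -, rfl⟩ := (hfs _ _).1 hv
    exact hnotW a
  · simp only [Finset.mem_image, Set.mem_toFinset]
    rintro _ ⟨c, hc, rfl⟩ _ ⟨d, hd, rfl⟩ v hv hw
    obtain ⟨a, rfl, rfl⟩ := (hfs _ _).1 hv
    obtain ⟨b, rfl, h⟩ := (hfs _ _).1 hw
    rw [htoV h]
  · simp only [Finset.mem_image, Set.mem_toFinset]
    rintro _ ⟨c, hc, rfl⟩ v hv w hvw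
    obtain ⟨a, rfl, rfl⟩ := (hfs _ _).1 hv
    by_cases hw : w ∈ W
    · exact Or.inr hw
    · obtain ⟨b, rfl⟩ := hinW w hw
      left
      rw [hfs]
      refine ⟨b, ?_, rfl⟩
      rw [SimpleGraph.ConnectedComponent.eq]
      exact ((hHadj a b).2 hvw).reachable.symm
  · have hinj : Set.InjOn fs H.coe.oddComponents.toFinset := by
      intro c _ d _ hcd
      obtain ⟨a, rfl⟩ := c.exists_rep
      have : toV a ∈ fs d := hcd ▸ (hfs _ _).2 ⟨a, rfl, rfl⟩
      obtain ⟨b, rfl, h⟩ := (hfs _ _).1 this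
      rw [htoV h]; rfl
    rw [Finset.card_image_of_injOn hinj, ← Set.ncard_eq_toFinset_card']
    have : W.card ≤ U.card + 1 + 1 := by
      refine (Finset.card_insert_le _ _).trans ?_
      have := Finset.card_insert_le y (U.map ⟨Subtype.val, Subtype.val_injective⟩)
      rw [Finset.card_map] at this
      omega
    have hU : U.card = u.ncard := (Set.ncard_eq_toFinset_card' u).symm
    omega

/-- The finset of odd components of `G - B`. -/
lemma comp_fam [Fintype V] (G : SimpleGraph V) (B : Finset V) :
    ∃ F : Finset (Finset V), OddFam G B F ∧
      F.card = Nat.card {K : Set V // IsComponentOf G ((B : Set V))ᶜ K ∧ Odd K.ncard} ∧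
      ∀ Y : Finset V, Odd Y.card → (∀ v ∈ Y, v ∉ B) →
        (∀ v ∈ Y, ∀ w, G.Adj v w → w ∈ Y ∨ w ∈ B) → ∃ K ∈ F, K ⊆ Y := by
  classical
  let F : Finset (Finset V) := univ.filter
    (fun Y : Finset V => IsComponentOf G ((B : Set V))ᶜ (Y : Set V) ∧ Odd (Y : Set V).ncard)
  have hF : ∀ Y, Y ∈ F ↔ IsComponentOf G ((B : Set V))ᶜ (Y : Set V) ∧ Odd Y.card := by
    intro Y; simp [F]
  have hmem : ∀ (Y : Finset V) (c : (G.induce ((B : Set V))ᶜ).ConnectedComponent),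
      (Y : Set V) = Subtype.val '' c.supp → ∀ v, v ∈ Y ↔
        ∃ a, (G.induce ((B : Set V))ᶜ).connectedComponentMk a = c ∧ (a : V) = v := by
    intro Y c h v
    rw [← Finset.mem_coe, h]; rfl
  refine ⟨F, ⟨?_, ?_, ?_, ?_⟩, ?_, ?_⟩
  · intro Y hY; exact ((hF Y).1 hY).2
  · intro Y hY v hv
    obtain ⟨c, hc⟩ := ((hF Y).1 hY).1
    obtain ⟨a, -, rfl⟩ := (hmem Y c hc v).1 hv
    exact fun hb => a.2 (Finset.mem_coe.2 hb)
  · intro Y hY Z hZ v hv hv'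
    obtain ⟨c, hc⟩ := ((hF Y).1 hY).1
    obtain ⟨d, hd⟩ := ((hF Z).1 hZ).1
    obtain ⟨a, rfl, rfl⟩ := (hmem Y c hc v).1 hv
    obtain ⟨b, rfl, hb⟩ := (hmem Z d hd _).1 hv'
    have := Subtype.val_injective hb
    subst this
    exact Finset.coe_injective (hc.trans hd.symm)
  · intro Y hY v hv w hvw
    obtain ⟨c, hc⟩ := ((hF Y).1 hY).1
    obtain ⟨a, rfl, rfl⟩ := (hmem Y c hc v).1 hv
    by_cases hw : w ∈ B
    · exact Or.inr hw
    · left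
      rw [hmem Y _ hc]
      refine ⟨⟨w, by simpa using hw⟩, ?_, rfl⟩
      rw [SimpleGraph.ConnectedComponent.eq]
      refine (SimpleGraph.Adj.reachable ?_).symm
      simpa using hvw
  · rw [← Fintype.card_coe, ← Nat.card_eq_fintype_card]
    refine Nat.card_congr (Equiv.subtypeEquiv Fintype.finsetEquivSet ?_)
    intro Y
    simp [F]
  · intro Y hodd hB hcl
    by_contra hcon
    push Not at hcon
    let comp : V → Finset V := fun v => univ.filter (fun w => ∃ (hv : v ∈ ((B : Set V))ᶜ)
      (hw : w ∈ ((B : Set V))ᶜ), (G.induce ((B : Set V))ᶜ).Reachable ⟨v, hv⟩ ⟨w, hw⟩)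
    have hsub : ∀ v ∈ Y, comp v ⊆ Y := by
      intro v hv w hw
      simp only [comp, Finset.mem_filter, Finset.mem_univ, true_and] at hw
      obtain ⟨h1, h2, ⟨p⟩⟩ := hw
      have : ∀ a b, (G.induce ((B : Set V))ᶜ).Walk a b → (a : V) ∈ Y → (b : V) ∈ Y := by
        intro a b p
        induction p with
        | nil => exact id
        | @cons a b c h _ ih =>
          intro ha
          refine ih ((hcl _ ha b (by simpa using h)).resolve_right ?_)
          exact fun hb => b.2 (Finset.mem_coe.2 hb)
      exact this _ _ p hv
    have heq : ∀ v ∈ Y, ∀ w ∈ Y, comp w = comp v ↔ w ∈ comp v := by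
      intro v hv w hw
      have hvB : v ∈ ((B : Set V))ᶜ := by simpa using hB v hv
      have hwB : w ∈ ((B : Set V))ᶜ := by simpa using hB w hw
      constructor
      · intro h
        rw [← h]
        simp only [comp, Finset.mem_filter, Finset.mem_univ, true_and]
        exact ⟨hwB, hwB, SimpleGraph.Reachable.refl _⟩
      · intro h
        simp only [comp, Finset.mem_filter, Finset.mem_univ, true_and] at h
        obtain ⟨h1, h2, h3⟩ := h
        ext z
        simp only [comp, Finset.mem_filter, Finset.mem_univ, true_and]
        constructor
        · rintro ⟨_, hz, h⟩; exact ⟨h1, hz, h3.trans h⟩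
        · rintro ⟨_, hz, h⟩; exact ⟨h2, hz, h3.symm.trans h⟩
    have hsum := Finset.card_eq_sum_card_image comp Y
    have heven : Even Y.card := by
      rw [hsum]
      refine Finset.even_sum _ ?_
      intro b hb
      obtain ⟨v, hv, rfl⟩ := Finset.mem_image.1 hb
      have : Y.filter (fun w => comp w = comp v) = comp v := by
        ext w
        rw [Finset.mem_filter]
        constructor
        · rintro ⟨hw, h⟩; exact (heq v hv w hw).1 h
        · intro h; exact ⟨hsub v hv h, (heq v hv w (hsub v hv h)).2 h⟩
      rw [this]
      by_contra hne
      rw [Nat.not_even_iff_odd] at hne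
      refine hcon (comp v) ((hF _).2 ⟨?_, hne⟩) (hsub v hv)
      have hvB : v ∈ ((B : Set V))ᶜ := by simpa using hB v hv
      refine ⟨(G.induce ((B : Set V))ᶜ).connectedComponentMk ⟨v, hvB⟩, ?_⟩
      ext w
      simp only [comp, Finset.coe_filter, Finset.mem_univ, true_and, Set.mem_ofPred_eq,
        Set.mem_image, SimpleGraph.ConnectedComponent.mem_supp_iff,
        SimpleGraph.ConnectedComponent.eq]
      constructor
      · rintro ⟨_, hw, h⟩; exact ⟨⟨w, hw⟩, h.symm, rfl⟩
      · rintro ⟨a, h, rfl⟩; exact ⟨hvB, a.2, h.symm⟩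
    exact (Nat.not_even_iff_odd.2 hodd) heven

lemma barrier_iff [Fintype V] (G : SimpleGraph V) (hG : MatchingCovered G) (B : Finset V) :
    IsBarrier G B ↔ 2 ≤ B.card ∧ PB G B := by
  classical
  obtain ⟨F, hF, hcard, hsub⟩ := comp_fam G B
  unfold IsBarrier
  rw [← hcard]
  constructor
  · rintro ⟨h1, h2⟩; exact ⟨h1, F, hF, h2.ge⟩
  · rintro ⟨h1, F', hF', h2⟩
    refine ⟨h1, le_antisymm (fam_le G hG B F hF) (h2.trans ?_)⟩
    have key : ∀ Y ∈ F', ∃ K ∈ F, K ⊆ Y := fun Y hY =>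
      hsub Y (hF'.1 Y hY) (hF'.2.1 Y hY) (hF'.2.2.2 Y hY)
    choose! g hg hg' using key
    apply Finset.card_le_card_of_injOn g (fun Y hY => hg Y hY)
    intro Y hY Z hZ h
    obtain ⟨v, hv⟩ := Finset.card_pos.1 (hF.1 _ (hg Y hY)).pos
    exact hF'.2.2.1 Y hY Z hZ v (hg' Y hY hv) (hg' Z hZ (h ▸ hv))

lemma odd_count {ι : Type*} [DecidableEq ι] (s : Finset ι) (f : ι → ℕ) :
    (∑ i ∈ s, f i) % 2 = (s.filter (fun i => Odd (f i))).card % 2 := by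
  have := Finset.odd_sum_iff_odd_card_odd (s := s) f
  simp only [Nat.odd_iff] at this ⊢
  omega

lemma core [Fintype V] (G : SimpleGraph V) (hG : MatchingCovered G) (S T : Finset V)
    (hS : PB G S) (hmax : ∀ S', PB G S' → S ⊆ S' → S = S') (hT : PB G T)
    (x z : V) (hxS : x ∈ S) (hxT : x ∈ T) (hzT : z ∈ T) (hzS : z ∉ S) : False := by
  classical
  obtain ⟨𝒦, hK, hKc⟩ := hS
  obtain ⟨ℒ, hL, hLc⟩ := hT
  have hKcov := fam_cover G hG S 𝒦 hK hKc ⟨x, hxS⟩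
  have hLcov := fam_cover G hG T ℒ hL hLc ⟨x, hxT⟩
  have hKle := fam_le G hG S 𝒦 hK
  obtain ⟨K1, K2, K3, K4⟩ := id hK
  obtain ⟨L1, L2, L3, L4⟩ := id hL
  -- splitting a finset along T and the members of ℒ
  have splitL : ∀ A : Finset V, A.card = (A ∩ T).card + ∑ L ∈ ℒ, (A ∩ L).card := by
    intro A
    rw [← Finset.card_biUnion, ← Finset.card_union_of_disjoint]
    · congr 1
      ext v
      simp only [Finset.mem_union, Finset.mem_inter, Finset.mem_biUnion]
      constructor
      · intro hv
        rcases hLcov v with h | ⟨L, h, h'⟩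
        · exact Or.inl ⟨hv, h⟩
        · exact Or.inr ⟨L, h, hv, h'⟩
      · rintro (h | ⟨L, h, h', h''⟩)
        exacts [h.1, h']
    · rw [Finset.disjoint_left]
      intro v hv hv'
      simp only [Finset.mem_inter, Finset.mem_biUnion] at hv hv'
      obtain ⟨L, h, h', h''⟩ := hv'
      exact L2 L h v h'' hv.2
    · intro L hL L' hL' hne
      simp only [Finset.disjoint_left, Finset.mem_inter]
      intro v hv hv'
      exact hne (L3 L hL L' hL' v hv.2 hv'.2)
  have splitK : ∀ A : Finset V, A.card = (A ∩ S).card + ∑ K ∈ 𝒦, (A ∩ K).card := by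
    intro A
    rw [← Finset.card_biUnion, ← Finset.card_union_of_disjoint]
    · congr 1
      ext v
      simp only [Finset.mem_union, Finset.mem_inter, Finset.mem_biUnion]
      constructor
      · intro hv
        rcases hKcov v with h | ⟨L, h, h'⟩
        · exact Or.inl ⟨hv, h⟩
        · exact Or.inr ⟨L, h, hv, h'⟩
      · rintro (h | ⟨L, h, h', h''⟩)
        exacts [h.1, h']
    · rw [Finset.disjoint_left]
      intro v hv hv'
      simp only [Finset.mem_inter, Finset.mem_biUnion] at hv hv'
      obtain ⟨L, h, h', h''⟩ := hv'
      exact K2 L h v h'' hv.2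
    · intro L hL L' hL' hne
      simp only [Finset.disjoint_left, Finset.mem_inter]
      intro v hv hv'
      exact hne (K3 L hL L' hL' v hv.2 hv'.2)
  have pieceCl : ∀ K ∈ 𝒦, ∀ L ∈ ℒ, ∀ v ∈ K ∩ L, ∀ w, G.Adj v w →
      w ∈ K ∩ L ∨ w ∈ S ∪ (K ∩ T) := by
    intro K hK L hL v hv w hvw
    rw [Finset.mem_inter] at hv
    have h1 := K4 K hK v hv.1 w hvw
    have h2 := L4 L hL v hv.2 w hvw
    simp only [Finset.mem_union, Finset.mem_inter]
    tauto
  -- K avoiding T lies in a single member of ℒ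
  have full : ∀ K ∈ 𝒦, K ∩ T = ∅ → ∃ L ∈ ℒ, K ⊆ L := by
    intro K hK hKT
    have hs := splitL K
    rw [hKT, Finset.card_empty, zero_add] at hs
    have hoc := odd_count ℒ (fun L => (K ∩ L).card)
    rw [← hs] at hoc
    have hKo := K1 K hK
    rw [Nat.odd_iff] at hKo
    have : 0 < (ℒ.filter (fun L => Odd (K ∩ L).card)).card := by omega
    obtain ⟨L, hL⟩ := Finset.card_pos.1 this
    rw [Finset.mem_filter] at hL
    refine ⟨L, hL.1, ?_⟩
    obtain ⟨w, hw⟩ := Finset.card_pos.1 hL.2.pos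
    have hnot : K ∩ L ∉ 𝒦.erase K := by
      intro h
      rw [Finset.mem_erase] at h
      exact h.1 (K3 _ h.2 K hK w hw (Finset.mem_inter.1 hw).1)
    have hfam : OddFam G S (insert (K ∩ L) (𝒦.erase K)) := by
      refine ⟨?_, ?_, ?_, ?_⟩
      · intro Y hY
        rcases Finset.mem_insert.1 hY with rfl | hY
        · exact hL.2
        · exact K1 Y (Finset.mem_of_mem_erase hY)
      · intro Y hY v hv
        rcases Finset.mem_insert.1 hY with rfl | hY
        · exact K2 K hK v (Finset.mem_inter.1 hv).1
        · exact K2 Y (Finset.mem_of_mem_erase hY) v hv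
      · intro Y hY Z hZ v hv hv'
        rcases Finset.mem_insert.1 hY with rfl | hY <;> rcases Finset.mem_insert.1 hZ with rfl | hZ
        · rfl
        · rw [Finset.mem_erase] at hZ
          exact absurd (K3 Z hZ.2 K hK v hv' (Finset.mem_inter.1 hv).1) hZ.1
        · rw [Finset.mem_erase] at hY
          exact absurd (K3 Y hY.2 K hK v hv (Finset.mem_inter.1 hv').1) hY.1
        · exact K3 Y (Finset.mem_of_mem_erase hY) Z (Finset.mem_of_mem_erase hZ) v hv hv'
      · intro Y hY v hv w hvw
        rcases Finset.mem_insert.1 hY with rfl | hY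
        · simpa [hKT] using pieceCl K hK L hL.1 v hv w hvw
        · exact K4 Y (Finset.mem_of_mem_erase hY) v hv w hvw
    intro v hv
    have hcov := fam_cover G hG S _ hfam (by
      rw [Finset.card_insert_of_notMem hnot, Finset.card_erase_add_one hK]; exact hKc) ⟨x, hxS⟩ v
    rcases hcov with h | ⟨Y, hY, h⟩
    · exact absurd h (K2 K hK v hv)
    · rcases Finset.mem_insert.1 hY with rfl | hY
      · exact (Finset.mem_inter.1 h).2
      · rw [Finset.mem_erase] at hY
        exact absurd (K3 Y hY.2 K hK v h hv) hY.1
  -- K meeting T has few odd pieces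
  have few : ∀ K ∈ 𝒦, (K ∩ T).Nonempty →
      (ℒ.filter (fun L => Odd (K ∩ L).card)).card + 1 ≤ (K ∩ T).card := by
    intro K hK hKT
    by_contra hcon
    have hs := splitL K
    have hoc := odd_count ℒ (fun L => (K ∩ L).card)
    have hKo := K1 K hK
    rw [Nat.odd_iff] at hKo
    set P := ℒ.filter (fun L => Odd (K ∩ L).card) with hP
    have hge : (K ∩ T).card + 1 ≤ P.card := by
      generalize (∑ L ∈ ℒ, (K ∩ L).card) = s at *
      omega
    have hPm : ∀ L, L ∈ P ↔ L ∈ ℒ ∧ Odd (K ∩ L).card := by intro L; rw [hP, Finset.mem_filter]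
    have hinj : Set.InjOn (fun L => K ∩ L) P := by
      intro L hL L' hL' h
      have hL := (hPm L).1 hL
      have hL' := (hPm L').1 hL'
      obtain ⟨w, hw⟩ := Finset.card_pos.1 hL.2.pos
      have hw' : w ∈ K ∩ L' := by
        have h : K ∩ L = K ∩ L' := h
        rwa [← h]
      exact L3 L hL.1 L' hL'.1 w (Finset.mem_inter.1 hw).2 (Finset.mem_inter.1 hw').2
    have hdisj : Disjoint (𝒦.erase K) (P.image (fun L => K ∩ L)) := by
      rw [Finset.disjoint_left]
      intro Y hY hY'
      obtain ⟨L, hL, rfl⟩ := Finset.mem_image.1 hY'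
      have hL := (hPm L).1 hL
      obtain ⟨w, hw⟩ := Finset.card_pos.1 hL.2.pos
      rw [Finset.mem_erase] at hY
      exact hY.1 (K3 _ hY.2 K hK w hw (Finset.mem_inter.1 hw).1)
    have hpb : PB G (S ∪ (K ∩ T)) := by
      refine ⟨𝒦.erase K ∪ P.image (fun L => K ∩ L), ⟨?_, ?_, ?_, ?_⟩, ?_⟩
      · intro Y hY
        rcases Finset.mem_union.1 hY with hY | hY
        · exact K1 Y (Finset.mem_of_mem_erase hY)
        · obtain ⟨L, hL, rfl⟩ := Finset.mem_image.1 hY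
          exact ((hPm L).1 hL).2
      · intro Y hY v hv hv'
        rcases Finset.mem_union.1 hY with hY | hY
        · rw [Finset.mem_erase] at hY
          rcases Finset.mem_union.1 hv' with h | h
          · exact K2 Y hY.2 v hv h
          · exact hY.1 (K3 Y hY.2 K hK v hv (Finset.mem_inter.1 h).1)
        · obtain ⟨L, hL, rfl⟩ := Finset.mem_image.1 hY
          rw [Finset.mem_inter] at hv
          rcases Finset.mem_union.1 hv' with h | h
          · exact K2 K hK v hv.1 h
          · exact L2 L ((hPm L).1 hL).1 v hv.2 (Finset.mem_inter.1 h).2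
      · intro Y hY Z hZ v hv hv'
        rcases Finset.mem_union.1 hY with hY | hY <;> rcases Finset.mem_union.1 hZ with hZ | hZ
        · exact K3 Y (Finset.mem_of_mem_erase hY) Z (Finset.mem_of_mem_erase hZ) v hv hv'
        · obtain ⟨L, hL, rfl⟩ := Finset.mem_image.1 hZ
          rw [Finset.mem_erase] at hY
          exact absurd (K3 Y hY.2 K hK v hv (Finset.mem_inter.1 hv').1) hY.1
        · obtain ⟨L, hL, rfl⟩ := Finset.mem_image.1 hY
          rw [Finset.mem_erase] at hZ
          exact absurd (K3 Z hZ.2 K hK v hv' (Finset.mem_inter.1 hv).1) hZ.1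
        · obtain ⟨L, hL, rfl⟩ := Finset.mem_image.1 hY
          obtain ⟨L', hL', rfl⟩ := Finset.mem_image.1 hZ
          rw [L3 L ((hPm L).1 hL).1 L' ((hPm L').1 hL').1 v (Finset.mem_inter.1 hv).2
            (Finset.mem_inter.1 hv').2]
      · intro Y hY v hv w hvw
        rcases Finset.mem_union.1 hY with hY | hY
        · rcases K4 Y (Finset.mem_of_mem_erase hY) v hv w hvw with h | h
          · exact Or.inl h
          · exact Or.inr (Finset.mem_union_left _ h)
        · obtain ⟨L, hL, rfl⟩ := Finset.mem_image.1 hY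
          exact pieceCl K hK L ((hPm L).1 hL).1 v hv w hvw
      · rw [Finset.card_union_of_disjoint hdisj, Finset.card_image_of_injOn hinj]
        have h1 := Finset.card_union_le S (K ∩ T)
        have h2 := Finset.card_erase_add_one hK
        omega
    have := hmax _ hpb Finset.subset_union_left
    obtain ⟨w, hw⟩ := hKT
    have hwS : w ∈ S := by rw [this]; exact Finset.mem_union_right _ hw
    exact K2 K hK w (Finset.mem_inter.1 hw).1 hwS
  -- the count
  let r : Finset V → ℕ := fun L => (𝒦.filter (fun K => K ⊆ L)).card
  let s : Finset V → ℕ := fun L => (S ∩ L).card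
  have hKne : ∀ K ∈ 𝒦, K.Nonempty := fun K hK => Finset.card_pos.1 (K1 K hK).pos
  have rdisj : ∀ J ⊆ ℒ, (J : Set (Finset V)).PairwiseDisjoint
      (fun L => 𝒦.filter (fun K => K ⊆ L)) := by
    intro J hJ L hL L' hL' hne
    simp only [Function.onFun, Finset.disjoint_left, Finset.mem_filter]
    intro K hK hK'
    obtain ⟨w, hw⟩ := hKne K hK.1
    exact hne (L3 L (hJ hL) L' (hJ hL') w (hK.2 hw) (hK'.2 hw))
  have sur : ∀ J ⊆ ℒ, ∑ L ∈ J, r L < (S ∩ T).card + ∑ L ∈ J, s L := by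
    intro J hJ
    have hr : ∑ L ∈ J, r L = (J.biUnion (fun L => 𝒦.filter (fun K => K ⊆ L))).card :=
      (Finset.card_biUnion (rdisj J hJ)).symm
    have hs : (S ∩ (T ∪ J.biUnion id)).card ≤ (S ∩ T).card + ∑ L ∈ J, s L := by
      rw [Finset.inter_union_distrib_left]
      refine (Finset.card_union_le _ _).trans ?_
      gcongr
      rw [Finset.inter_biUnion]
      exact Finset.card_biUnion_le
    rw [hr]
    refine lt_of_lt_of_le ?_ hs
    by_contra hcon
    push Not at hcon
    have hmemF : ∀ K, K ∈ J.biUnion (fun L => 𝒦.filter (fun K => K ⊆ L)) ↔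
        ∃ L ∈ J, K ∈ 𝒦 ∧ K ⊆ L := by intro K; simp
    have hxW : x ∈ S ∩ (T ∪ J.biUnion id) := by simp [hxS, hxT]
    have := fam_cover G hG (S ∩ (T ∪ J.biUnion id))
      (J.biUnion (fun L => 𝒦.filter (fun K => K ⊆ L))) (by
        refine ⟨?_, ?_, ?_, ?_⟩
        · intro Y hY
          obtain ⟨L, hL, hY, -⟩ := (hmemF Y).1 hY
          exact K1 Y hY
        · intro Y hY v hv hv'
          obtain ⟨L, hL, hY, -⟩ := (hmemF Y).1 hY
          exact K2 Y hY v hv (Finset.mem_inter.1 hv').1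
        · intro Y hY Z hZ
          obtain ⟨L, hL, hY, -⟩ := (hmemF Y).1 hY
          obtain ⟨L', hL', hZ, -⟩ := (hmemF Z).1 hZ
          exact K3 Y hY Z hZ
        · intro Y hY v hv w hvw
          obtain ⟨L, hL, hY, hYL⟩ := (hmemF Y).1 hY
          rcases K4 Y hY v hv w hvw with h | h
          · exact Or.inl h
          · right
            simp only [Finset.mem_inter, Finset.mem_union, Finset.mem_biUnion, id]
            refine ⟨h, ?_⟩
            rcases L4 L (hJ hL) v (hYL hv) w hvw with h | h
            · exact Or.inr ⟨L, hL, h⟩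
            · exact Or.inl h) hcon ⟨x, hxW⟩ z
    rcases this with h | ⟨Y, hY, h⟩
    · exact hzS (Finset.mem_inter.1 h).1
    · obtain ⟨L, hL, hY, hYL⟩ := (hmemF Y).1 hY
      exact L2 L (hJ hL) z (hYL h) hzT
  let PP := 𝒦.filter (fun K => (K ∩ T).Nonempty)
  have rtot : ∑ L ∈ ℒ, r L + PP.card = 𝒦.card := by
    have hr : ∑ L ∈ ℒ, r L = (ℒ.biUnion (fun L => 𝒦.filter (fun K => K ⊆ L))).card :=
      (Finset.card_biUnion (rdisj ℒ subset_rfl)).symm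
    have : ℒ.biUnion (fun L => 𝒦.filter (fun K => K ⊆ L)) =
        𝒦.filter (fun K => ¬ (K ∩ T).Nonempty) := by
      ext K
      simp only [Finset.mem_biUnion, Finset.mem_filter, Finset.not_nonempty_iff_eq_empty]
      constructor
      · rintro ⟨L, hL, hK, hKL⟩
        refine ⟨hK, ?_⟩
        rw [← Finset.not_nonempty_iff_eq_empty]
        rintro ⟨w, hw⟩
        rw [Finset.mem_inter] at hw
        exact L2 L hL w (hKL hw.1) hw.2
      · rintro ⟨hK, h⟩
        obtain ⟨L, hL, h⟩ := full K hK h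
        exact ⟨L, hL, hK, h⟩
    rw [hr, this, add_comm]
    exact Finset.card_filter_add_card_filter_not _
  have stot : S.card = (S ∩ T).card + ∑ L ∈ ℒ, s L := splitL S
  -- J1
  let J1 := ℒ.filter (fun L => ∃ K ∈ PP, Odd (K ∩ L).card)
  have hJ1 : J1.card + PP.card + (S ∩ T).card ≤ T.card := by
    have e1 : J1 ⊆ PP.biUnion (fun K => ℒ.filter (fun L => Odd (K ∩ L).card)) := by
      intro L hL
      obtain ⟨hL, K, hK, h⟩ := Finset.mem_filter.1 hL
      exact Finset.mem_biUnion.2 ⟨K, hK, Finset.mem_filter.2 ⟨hL, h⟩⟩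
    have e2 := (Finset.card_le_card e1).trans Finset.card_biUnion_le
    have e3 : ∑ K ∈ PP, ((ℒ.filter (fun L => Odd (K ∩ L).card)).card + 1) ≤
        ∑ K ∈ PP, (K ∩ T).card := by
      refine Finset.sum_le_sum ?_
      intro K hK
      obtain ⟨hK, h⟩ := Finset.mem_filter.1 hK
      exact few K hK h
    rw [Finset.sum_add_distrib, Finset.sum_const, smul_eq_mul, mul_one] at e3
    have e4 : ∑ K ∈ PP, (K ∩ T).card ≤ ∑ K ∈ 𝒦, (T ∩ K).card := by
      simp_rw [Finset.inter_comm T]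
      exact Finset.sum_le_sum_of_subset (Finset.filter_subset _ _)
    have e5 := splitK T
    rw [Finset.inter_comm T S] at e5
    omega
  have parity : ∀ L ∈ ℒ, L ∉ J1 → s L ≠ r L := by
    intro L hL hLJ heq
    have h1 := splitK L
    have h2 := odd_count 𝒦 (fun K => (L ∩ K).card)
    have h3 : 𝒦.filter (fun K => Odd (L ∩ K).card) = 𝒦.filter (fun K => K ⊆ L) := by
      apply Finset.filter_congr
      intro K hK
      constructor
      · intro h
        rw [Finset.inter_comm] at h
        by_cases hKT : (K ∩ T).Nonempty
        · exact absurd (Finset.mem_filter.2 ⟨hL, K, Finset.mem_filter.2 ⟨hK, hKT⟩, h⟩) hLJ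
        · rw [Finset.not_nonempty_iff_eq_empty] at hKT
          obtain ⟨L', hL', h'⟩ := full K hK hKT
          obtain ⟨w, hw⟩ := Finset.card_pos.1 h.pos
          rw [Finset.mem_inter] at hw
          rw [L3 L hL L' hL' w hw.2 (h' hw.1)]
          exact h'
      · intro h
        rw [Finset.inter_eq_right.2 h]
        exact K1 K hK
    rw [h3] at h2
    have h4 := L1 L hL
    rw [Nat.odd_iff] at h4
    have h5 : (L ∩ S).card = s L := by rw [Finset.inter_comm]
    have h6 : (𝒦.filter (fun K => K ⊆ L)).card = r L := rfl
    rw [h5] at h1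
    rw [h6] at h2
    omega
  let Jp := ℒ.filter (fun L => L ∉ J1 ∧ r L < s L)
  let Jm := ℒ.filter (fun L => L ∉ J1 ∧ s L < r L)
  have hcov : ℒ.card ≤ J1.card + Jp.card + Jm.card := by
    have : ℒ ⊆ J1 ∪ Jp ∪ Jm := by
      intro L hL
      by_cases h : L ∈ J1
      · simp [h]
      · rcases lt_or_gt_of_ne (parity L hL h) with h' | h'
        · exact Finset.mem_union_right _ (Finset.mem_filter.2 ⟨hL, h, h'⟩)
        · exact Finset.mem_union_left _
            (Finset.mem_union_right _ (Finset.mem_filter.2 ⟨hL, h, h'⟩))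
    refine (Finset.card_le_card this).trans ((Finset.card_union_le _ _).trans ?_)
    have := Finset.card_union_le J1 Jp
    omega
  have hm : Jm.card + ∑ L ∈ Jm, s L ≤ ∑ L ∈ Jm, r L := by
    rw [Finset.card_eq_sum_ones, ← Finset.sum_add_distrib]
    refine Finset.sum_le_sum ?_
    intro L hL
    have := (Finset.mem_filter.1 hL).2.2
    omega
  have hp : Jp.card + ∑ L ∈ Jp, r L ≤ ∑ L ∈ Jp, s L := by
    rw [Finset.card_eq_sum_ones, ← Finset.sum_add_distrib]
    refine Finset.sum_le_sum ?_
    intro L hL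
    have := (Finset.mem_filter.1 hL).2.2
    omega
  have hsm := sur Jm (Finset.filter_subset _ _)
  have hsp := sur (ℒ \ Jp) Finset.sdiff_subset
  have q1 := Finset.sum_sdiff (f := r) (Finset.filter_subset (fun L => L ∉ J1 ∧ r L < s L) ℒ)
  have q2 := Finset.sum_sdiff (f := s) (Finset.filter_subset (fun L => L ∉ J1 ∧ r L < s L) ℒ)
  change ∑ L ∈ ℒ \ Jp, r L + ∑ L ∈ Jp, r L = ∑ L ∈ ℒ, r L at q1
  change ∑ L ∈ ℒ \ Jp, s L + ∑ L ∈ Jp, s L = ∑ L ∈ ℒ, s L at q2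
  omega

/-- characterization of maximal barriers. -/
theorem maximal_barrier_iff [Fintype V] (G : SimpleGraph V)
    (hG : MatchingCovered G) (B : Finset V) (hB : 2 ≤ B.card) :
    (IsBarrier G B ∧ ∀ B' : Finset V, IsBarrier G B' → B ⊆ B' → B = B') ↔
      ((∀ x ∈ B, ∀ y ∈ B, x ≠ y →
          ¬ ∃ M : (G.induce ({x, y} : Set V)ᶜ).Subgraph, M.IsPerfectMatching) ∧
       (∀ x ∈ B, ∀ z : V, z ∉ B →
          ∃ M : (G.induce ({x, z} : Set V)ᶜ).Subgraph, M.IsPerfectMatching)) := by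
  classical
  have key : ∀ S : Finset V, 2 ≤ S.card → PB G S → (∀ S', PB G S' → S ⊆ S' → S = S') →
      ∀ x ∈ S, ∀ z : V, z ∉ S →
        ∃ M : (G.induce ({x, z} : Set V)ᶜ).Subgraph, M.IsPerfectMatching := by
    intro S hS hPB hmax x hx z hz
    by_contra hcon
    obtain ⟨T, hxT, hzT, hT⟩ := PB_of_no_pm G hG x z (by rintro rfl; exact hz hx) hcon
    exact core G hG S T hPB hmax hT x z hx hxT hzT hz
  constructor
  · rintro ⟨h1, h2⟩
    have hPB := ((barrier_iff G hG B).1 h1).2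
    refine ⟨fun x hx y hy _ => no_pm_of_PB G B hPB x y hx hy, key B hB hPB ?_⟩
    intro S' hS' hsub
    exact h2 S' ((barrier_iff G hG S').2 ⟨hB.trans (Finset.card_le_card hsub), hS'⟩) hsub
  · rintro ⟨h1, h2⟩
    obtain ⟨x, hx, y, hy, hxy⟩ := Finset.one_lt_card.1 hB
    obtain ⟨W, hxW, hyW, hW⟩ := PB_of_no_pm G hG x y hxy (h1 x hx y hy hxy)
    obtain ⟨S, hWS, hSmax⟩ := (Set.toFinite {S : Finset V | PB G S}).exists_le_maximal hW
    have hSPB : PB G S := hSmax.1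
    have hmax : ∀ S', PB G S' → S ⊆ S' → S = S' := fun S' h h' => hSmax.eq_of_le h h'
    have hxS : x ∈ S := hWS hxW
    have hyS : y ∈ S := hWS hyW
    have hScard : 2 ≤ S.card := Finset.one_lt_card.2 ⟨x, hxS, y, hyS, hxy⟩
    have hSB : S = B := by
      apply Finset.Subset.antisymm
      · intro z hz
        by_contra hzB
        exact no_pm_of_PB G S hSPB x z hxS hz (h2 x hx z hzB)
      · intro z hz
        by_contra hzS
        have hxz : x ≠ z := by rintro rfl; exact hzS hxS
        exact h1 x hx z hz hxz (key S hScard hSPB hmax x hxS z hzS)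
    subst hSB
    refine ⟨(barrier_iff G hG S).2 ⟨hB, hSPB⟩, ?_⟩
    intro B' hB' hsub
    exact hmax B' ((barrier_iff G hG B').1 hB').2 hsub
end

section
/- Let G be a matching covered graph that is Birkhoff–von Neumann. Then there exist perfect matchings M_1, …, M_k of G and distinct edges e_2, …, e_k with e_i ∈ M_i and e_i ∉ M_j for all j < i, such that the incidence vectors 1_{M_1}, …, 1_{M_k} are linearly independent over ℚ and the set of their integer linear combinations equals the perfect matching lattice L(G). -/
open BigOperators

variable {V : Type*}

open Classical in
/-- The incidence vector (over `ℚ`) of the edge set of a subgraph `M` of `G`. -/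
noncomputable def incVecQ (G : SimpleGraph V) (M : G.Subgraph) : Sym2 V → ℚ :=
  fun e => if e ∈ M.edgeSet then (1 : ℚ) else 0

/-- The perfect matching lattice: all integer linear combinations of incidence
vectors of perfect matchings, inside `ℚ^{Sym2 V}`. -/
noncomputable def pmLattice (G : SimpleGraph V) : Submodule ℤ (Sym2 V → ℚ) :=
  Submodule.span ℤ {x | ∃ M : G.Subgraph, M.IsPerfectMatching ∧ x = incVecQ G M}

open Classical in
/-- The incidence vector (over `ℝ`) of the edge set of a subgraph `M` of `G`. -/
noncomputable def incVecR (G : SimpleGraph V) (M : G.Subgraph) : Sym2 V → ℝ :=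
  fun e => if e ∈ M.edgeSet then (1 : ℝ) else 0

/-- The perfect matching polytope: convex hull of incidence vectors of perfect
matchings. -/
def pmPolytope (G : SimpleGraph V) : Set (Sym2 V → ℝ) :=
  convexHull ℝ {x | ∃ M : G.Subgraph, M.IsPerfectMatching ∧ x = incVecR G M}

/-- The bipartite relaxation `P(G)`: nonnegative vectors supported on the edges
of `G` whose sum over the edges at each vertex is `1`. -/
def bipRelaxation [Fintype V] [DecidableEq V] (G : SimpleGraph V) : Set (Sym2 V → ℝ) :=
  {x | (∀ e, 0 ≤ x e) ∧ (∀ e, e ∉ G.edgeSet → x e = 0) ∧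
    ∀ v : V, ∑ e ∈ Finset.univ.filter (fun e : Sym2 V => v ∈ e), x e = 1}

/-- A matching covered graph is Birkhoff–von Neumann if its perfect matching
polytope equals its bipartite relaxation. -/
def IsBvN [Fintype V] [DecidableEq V] (G : SimpleGraph V) : Prop :=
  pmPolytope G = bipRelaxation G


open Classical in
theorem tri_aux {K : Type*} [Field K] {X : Type*} (H : AddSubgroup K) {k : ℕ}
    (A : Fin k → Set X) (e : Fin k → X)
    (h1 : ∀ i, e i ∈ A i) (h2 : ∀ i j, j < i → e i ∉ A j) (c : Fin k → K)
    (hc : ∀ i, ∑ j, c j * (if e i ∈ A j then (1 : K) else 0) ∈ H) :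
    ∀ i, c i ∈ H := by
  intro i
  induction i using WellFoundedGT.induction with
  | ind i ih =>
    have h := hc i
    rw [← Finset.add_sum_erase _ _ (Finset.mem_univ i)] at h
    rw [if_pos (h1 i), mul_one] at h
    refine (H.add_mem_cancel_right ?_).1 h
    refine H.sum_mem ?_
    intro j hj
    have hne := (Finset.mem_erase.1 hj).1
    rcases lt_or_gt_of_ne hne with hlt | hgt
    · rw [if_neg (h2 i j hlt), mul_zero]; exact H.zero_mem
    · split_ifs
      · rw [mul_one]; exact ih j hgt
      · rw [mul_zero]; exact H.zero_mem

/-- `T` is a union of perfect matchings. -/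
def PMCovered (G : SimpleGraph V) (T : Finset (Sym2 V)) : Prop :=
  ∀ e ∈ T, ∃ N : G.Subgraph, N.IsPerfectMatching ∧ N.edgeSet ⊆ ↑T ∧ e ∈ N.edgeSet

theorem incVecR_mem_rel [Fintype V] [DecidableEq V] (G : SimpleGraph V) (hB : IsBvN G)
    (N : G.Subgraph) (hN : N.IsPerfectMatching) : incVecR G N ∈ bipRelaxation G := by
  rw [← hB]
  exact subset_convexHull ℝ _ ⟨N, hN, rfl⟩

theorem incVecR_nonneg (G : SimpleGraph V) (N : G.Subgraph) (e : Sym2 V) :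
    0 ≤ incVecR G N e := by
  unfold incVecR; split_ifs <;> norm_num

/-- A point of the relaxation supported in `S` lies in the span of the perfect matchings in `S`. -/
theorem mem_span_of_rel [Fintype V] [DecidableEq V] (G : SimpleGraph V) (hB : IsBvN G)
    (S : Finset (Sym2 V)) (y : Sym2 V → ℝ) (hy : y ∈ bipRelaxation G)
    (hS : ∀ e, e ∉ S → y e = 0) :
    y ∈ Submodule.span ℝ {x | ∃ N : G.Subgraph, N.IsPerfectMatching ∧ N.edgeSet ⊆ ↑S ∧
      x = incVecR G N} := by
  rw [← hB, pmPolytope, mem_convexHull_iff_exists_fintype] at hy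
  obtain ⟨ι, _, w, z, hw, hw1, hz, rfl⟩ := hy
  refine Submodule.sum_mem _ ?_
  intro i _
  rcases (hw i).eq_or_lt with h0 | hpos
  · rw [← h0, zero_smul]; exact Submodule.zero_mem _
  · refine Submodule.smul_mem _ _ (Submodule.subset_span ?_)
    obtain ⟨N, hN, hzN⟩ := hz i
    refine ⟨N, hN, ?_, hzN⟩
    intro e he
    by_contra heS
    have h := hS e heS
    rw [Finset.sum_apply] at h
    have hnn : ∀ j ∈ Finset.univ, 0 ≤ (w j • z j) e := by
      intro j _
      obtain ⟨N', _, hz'⟩ := hz j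
      rw [hz', Pi.smul_apply, smul_eq_mul]
      exact mul_nonneg (hw j) (incVecR_nonneg G N' e)
    have h3 := (Finset.sum_eq_zero_iff_of_nonneg hnn).1 h i (Finset.mem_univ i)
    rw [hzN, Pi.smul_apply, smul_eq_mul] at h3
    simp only [incVecR, if_pos he, mul_one] at h3
    exact hpos.ne' h3

theorem mem_span_of_zero_sum [Fintype V] [DecidableEq V] (G : SimpleGraph V) (hB : IsBvN G)
    (S : Finset (Sym2 V)) (hcov : PMCovered G S) (w : Sym2 V → ℝ)
    (hS : ∀ e, e ∉ S → w e = 0)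
    (hsum : ∀ v : V, ∑ e ∈ Finset.univ.filter (fun e : Sym2 V => v ∈ e), w e = 0) :
    w ∈ Submodule.span ℝ {x | ∃ N : G.Subgraph, N.IsPerfectMatching ∧ N.edgeSet ⊆ ↑S ∧
      x = incVecR G N} := by
  classical
  rcases S.eq_empty_or_nonempty with rfl | ⟨e0, he0⟩
  · have : w = 0 := by
      funext e; exact hS e (by simp)
    rw [this]; exact Submodule.zero_mem _
  have hfin : Finite G.Subgraph := inferInstance
  have : Fintype G.Subgraph := Fintype.ofFinite _
  set F : Finset G.Subgraph :=
    Finset.univ.filter (fun N => N.IsPerfectMatching ∧ N.edgeSet ⊆ (↑S : Set (Sym2 V))) with hF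
  have hmem : ∀ N, N ∈ F ↔ N.IsPerfectMatching ∧ N.edgeSet ⊆ (↑S : Set (Sym2 V)) := by
    intro N; simp [hF]
  set x : Sym2 V → ℝ := ∑ N ∈ F, incVecR G N with hx
  have hxspan : x ∈ Submodule.span ℝ {x | ∃ N : G.Subgraph, N.IsPerfectMatching ∧
      N.edgeSet ⊆ ↑S ∧ x = incVecR G N} := by
    refine Submodule.sum_mem _ fun N hN => Submodule.subset_span ?_
    exact ⟨N, ((hmem N).1 hN).1, ((hmem N).1 hN).2, rfl⟩
  have hFne : F.Nonempty := by
    obtain ⟨N, h1, h2, _⟩ := hcov e0 he0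
    exact ⟨N, (hmem N).2 ⟨h1, h2⟩⟩
  have hn : (0 : ℝ) < F.card := by exact_mod_cast hFne.card_pos
  have hx1 : ∀ e ∈ S, 1 ≤ x e := by
    intro e he
    obtain ⟨N, h1, h2, h3⟩ := hcov e he
    have h4 : incVecR G N e = 1 := by simp [incVecR, h3]
    rw [hx, Finset.sum_apply, ← h4]
    exact Finset.single_le_sum (f := fun N => incVecR G N e)
      (fun N _ => incVecR_nonneg G N e) ((hmem N).2 ⟨h1, h2⟩)
  have hx0 : ∀ e, e ∉ S → x e = 0 := by
    intro e he
    rw [hx, Finset.sum_apply]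
    refine Finset.sum_eq_zero fun N hN => ?_
    have : e ∉ N.edgeSet := fun h => he (((hmem N).1 hN).2 h)
    simp [incVecR, this]
  have hxG : ∀ e, e ∉ G.edgeSet → x e = 0 := by
    intro e he
    rw [hx, Finset.sum_apply]
    exact Finset.sum_eq_zero fun N hN => (incVecR_mem_rel G hB N ((hmem N).1 hN).1).2.1 e he
  have hSG : ∀ e ∈ S, e ∈ G.edgeSet := by
    intro e he
    by_contra h
    have := hx1 e he
    rw [hxG e h] at this
    norm_num at this
  have hxv : ∀ v : V, ∑ e ∈ Finset.univ.filter (fun e : Sym2 V => v ∈ e), x e = F.card := by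
    intro v
    simp only [hx, Finset.sum_apply]
    rw [Finset.sum_comm]
    rw [Finset.sum_congr rfl
      (fun N hN => (incVecR_mem_rel G hB N ((hmem N).1 hN).1).2.2 v)]
    simp
  set C : ℝ := (∑ e, |w e|) + 1 with hC
  have hCw : ∀ e, |w e| ≤ C := by
    intro e
    have := Finset.single_le_sum (f := fun e => |w e|) (fun e _ => abs_nonneg _)
      (Finset.mem_univ e)
    linarith
  have hCpos : 0 < C := by
    have : 0 ≤ ∑ e, |w e| := Finset.sum_nonneg fun e _ => abs_nonneg _
    linarith
  set D : ℝ := C * F.card with hD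
  have hDpos : 0 < D := mul_pos hCpos hn
  have hy : D⁻¹ • (w + C • x) ∈ bipRelaxation G := by
    refine ⟨?_, ?_, ?_⟩
    · intro e
      simp only [Pi.smul_apply, Pi.add_apply, smul_eq_mul]
      refine mul_nonneg (inv_nonneg.2 hDpos.le) ?_
      by_cases he : e ∈ S
      · have h1 := hx1 e he
        have h2 := (abs_le.1 (hCw e)).1
        nlinarith
      · rw [hS e he, hx0 e he]; simp
    · intro e he
      have : e ∉ S := fun h => he (hSG e h)
      simp [hS e this, hx0 e this]
    · intro v
      simp only [Pi.smul_apply, Pi.add_apply, smul_eq_mul]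
      rw [← Finset.mul_sum, Finset.sum_add_distrib, hsum, ← Finset.mul_sum, hxv, zero_add]
      exact inv_mul_cancel₀ hDpos.ne'
  have hyS := mem_span_of_rel G hB S _ hy (by
    intro e he
    simp [hS e he, hx0 e he])
  have hw : w = D • (D⁻¹ • (w + C • x)) - C • x := by
    rw [smul_smul, mul_inv_cancel₀ hDpos.ne', one_smul, add_sub_cancel_right]
  rw [hw]
  exact Submodule.sub_mem _ (Submodule.smul_mem _ _ hyS) (Submodule.smul_mem _ _ hxspan)

theorem chain_exists [Fintype V] [DecidableEq V] (G : SimpleGraph V) (hB : IsBvN G)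
    (S : Finset (Sym2 V)) :
    ∃ (k : ℕ) (M : Fin k → G.Subgraph) (e : Fin k → Sym2 V),
      (∀ i, (M i).IsPerfectMatching) ∧ (∀ i, (M i).edgeSet ⊆ ↑S) ∧
      (∀ i, e i ∈ (M i).edgeSet) ∧ (∀ i j, j < i → e i ∉ (M j).edgeSet) ∧
      ∀ N : G.Subgraph, N.IsPerfectMatching → N.edgeSet ⊆ ↑S →
        incVecR G N ∈ Submodule.span ℝ (Set.range fun i => incVecR G (M i)) := by
  classical
  induction S using Finset.strongInduction with
  | H S ih =>
  by_cases hcov : PMCovered G S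
  swap
  · unfold PMCovered at hcov
    push Not at hcov
    obtain ⟨e, he, hno⟩ := hcov
    obtain ⟨k, M, f, h1, h2, h3, h4, h5⟩ := ih (S.erase e) (Finset.erase_ssubset he)
    refine ⟨k, M, f, h1, fun i => (h2 i).trans (by simp), h3, h4, ?_⟩
    intro N hN hNS
    refine h5 N hN ?_
    intro a ha
    have : a ≠ e := by rintro rfl; exact hno N hN hNS ha
    simpa [this] using hNS ha
  rcases S.eq_empty_or_nonempty with rfl | hne
  · refine ⟨0, Fin.elim0, Fin.elim0, fun i => i.elim0, fun i => i.elim0, fun i => i.elim0,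
      fun i => i.elim0, ?_⟩
    intro N _ hNS
    have : incVecR G N = 0 := by
      funext e
      have : e ∉ N.edgeSet := fun h => by simpa using hNS h
      simp [incVecR, this]
    rw [this]; exact Submodule.zero_mem _
  obtain ⟨T, hT, hTmax⟩ := Finset.exists_max_image
    (S.ssubsets.filter (fun T => PMCovered G T)) Finset.card
    ⟨∅, by
      simp only [Finset.mem_filter, Finset.mem_ssubsets]
      exact ⟨Finset.empty_ssubset.2 hne, fun e he => by simp at he⟩⟩
  simp only [Finset.mem_filter, Finset.mem_ssubsets] at hT hTmax
  obtain ⟨hTS, hTcov⟩ := hT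
  have key : ∀ N : G.Subgraph, N.IsPerfectMatching → N.edgeSet ⊆ (↑S : Set (Sym2 V)) →
      ¬ N.edgeSet ⊆ (↑T : Set (Sym2 V)) → ∀ e ∈ S, e ∉ T → e ∈ N.edgeSet := by
    intro N hN hNS hNT e heS heT
    by_contra heN
    obtain ⟨a, haN, haT⟩ := Set.not_subset.1 hNT
    have hlt : (S.filter (fun b => b ∈ T ∨ b ∈ N.edgeSet)) ⊂ S :=
      Finset.filter_ssubset.2 ⟨e, heS, by tauto⟩
    have hsub : T ⊂ S.filter (fun b => b ∈ T ∨ b ∈ N.edgeSet) := by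
      refine (Finset.ssubset_iff_of_subset ?_).2 ⟨a, ?_, haT⟩
      · intro b hb
        exact Finset.mem_filter.2 ⟨hTS.1 hb, Or.inl hb⟩
      · exact Finset.mem_filter.2 ⟨hNS haN, Or.inr haN⟩
    have hc : PMCovered G (S.filter (fun b => b ∈ T ∨ b ∈ N.edgeSet)) := by
      intro b hb
      rcases (Finset.mem_filter.1 hb).2 with hbT | hbN
      · obtain ⟨K, hK, hKT, hbK⟩ := hTcov b hbT
        exact ⟨K, hK, fun c hc => hsub.1 (hKT hc), hbK⟩
      · exact ⟨N, hN, fun c hc => Finset.mem_filter.2 ⟨hNS hc, Or.inr hc⟩, hbN⟩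
    have := hTmax _ ⟨hlt, hc⟩
    exact absurd (Finset.card_lt_card hsub) (not_lt.2 this)
  obtain ⟨k, M, f, h1, h2, h3, h4, h5⟩ := ih T hTS
  obtain ⟨e, heS, heT⟩ := Finset.exists_of_ssubset hTS
  obtain ⟨N, hN, hNS, heN⟩ := hcov e heS
  have hNT : ¬ N.edgeSet ⊆ (↑T : Set (Sym2 V)) := fun h => heT (h heN)
  refine ⟨k + 1, Fin.snoc M N, Fin.snoc f e, ?_, ?_, ?_, ?_, ?_⟩
  · intro i
    induction i using Fin.lastCases with
    | last => simpa using hN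
    | cast i => simpa using h1 i
  · intro i
    induction i using Fin.lastCases with
    | last => simpa using hNS
    | cast i => simpa using (h2 i).trans (Finset.coe_subset.2 hTS.1)
  · intro i
    induction i using Fin.lastCases with
    | last => simpa using heN
    | cast i => simpa using h3 i
  · intro i j hij
    induction j using Fin.lastCases with
    | last => exact absurd hij (not_lt.2 (Fin.le_last i))
    | cast j =>
      induction i using Fin.lastCases with
      | last =>
        simp only [Fin.snoc_last, Fin.snoc_castSucc]
        exact fun h => heT (h2 j h)
      | cast i =>
        simp only [Fin.snoc_castSucc]
        exact h4 i j (by simpa using hij)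
  · intro K hK hKS
    set W := Submodule.span ℝ (Set.range fun i =>
      incVecR G ((Fin.snoc M N : Fin (k + 1) → G.Subgraph) i)) with hW
    have hle : Submodule.span ℝ (Set.range fun i => incVecR G (M i)) ≤ W := by
      refine Submodule.span_mono ?_
      rintro _ ⟨i, rfl⟩
      exact ⟨i.castSucc, by simp⟩
    by_cases hKT : K.edgeSet ⊆ (↑T : Set (Sym2 V))
    · exact hle (h5 K hK hKT)
    have hNW : incVecR G N ∈ W := Submodule.subset_span ⟨Fin.last k, by simp⟩
    have hd := mem_span_of_zero_sum G hB T hTcov (incVecR G K - incVecR G N) (by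
      intro a haT
      by_cases haS : a ∈ S
      · simp [incVecR, key K hK hKS hKT a haS haT, key N hN hNS hNT a haS haT]
      · have a1 : a ∉ K.edgeSet := fun h => haS (hKS h)
        have a2 : a ∉ N.edgeSet := fun h => haS (hNS h)
        simp [incVecR, a1, a2]) (by
      intro v
      simp only [Pi.sub_apply]
      rw [Finset.sum_sub_distrib, (incVecR_mem_rel G hB K hK).2.2 v,
        (incVecR_mem_rel G hB N hN).2.2 v, sub_self])
    have hd' : incVecR G K - incVecR G N ∈ W := by
      refine (Submodule.span_le.2 ?_) hd
      rintro _ ⟨L, hL, hLT, rfl⟩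
      exact hle (h5 L hL hLT)
    have := W.add_mem hd' hNW
    rwa [sub_add_cancel] at this

/-- a matching covered Birkhoff–von Neumann graph has perfect
matchings `M₁, …, Mₖ` and distinct edges `e₂, …, eₖ` with `eᵢ ∈ Mᵢ` and
`eᵢ ∉ Mⱼ` for `j < i`, whose incidence vectors are linearly independent and
integrally span the perfect matching lattice. -/
theorem bvn_lattice_basis [Fintype V] [DecidableEq V] (G : SimpleGraph V)
    (hG : MatchingCovered G) (hBvN : IsBvN G) :
    ∃ (k : ℕ) (M : Fin k → G.Subgraph) (e : Fin k → Sym2 V),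
      (∀ i, (M i).IsPerfectMatching) ∧
      (∀ i j : Fin k, 0 < (i : ℕ) → 0 < (j : ℕ) → i ≠ j → e i ≠ e j) ∧
      (∀ i : Fin k, 0 < (i : ℕ) →
        e i ∈ (M i).edgeSet ∧ ∀ j : Fin k, j < i → e i ∉ (M j).edgeSet) ∧
      LinearIndependent ℚ (fun i => incVecQ G (M i)) ∧
      Submodule.span ℤ (Set.range fun i => incVecQ G (M i)) = pmLattice G := by
  classical
  obtain ⟨k, M, e, h1, -, h3, h4, h5⟩ := chain_exists G hBvN Finset.univ
  refine ⟨k, M, e, h1, ?_, fun i _ => ⟨h3 i, h4 i⟩, ?_, ?_⟩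
  · intro i j _ _ hij heq
    rcases lt_or_gt_of_ne hij with h | h
    · exact h4 j i h (heq ▸ h3 i)
    · exact h4 i j h (heq ▸ h3 j)
  · rw [Fintype.linearIndependent_iff]
    intro c hc
    have := tri_aux (⊥ : AddSubgroup ℚ) (fun i => (M i).edgeSet) e h3 h4 c (by
      intro i
      have h := congrFun hc (e i)
      simp only [Finset.sum_apply, Pi.smul_apply, smul_eq_mul, incVecQ, Pi.zero_apply] at h
      rw [AddSubgroup.mem_bot]
      convert h)
    intro i
    exact AddSubgroup.mem_bot.1 (this i)
  · unfold pmLattice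
    refine le_antisymm (Submodule.span_mono ?_) (Submodule.span_le.2 ?_)
    · rintro _ ⟨i, rfl⟩
      exact ⟨M i, h1 i, rfl⟩
    · rintro _ ⟨N, hN, rfl⟩
      obtain ⟨c, hc⟩ := (Submodule.mem_span_range_iff_exists_fun ℝ).1 (h5 N hN (by simp))
      have hci := tri_aux (Int.castAddHom ℝ).range (fun i => (M i).edgeSet) e h3 h4 c (by
        intro i
        have h := congrFun hc (e i)
        simp only [Finset.sum_apply, Pi.smul_apply, smul_eq_mul, incVecR] at h
        refine ⟨if e i ∈ N.edgeSet then 1 else 0, ?_⟩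
        have h' : ((if e i ∈ N.edgeSet then (1 : ℤ) else 0 : ℤ) : ℝ)
            = if e i ∈ N.edgeSet then (1 : ℝ) else 0 := by split_ifs <;> simp
        refine h'.trans ?_
        convert h.symm)
      choose z hz using hci
      refine (Submodule.mem_span_range_iff_exists_fun ℤ).2 ⟨z, ?_⟩
      funext a
      have h := congrFun hc a
      have hcast : ∀ K : G.Subgraph, ((incVecQ G K a : ℚ) : ℝ) = incVecR G K a := by
        intro K
        unfold incVecQ incVecR
        split_ifs <;> simp
      simp only [Finset.sum_apply, Pi.smul_apply, smul_eq_mul, ← hz,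
        Int.coe_castAddHom, ← hcast] at h
      simp only [Finset.sum_apply, Pi.smul_apply]
      simp only [zsmul_eq_mul]
      exact_mod_cast h
end

section
/- Let G be a matching covered graph on an even number n of vertices and let C be an odd cut of G. Let B be a finite set of perfect matchings of G, each satisfying |M ∩ C| = 1, and let M* be a perfect matching of G with |M* ∩ C| = 3. Assume: (1) the incidence vectors of the matchings in B ∪ {M*} are linearly independent over ℚ; (2) the incidence vector of every perfect matching of G lies in the ℚ-linear span of the incidence vectors of B ∪ {M*}; and (3) every integer vector in the ℚ-linear span of the incidence vectors of B is an integer linear combination of them. Then every element of the perfect matching lattice L(G) is an integer linear combination of the incidence vectors of B ∪ {M*}. -/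
open BigOperators

variable {V : Type*}

/-- Perfect matchings meet an odd cut in an odd number of edges. -/
theorem odd_inter_cut [Fintype V] (G : SimpleGraph V) (U : Set V) (hU : Odd U.ncard)
    (N : G.Subgraph) (hN : N.IsPerfectMatching) :
    Odd (N.edgeSet ∩ cutSet G U).ncard := by
  classical
  have hex : ∀ v, ∃! w, N.Adj v w := fun v => hN.1 (hN.2 v)
  choose p hp hpu using hex
  have hpp : ∀ v, p (p v) = v := fun v => (hpu (p v) v (hp v).symm).symm
  have hne : ∀ v, p v ≠ v := fun v h => (hp v).ne h.symm
  have himg : N.edgeSet ∩ cutSet G U = (fun u => s(u, p u)) '' {u | u ∈ U ∧ p u ∉ U} := by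
    ext e
    constructor
    · rintro ⟨he, -, a, b, rfl, ha, hb⟩
      have hab : N.Adj a b := he
      have := hpu a b hab
      subst this
      exact ⟨a, ⟨ha, hb⟩, rfl⟩
    · rintro ⟨u, ⟨hu, hpu'⟩, rfl⟩
      exact ⟨hp u, N.adj_sub (hp u), u, p u, rfl, hu, hpu'⟩
  have hinj : Set.InjOn (fun u => s(u, p u)) {u | u ∈ U ∧ p u ∉ U} := by
    rintro a ⟨ha, ha'⟩ b ⟨hb, hb'⟩ h
    rcases Sym2.eq_iff.1 h with h | h
    · exact h.1
    · exact absurd (h.1 ▸ ha) hb'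
  rw [himg, hinj.ncard_image]
  have hA : {u | u ∈ U ∧ p u ∉ U}.ncard = (Finset.univ.filter fun u => u ∈ U ∧ p u ∉ U).card := by
    rw [← Set.ncard_coe_finset]; simp
  have hB : U.ncard = (Finset.univ.filter fun u => u ∈ U).card := by
    rw [← Set.ncard_coe_finset]; simp
  have hsplit := Finset.card_filter_add_card_filter_not (s := Finset.univ.filter fun u => u ∈ U)
    (fun u => p u ∈ U)
  rw [Finset.filter_filter, Finset.filter_filter] at hsplit
  have hz : (((Finset.univ.filter fun u => u ∈ U ∧ p u ∈ U).card : ℕ) : ZMod 2) = 0 := by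
    rw [Finset.card_eq_sum_ones, Nat.cast_sum]
    refine Finset.sum_involution (fun a _ => p a) ?_ ?_ ?_ ?_
    · intro a _; decide
    · intro a _ _; exact hne a
    · intro a ha
      simp only [Finset.mem_filter, Finset.mem_univ, true_and] at ha ⊢
      exact ⟨ha.2, by rw [hpp]; exact ha.1⟩
    · intro a _; exact hpp a
  rw [ZMod.natCast_eq_zero_iff] at hz
  rw [hA]
  rw [hB] at hU
  rw [Nat.odd_iff] at *
  omega

/-- Degree functional. -/
theorem sum_star [Fintype V] (G : SimpleGraph V) (v : V)
    (N : G.Subgraph) (hN : N.IsPerfectMatching) : ∑ w, incVecQ G N s(v, w) = 1 := by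
  classical
  obtain ⟨w, hw, hu⟩ := hN.1 (hN.2 v)
  rw [Finset.sum_eq_single w]
  · simp only [incVecQ, SimpleGraph.Subgraph.mem_edgeSet]; rw [if_pos hw]
  · intro b _ hb
    simp only [incVecQ, SimpleGraph.Subgraph.mem_edgeSet]
    rw [if_neg]
    intro h; exact hb (hu b h)
  · simp

open Classical in
/-- Cut functional. -/
theorem sum_cut [Fintype V] (G : SimpleGraph V) (U : Set V) (N : G.Subgraph) :
    ∑ e ∈ Finset.univ.filter (fun e => e ∈ cutSet G U), incVecQ G N e =
      ((N.edgeSet ∩ cutSet G U).ncard : ℚ) := by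
  simp only [incVecQ]
  rw [Finset.sum_boole, Finset.filter_filter, ← Set.ncard_coe_finset]
  congr 2
  ext e
  simp [and_comm]

/-- augmenting an integral basis of matchings meeting an odd cut once
with a matching meeting it three times integrally generates the matching lattice. -/
theorem lattice_spanned_by_augmented_basis [Fintype V] (G : SimpleGraph V)
    (hG : MatchingCovered G) (heven : Even (Fintype.card V))
    (U : Set V) (hodd : IsOddCutShore U)
    (B : Finset G.Subgraph)
    (hB : ∀ M ∈ B, M.IsPerfectMatching ∧ (M.edgeSet ∩ cutSet G U).ncard = 1)
    (Mstar : G.Subgraph) (hMstar : Mstar.IsPerfectMatching)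
    (hM3 : (Mstar.edgeSet ∩ cutSet G U).ncard = 3)
    (hind : LinearIndependent ℚ
      (fun M : ((B : Set G.Subgraph) ∪ {Mstar} : Set G.Subgraph) =>
        incVecQ G (M : G.Subgraph)))
    (hspan : ∀ N : G.Subgraph, N.IsPerfectMatching →
      incVecQ G N ∈ Submodule.span ℚ (incVecQ G '' ((B : Set G.Subgraph) ∪ {Mstar})))
    (hintB : ∀ x ∈ Submodule.span ℚ (incVecQ G '' (B : Set G.Subgraph)),
      (∀ e, ∃ n : ℤ, x e = n) →
        x ∈ Submodule.span ℤ (incVecQ G '' (B : Set G.Subgraph))) :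
    ∀ y ∈ pmLattice G,
      y ∈ Submodule.span ℤ (incVecQ G '' ((B : Set G.Subgraph) ∪ {Mstar})) := by
  classical
  obtain ⟨v⟩ := hG.1.nonempty
  intro y hy
  refine (Submodule.span_le.2 ?_ : pmLattice G ≤ _) hy
  rintro _ ⟨N, hN, rfl⟩
  have h := hspan N hN
  rw [Set.image_union, Set.image_singleton, Set.union_comm, Set.singleton_union,
    Submodule.mem_span_insert] at h
  obtain ⟨c, z, hz, hNz⟩ := h
  have key : ∑ w, z s(v, w) = ∑ e ∈ Finset.univ.filter (fun e => e ∈ cutSet G U), z e := by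
    clear hNz
    induction hz using Submodule.span_induction with
    | mem x hx =>
      obtain ⟨M, hM, rfl⟩ := hx
      rw [sum_star G v M (hB M hM).1, sum_cut, (hB M hM).2, Nat.cast_one]
    | zero => simp
    | add x y _ _ hx hy => simp only [Pi.add_apply, Finset.sum_add_distrib, hx, hy]
    | smul a x _ hx => simp only [Pi.smul_apply, ← Finset.smul_sum, hx]
  have h1 := sum_star G v N hN
  have h2 := sum_cut G U N
  rw [hNz] at h1
  conv_lhs at h2 => rw [hNz]
  simp only [Pi.add_apply, Pi.smul_apply, Finset.sum_add_distrib, ← Finset.smul_sum] at h1 h2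
  rw [sum_star G v Mstar hMstar] at h1
  rw [sum_cut, hM3] at h2
  obtain ⟨k, hk⟩ := odd_inter_cut G U hodd.1 N hN
  rw [hk] at h2
  push_cast at h2
  simp only [smul_eq_mul] at h1 h2
  have hc : c = (k : ℤ) := by push_cast; linarith
  have hzint : z ∈ Submodule.span ℤ (incVecQ G '' (B : Set G.Subgraph)) := by
    apply hintB z hz
    intro e
    have he := congrFun hNz e
    simp only [Pi.add_apply, Pi.smul_apply, smul_eq_mul, hc] at he
    have hi : ∀ M : G.Subgraph, ∃ n : ℤ, incVecQ G M e = n := by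
      intro M
      unfold incVecQ
      split_ifs
      · exact ⟨1, by simp⟩
      · exact ⟨0, by simp⟩
    obtain ⟨a, ha⟩ := hi N
    obtain ⟨b, hb⟩ := hi Mstar
    refine ⟨a - k * b, ?_⟩
    rw [ha, hb] at he
    push_cast at he ⊢
    linarith
  rw [SetLike.mem_coe, hNz, hc, Int.cast_smul_eq_zsmul]
  refine add_mem (Submodule.smul_mem _ _ (Submodule.subset_span ⟨Mstar, by simp, rfl⟩)) ?_
  exact Submodule.span_mono (Set.image_mono Set.subset_union_left) hzint
end

section
/- Let G be a finite simple graph whose vertex set is partitioned as V(G) = U ⊔ K₁ ⊔ K₂ ⊔ {v}, where there are no edges of G between K₁ and K₂. Then for every perfect matching M of G, |M ∩ δ(K₁ ∪ U)| + |M ∩ δ(K₂ ∪ U)| = |M ∩ δ(U)| + 1. -/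
open BigOperators

variable {V : Type*}

theorem mem_cutSet_mk (G : SimpleGraph V) (U : Set V) (a b : V) :
    s(a, b) ∈ cutSet G U ↔ G.Adj a b ∧ ((a ∈ U ∧ b ∉ U) ∨ (b ∈ U ∧ a ∉ U)) := by
  constructor
  · rintro ⟨h, c, d, hcd, hc, hd⟩
    refine ⟨h, ?_⟩
    rcases Sym2.eq_iff.1 hcd with ⟨rfl, rfl⟩ | ⟨rfl, rfl⟩
    · exact Or.inl ⟨hc, hd⟩
    · exact Or.inr ⟨hc, hd⟩
  · rintro ⟨h, ⟨h1, h2⟩ | ⟨h1, h2⟩⟩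
    · exact ⟨h, a, b, rfl, h1, h2⟩
    · exact ⟨h, b, a, Sym2.eq_swap, h1, h2⟩

/-- if `V = U ⊔ K₁ ⊔ K₂ ⊔ {v}` with no edges between `K₁` and `K₂`,
then every perfect matching `M` satisfies
`|M ∩ δ(K₁ ∪ U)| + |M ∩ δ(K₂ ∪ U)| = |M ∩ δ(U)| + 1`. -/
theorem two_separation_cut_identity [Fintype V] [DecidableEq V]
    (G : SimpleGraph V) (U K₁ K₂ : Finset V) (v : V)
    (hUK₁ : Disjoint U K₁) (hUK₂ : Disjoint U K₂) (hK₁K₂ : Disjoint K₁ K₂)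
    (hvU : v ∉ U) (hvK₁ : v ∉ K₁) (hvK₂ : v ∉ K₂)
    (hcover : U ∪ K₁ ∪ K₂ ∪ {v} = Finset.univ)
    (hnoedge : ∀ a ∈ K₁, ∀ b ∈ K₂, ¬ G.Adj a b) :
    ∀ M : G.Subgraph, M.IsPerfectMatching →
      (M.edgeSet ∩ cutSet G ((K₁ : Set V) ∪ (U : Set V))).ncard +
        (M.edgeSet ∩ cutSet G ((K₂ : Set V) ∪ (U : Set V))).ncard =
      (M.edgeSet ∩ cutSet G (U : Set V)).ncard + 1 := by
  intro M hM
  obtain ⟨w, hw, huniq⟩ := hM.1 (hM.2 v)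
  have hc : ∀ x, x ∈ U ∨ x ∈ K₁ ∨ x ∈ K₂ ∨ x = v := by
    intro x
    have hx := Finset.mem_univ x
    rw [← hcover] at hx
    simp only [Finset.mem_union, Finset.mem_singleton] at hx
    tauto
  have d1 : ∀ x, x ∈ U → x ∉ K₁ := fun _ hx => Finset.disjoint_left.1 hUK₁ hx
  have d2 : ∀ x, x ∈ U → x ∉ K₂ := fun _ hx => Finset.disjoint_left.1 hUK₂ hx
  have d3 : ∀ x, x ∈ K₁ → x ∉ K₂ := fun _ hx => Finset.disjoint_left.1 hK₁K₂ hx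
  -- an edge of the matching is the edge at `v` iff it contains `v`
  have key : ∀ a b, M.Adj a b → (s(a, b) = s(v, w) ↔ (a = v ∨ b = v)) := by
    intro a b hab
    rw [Sym2.eq_iff]
    constructor
    · rintro (⟨h, _⟩ | ⟨_, h⟩)
      · exact Or.inl h
      · exact Or.inr h
    · rintro (rfl | rfl)
      · exact Or.inl ⟨rfl, huniq _ hab⟩
      · exact Or.inr ⟨huniq _ hab.symm, rfl⟩
  have hun : (M.edgeSet ∩ cutSet G ((K₁ : Set V) ∪ (U : Set V))) ∪
      (M.edgeSet ∩ cutSet G ((K₂ : Set V) ∪ (U : Set V))) =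
      (M.edgeSet ∩ cutSet G (U : Set V)) ∪ {s(v, w)} := by
    ext e
    induction e using Sym2.ind with
    | _ a b =>
      by_cases hab : M.Adj a b
      · have hk := key a b hab
        have hG := hab.adj_sub
        have hn1 := hnoedge a
        have hn2 := hnoedge b
        have hG' := hG.symm
        have hne := hG.ne
        simp only [Set.mem_union, Set.mem_inter_iff, SimpleGraph.Subgraph.mem_edgeSet,
          mem_cutSet_mk, Set.mem_singleton_iff, hk, Finset.mem_coe, hab, hG, true_and]
        have := hc a
        have := hc b
        grind
      · have hne : s(a, b) ≠ s(v, w) := by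
          intro h
          apply hab
          rw [← SimpleGraph.Subgraph.mem_edgeSet, h]
          exact hw
        simp [hab, hne]
  have hint : (M.edgeSet ∩ cutSet G ((K₁ : Set V) ∪ (U : Set V))) ∩
      (M.edgeSet ∩ cutSet G ((K₂ : Set V) ∪ (U : Set V))) =
      (M.edgeSet ∩ cutSet G (U : Set V)) ∩ {s(v, w)} := by
    ext e
    induction e using Sym2.ind with
    | _ a b =>
      by_cases hab : M.Adj a b
      · have hk := key a b hab
        have hG := hab.adj_sub
        have hn1 := hnoedge a
        have hn2 := hnoedge b
        have hG' := hG.symm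
        have hne := hG.ne
        simp only [Set.mem_union, Set.mem_inter_iff, SimpleGraph.Subgraph.mem_edgeSet,
          mem_cutSet_mk, Set.mem_singleton_iff, hk, Finset.mem_coe, hab, hG, true_and]
        have := hc a
        have := hc b
        grind
      · simp [hab]
  rw [← Set.ncard_union_add_ncard_inter _ _ (Set.toFinite _) (Set.toFinite _), hun, hint,
    Set.ncard_union_add_ncard_inter _ _ (Set.toFinite _) (Set.toFinite _), Set.ncard_singleton]
end

section
/- Let G be a finite simple graph whose vertex set is partitioned as V(G) = U ⊔ B ⊔ K₁ ⊔ … ⊔ K_t with t = |B| + 1, where there are no edges of G between K_i and K_j for i ≠ j, and where |U| is odd and each |K_i| is odd. Then every perfect matching M of G with |M ∩ δ(U)| = 1 satisfies |M ∩ δ(K_i)| = 1 for every i, and M contains no edge with both endpoints in B nor any edge between B and U. -/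
open BigOperators

variable {V : Type*}

/-- The set `E'` of edges of `G` with both endpoints in `B`, or one endpoint in
`B` and the other in `U`. -/
def bEdges [DecidableEq V] (G : SimpleGraph V) (B U : Finset V) : Set (Sym2 V) :=
  {e | e ∈ G.edgeSet ∧ ∃ a b, e = s(a, b) ∧ a ∈ B ∧ (b ∈ B ∨ b ∈ U)}

theorem aux_cut_card [Fintype V] [DecidableEq V] (G : SimpleGraph V) (M : G.Subgraph)
    (f : V → V) (hf : ∀ v w, M.Adj v w ↔ w = f v) (S : Finset V) :
    (M.edgeSet ∩ cutSet G (S : Set V)).ncard = (S.filter (fun v => f v ∉ S)).card := by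
  have himg : M.edgeSet ∩ cutSet G (S : Set V)
      = (fun v => s(v, f v)) '' ((S.filter (fun v => f v ∉ S) : Finset V) : Set V) := by
    ext e
    constructor
    · rintro ⟨h1, -, a, b, rfl, ha, hb⟩
      have h2 : M.Adj a b := h1
      rw [hf] at h2
      subst h2
      exact ⟨a, by simpa using ⟨ha, hb⟩, rfl⟩
    · rintro ⟨v, hv, rfl⟩
      have hv' : v ∈ S ∧ f v ∉ S := by simpa using hv
      have hadj : M.Adj v (f v) := (hf _ _).2 rfl
      exact ⟨hadj, hadj.adj_sub, v, f v, rfl, by simpa using hv'.1, by simpa using hv'.2⟩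
  rw [himg, Set.InjOn.ncard_image, Set.ncard_coe_finset]
  intro v hv w hw h
  have hv' : v ∈ S ∧ f v ∉ S := by simpa using hv
  have hw' : w ∈ S ∧ f w ∉ S := by simpa using hw
  rcases Sym2.eq_iff.1 h with h | h
  · exact h.1
  · exact absurd (h.1 ▸ hv'.1) hw'.2

theorem aux_odd_pos [Fintype V] [DecidableEq V] (f : V → V) (hinv : ∀ v, f (f v) = v)
    (hne : ∀ v, f v ≠ v) (S : Finset V) (hS : Odd S.card) :
    1 ≤ (S.filter (fun v => f v ∉ S)).card := by
  by_contra hcon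
  have h0 : S.filter (fun v => f v ∉ S) = ∅ := by
    rw [← Finset.card_eq_zero]; omega
  have hmem : ∀ v ∈ S, f v ∈ S := by
    intro v hv
    by_contra h
    have : v ∈ S.filter (fun v => f v ∉ S) := Finset.mem_filter.2 ⟨hv, h⟩
    simp [h0] at this
  have hsum : ∑ _v ∈ S, (1 : ZMod 2) = 0 :=
    Finset.sum_involution (fun v _ => f v) (fun _ _ => by decide) (fun v _ _ => hne v)
      (fun v hv => hmem v hv) (fun v _ => hinv v)
  rw [Finset.sum_const, nsmul_one, ZMod.natCast_eq_zero_iff_even] at hsum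
  exact (Nat.not_even_iff_odd.2 hS) hsum

/-- if `V = U ⊔ B ⊔ K₁ ⊔ … ⊔ K_t` with `t = |B| + 1`, no edges
between distinct `K i`, and `U` and all `K i` odd, then every perfect matching
meeting `δ(U)` once meets each `δ(K i)` once and avoids edges within `B` and
between `B` and `U`. -/
theorem barrier_cut_tightness [Fintype V] [DecidableEq V]
    (G : SimpleGraph V) (U B : Finset V) (t : ℕ) (K : Fin t → Finset V)
    (ht : t = B.card + 1)
    (hUB : Disjoint U B)
    (hUK : ∀ i, Disjoint U (K i)) (hBK : ∀ i, Disjoint B (K i))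
    (hKK : ∀ i j, i ≠ j → Disjoint (K i) (K j))
    (hcover : U ∪ B ∪ (Finset.univ : Finset (Fin t)).biUnion K = Finset.univ)
    (hnoedge : ∀ i j, i ≠ j → ∀ a ∈ K i, ∀ b ∈ K j, ¬ G.Adj a b)
    (hUodd : Odd U.card) (hKodd : ∀ i, Odd (K i).card) :
    ∀ M : G.Subgraph, M.IsPerfectMatching →
      (M.edgeSet ∩ cutSet G (U : Set V)).ncard = 1 →
        (∀ i, (M.edgeSet ∩ cutSet G ((K i : Set V))).ncard = 1) ∧
          M.edgeSet ∩ bEdges G B U = ∅ := by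
  intro M hM hcut
  have hex : ∀ v, ∃! w, M.Adj v w := SimpleGraph.Subgraph.isPerfectMatching_iff.1 hM
  choose f hf1 hf2 using hex
  have hf : ∀ v w, M.Adj v w ↔ w = f v :=
    fun v w => ⟨fun h => hf2 v w h, fun h => h ▸ hf1 v⟩
  have hinv : ∀ v, f (f v) = v := fun v => ((hf _ _).1 (hf1 v).symm).symm
  have hne : ∀ v, f v ≠ v := fun v h => (hf1 v).ne h.symm
  have hinj : Function.Injective f := fun a b h => by rw [← hinv a, h, hinv]
  rw [aux_cut_card G M f hf] at hcut
  set O : Finset V → Finset V := fun S => S.filter (fun v => f v ∉ S) with hO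
  have hpos : ∀ i, 1 ≤ (O (K i)).card := fun i => aux_odd_pos f hinv hne _ (hKodd i)
  have hdisj : ∀ i j, i ≠ j → Disjoint (O (K i)) (O (K j)) := fun i j hij =>
    Finset.disjoint_of_subset_left (Finset.filter_subset _ _)
      (Finset.disjoint_of_subset_right (Finset.filter_subset _ _) (hKK i j hij))
  set A := (Finset.univ : Finset (Fin t)).biUnion (fun i => O (K i)) with hA
  have hAcard : A.card = ∑ i, (O (K i)).card :=
    Finset.card_biUnion (fun i _ j _ hij => hdisj i j hij)
  have hsub : A.image f ⊆ B ∪ O U := by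
    intro w hw
    obtain ⟨v, hv, rfl⟩ := Finset.mem_image.1 hw
    obtain ⟨i, -, hi⟩ := Finset.mem_biUnion.1 hv
    obtain ⟨hvK, hfv⟩ := Finset.mem_filter.1 hi
    have hc : f v ∈ U ∪ B ∪ (Finset.univ : Finset (Fin t)).biUnion K := by
      rw [hcover]; exact Finset.mem_univ _
    rcases Finset.mem_union.1 hc with hc | hc
    · rcases Finset.mem_union.1 hc with hc | hc
      · refine Finset.mem_union_right _ (Finset.mem_filter.2 ⟨hc, ?_⟩)
        rw [hinv]
        exact fun h => Finset.disjoint_left.1 (hUK i) h hvK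
      · exact Finset.mem_union_left _ hc
    · obtain ⟨j, -, hj⟩ := Finset.mem_biUnion.1 hc
      have hij : i ≠ j := by rintro rfl; exact hfv hj
      exact absurd (hf1 v).adj_sub (hnoedge i j hij v hvK _ hj)
  have hBU : (B ∪ O U).card ≤ B.card + 1 := by
    have := Finset.card_union_le B (O U)
    have h2 : (O U).card = 1 := hcut
    omega
  have himc : (A.image f).card = A.card := Finset.card_image_of_injective _ hinj
  have hle : A.card ≤ B.card + 1 := by
    rw [← himc]; exact (Finset.card_le_card hsub).trans hBU
  have hge : ∑ _i : Fin t, 1 ≤ ∑ i, (O (K i)).card := Finset.sum_le_sum (fun i _ => hpos i)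
  have ht1 : ∑ _i : Fin t, 1 = B.card + 1 := by simp [ht]
  have heq : ∑ _i : Fin t, 1 = ∑ i, (O (K i)).card := by omega
  have hall := (Finset.sum_eq_sum_iff_of_le (fun i _ => hpos i)).1 heq
  have himeq : A.image f = B ∪ O U := Finset.eq_of_subset_of_card_le hsub (by omega)
  refine ⟨fun i => ?_, ?_⟩
  · rw [aux_cut_card G M f hf]
    exact (hall i (Finset.mem_univ _)).symm
  · rw [Set.eq_empty_iff_forall_notMem]
    rintro e ⟨h1, -, a, b, rfl, ha, hb⟩
    have h2 : M.Adj a b := h1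
    rw [hf] at h2
    have ham : a ∈ A.image f := by rw [himeq]; exact Finset.mem_union_left _ ha
    obtain ⟨v, hv, hva⟩ := Finset.mem_image.1 ham
    obtain ⟨i, -, hi⟩ := Finset.mem_biUnion.1 hv
    have hvK := (Finset.mem_filter.1 hi).1
    have hbv : b = v := by rw [h2, ← hva, hinv]
    subst hbv
    rcases hb with hb | hb
    · exact Finset.disjoint_left.1 (hBK i) hb hvK
    · exact Finset.disjoint_left.1 (hUK i) hb hvK
end
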